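/- Let d ≥ 2, let P_1, …, P_{d−2} be convex bodies in ℝ^d, and let η_1, …, η_n be convex bodies in ℝ^d. Define the symmetric n×n real matrix AF by AF_{ij} = V(η_i, η_j, P_1, …, P_{d−2}). If AF is not the zero matrix, then AF has exactly one positive eigenvalue, counted with multiplicity. -/

import Mathlib

open Pointwise MeasureTheory

/-- The mixed volume of `d` convex bodies in `ℝ^d`:
`V(P_1, …, P_d) = ∑_{S ⊆ {1,…,d}} (−1)^{d−|S|} vol(∑_{i∈S} P_i)`. -/
noncomputable def mixedVolume {d : ℕ} (P : Fin d → Set (EuclideanSpace ℝ (Fin d))) : ℝ :=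
  ∑ S : Finset (Fin d), (-1 : ℝ) ^ (d - S.card) * (volume (∑ i ∈ S, P i)).toReal

/-- A form dominated by the squared length of a linear image `b`, whose polarisation through `b`
is a symmetric operator with top eigenvalue `1`, is nonpositive off the top eigenvector. -/
theorem form_nonpos_of_le_norm_sq {V E : Type*} [AddCommGroup V] [Module ℝ V]
    [NormedAddCommGroup E] [InnerProductSpace ℝ E] [FiniteDimensional ℝ E]
    (Q : V →ₗ[ℝ] V →ₗ[ℝ] ℝ) (hQ : ∀ x y, Q x y = Q y x) (b : V →ₗ[ℝ] E) (j : E →ₗ[ℝ] V)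
    (hbj : ∀ y φ, Q y (j φ) = inner ℝ (b y) φ) (hle : ∀ y, Q y y ≤ ‖b y‖ ^ 2) (ψ : E)
    (hψ : b (j ψ) = ψ) (hone : ∀ φ, inner ℝ (b (j φ)) φ ≤ ‖φ‖ ^ 2)
    (hfix : ∀ φ, b (j φ) = φ → inner ℝ φ ψ = 0 → φ = 0) (y : V) (hy : inner ℝ (b y) ψ = 0) :
    Q y y ≤ 0 := by
  set T : E →ₗ[ℝ] E := b ∘ₗ j with hT
  have hsym : T.IsSymmetric := by
    intro φ χ
    have h1 := hbj (j φ) χ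
    have h2 := hbj (j χ) φ
    simp only [hT, LinearMap.comp_apply]
    rw [← h1, real_inner_comm, ← h2, hQ]
  -- the form is nonpositive on the orthogonal complement of `ψ`
  have hneg : ∀ φ, inner ℝ φ ψ = 0 → inner ℝ (T φ) φ ≤ 0 := by
    intro φ hφ
    set B := hsym.eigenvectorBasis rfl with hB
    set ev := hsym.eigenvalues rfl with hev
    have hTB : ∀ k, T (B k) = ev k • B k := fun k => hsym.apply_eigenvectorBasis rfl k
    have hnorm : ∀ k, ‖B k‖ = 1 := fun k => B.orthonormal.1 k
    have hBB : ∀ k, inner ℝ (B k) (B k) = (1 : ℝ) := fun k => by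
      rw [real_inner_self_eq_norm_sq, hnorm]; norm_num
    have hev1 : ∀ k, ev k ≤ 1 := by
      intro k
      have := hone (B k)
      change inner ℝ (T (B k)) (B k) ≤ _ at this
      rw [hTB, inner_smul_left, hBB, hnorm] at this
      simpa using this
    have hev2 : ∀ k, ev k ≤ ev k ^ 2 := by
      intro k
      have := hle (j (B k))
      rw [hbj] at this
      change inner ℝ (T (B k)) (B k) ≤ ‖T (B k)‖ ^ 2 at this
      rw [hTB, inner_smul_left, hBB, norm_smul, hnorm] at this
      simpa using this
    rw [← B.sum_inner_mul_inner]
    apply Finset.sum_nonpos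
    intro k _
    have h1 : inner ℝ (T φ) (B k) = ev k * inner ℝ φ (B k) := by
      rw [hsym, hTB, inner_smul_right]
    rw [h1, real_inner_comm φ (B k)]
    by_cases hk : ev k = 1
    · have : inner ℝ (B k) ψ = 0 ∨ inner ℝ (B k) ψ ≠ 0 := by tauto
      -- `B k` is proportional to `ψ`
      have hz : B k - (inner ℝ (B k) ψ / inner ℝ ψ ψ : ℝ) • ψ = 0 := by
        apply hfix
        · rw [map_sub, map_sub, map_smul, map_smul, hψ]
          congr 1
          have := hTB k
          rw [hk, one_smul] at this
          exact this
        · rw [inner_sub_left, inner_smul_left]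
          by_cases h0 : ψ = 0
          · simp [h0]
          · have : inner ℝ ψ ψ ≠ (0 : ℝ) := inner_self_ne_zero.mpr h0
            simp; field_simp; simp
      have : B k = (inner ℝ (B k) ψ / inner ℝ ψ ψ : ℝ) • ψ := sub_eq_zero.mp hz
      have h3 : inner ℝ φ (B k) = 0 := by rw [this, inner_smul_right, hφ, mul_zero]
      simp [h3]
    · have hlt : ev k < 1 := lt_of_le_of_ne (hev1 k) hk
      have : ev k ≤ 0 := by nlinarith [hev2 k]
      nlinarith [mul_self_nonneg (inner ℝ φ (B k) : ℝ)]
  -- `b y` lies in the range of `T`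
  have hrange : b y ∈ LinearMap.range T := by
    have : LinearMap.range T = (LinearMap.ker T)ᗮ := by
      rw [← hsym.orthogonal_range, Submodule.orthogonal_orthogonal]
    rw [this, Submodule.mem_orthogonal]
    intro z hz
    have hz' : b (j z) = 0 := hz
    have key : ∀ t : ℝ, Q y y + 2 * t * inner ℝ (b y) z ≤ ‖b y‖ ^ 2 := by
      intro t
      have := hle (y + t • j z)
      rw [map_add b, map_smul b, hz', smul_zero, add_zero] at this
      simp only [map_add, map_smul, LinearMap.add_apply, LinearMap.smul_apply, smul_eq_mul] at this
      rw [hQ (j z) y, hbj, hbj, hz', inner_zero_left] at this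
      linarith
    rw [real_inner_comm]
    by_contra hne
    have := key ((‖b y‖ ^ 2 - Q y y + 1) / (2 * inner ℝ (b y) z))
    have e : 2 * ((‖b y‖ ^ 2 - Q y y + 1) / (2 * inner ℝ (b y) z)) * inner ℝ (b y) z
        = ‖b y‖ ^ 2 - Q y y + 1 := by field_simp
    linarith
  obtain ⟨φ, hφ⟩ := hrange
  have hφψ : inner ℝ φ ψ = 0 := by
    have : inner ℝ (T φ) ψ = inner ℝ φ (T ψ) := hsym φ ψ
    rw [hφ, hy] at this
    rw [show T ψ = ψ from hψ] at this
    exact this.symm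
  have h1 := hle (y - j φ)
  have h2 : b (y - j φ) = 0 := by rw [map_sub, sub_eq_zero]; exact hφ.symm
  rw [h2] at h1
  simp only [map_sub, LinearMap.sub_apply] at h1
  rw [hQ (j φ) y, hbj, hbj] at h1
  have h3 := hneg φ hφψ
  have h4 : inner ℝ (b (j φ)) φ = inner ℝ (T φ) φ := rfl
  rw [h4, ← hφ] at h1
  simp at h1
  linarith

/-- The linear algebra behind the inductive step of the Alexandrov–Fenchel inequality. -/
theorem form_nonpos_of_local_inequality {V σ : Type*} [AddCommGroup V] [Module ℝ V] [Fintype σ]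
    (Q : V →ₗ[ℝ] V →ₗ[ℝ] ℝ) (hQ : ∀ x y, Q x y = Q y x) (e : σ → V) (s : σ → ℝ)
    (hs : ∀ i, 0 < s i) (v : V) (hv : ∀ y, Q y v = ∑ i, s i * Q y (e i))
    (hq : ∀ i, 0 < Q (e i) v)
    (hle : ∀ y, Q y y ≤ ∑ i, s i * (Q y (e i)) ^ 2 / Q (e i) v)
    (hoff : ∀ i j, i ≠ j → 0 ≤ Q (e i) (e j))
    (hconn : ∀ z : σ → ℝ, (∀ i j, i ≠ j → 0 < Q (e i) (e j) → z i = z j) → ∀ i j, z i = z j)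
    (y : V) (hy : Q y v = 0) : Q y y ≤ 0 := by
  classical
  set p : σ → ℝ := fun i => Real.sqrt (Q (e i) v / s i) with hp
  have hp0 : ∀ i, 0 < p i := fun i => Real.sqrt_pos.mpr (div_pos (hq i) (hs i))
  have hp2 : ∀ i, p i ^ 2 = Q (e i) v / s i := fun i =>
    Real.sq_sqrt (div_pos (hq i) (hs i)).le
  have hqp : ∀ i, Q (e i) v = s i * p i ^ 2 := fun i => by
    rw [hp2]; have := (hs i).ne'; field_simp
  let b : V →ₗ[ℝ] EuclideanSpace ℝ σ :=
    (WithLp.linearEquiv 2 ℝ (σ → ℝ)).symm.toLinearMap ∘ₗ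
      LinearMap.pi (fun i => (p i)⁻¹ • (Q.flip (e i)))
  have hb : ∀ y i, b y i = Q y (e i) / p i := fun y i => by
    simp [b, div_eq_inv_mul]
  let j : EuclideanSpace ℝ σ →ₗ[ℝ] V :=
    (∑ i, ((p i)⁻¹ • LinearMap.toSpanSingleton ℝ V (e i)) ∘ₗ
        (LinearMap.proj i : (σ → ℝ) →ₗ[ℝ] ℝ)) ∘ₗ
      (WithLp.linearEquiv 2 ℝ (σ → ℝ)).toLinearMap
  have hj : ∀ φ, j φ = ∑ i, (φ i / p i) • e i := fun φ => by
    simp [j, smul_smul, div_eq_inv_mul]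
  have hQj : ∀ y φ, Q y (j φ) = ∑ i, (φ i / p i) * Q y (e i) := fun y φ => by
    rw [hj, map_sum]; simp
  have hinner : ∀ x y : EuclideanSpace ℝ σ, inner ℝ x y = ∑ i, x i * y i := fun x y => by
    rw [PiLp.inner_apply]; simp [mul_comm]
  let ψ : EuclideanSpace ℝ σ := WithLp.toLp 2 (fun i => s i * p i)
  have hψi : ∀ i, ψ i = s i * p i := fun i => rfl
  have hnn : ∀ x : EuclideanSpace ℝ σ, ‖x‖ ^ 2 = ∑ i, x i ^ 2 := fun x => by
    rw [← real_inner_self_eq_norm_sq, hinner]; simp [sq]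
  -- the gap between the norm and the form, written through the weights `s`
  have hgap : ∀ z : σ → ℝ, ∀ φ : EuclideanSpace ℝ σ, (∀ i, φ i = z i * (s i * p i)) →
      ‖φ‖ ^ 2 - inner ℝ (b (j φ)) φ
        = (1 / 2) * ∑ i, ∑ k, s i * s k * Q (e i) (e k) * (z i - z k) ^ 2 := by
    intro z φ hφ
    have e1 : ∀ i, φ i ^ 2 = ∑ k, s i * s k * Q (e i) (e k) * z i ^ 2 := by
      intro i
      have : s i * p i ^ 2 = ∑ k, s k * Q (e i) (e k) := by rw [← hqp, hv]
      calc φ i ^ 2 = (s i * p i ^ 2) * (s i * z i ^ 2) := by rw [hφ]; ring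
        _ = _ := by rw [this, Finset.sum_mul]; exact Finset.sum_congr rfl fun k _ => by ring
    have e2 : inner ℝ (b (j φ)) φ = ∑ i, ∑ k, s i * s k * Q (e i) (e k) * (z i * z k) := by
      rw [hinner]
      refine Finset.sum_congr rfl fun i _ => ?_
      rw [hb, hQ, hQj, hφ, Finset.sum_div, Finset.sum_mul]
      refine Finset.sum_congr rfl fun k _ => ?_
      rw [hφ]
      have := (hp0 i).ne'; have := (hp0 k).ne'
      field_simp
    have e3 : ∑ i, ∑ k, s i * s k * Q (e i) (e k) * z i ^ 2
        = ∑ i, ∑ k, s i * s k * Q (e i) (e k) * z k ^ 2 := by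
      rw [Finset.sum_comm]
      refine Finset.sum_congr rfl fun i _ => Finset.sum_congr rfl fun k _ => ?_
      rw [hQ (e k) (e i)]; ring
    have e4 : ∑ i, ∑ k, s i * s k * Q (e i) (e k) * (z i - z k) ^ 2
        = ∑ i, ∑ k, s i * s k * Q (e i) (e k) * z i ^ 2
        + ∑ i, ∑ k, s i * s k * Q (e i) (e k) * z k ^ 2
        - 2 * ∑ i, ∑ k, s i * s k * Q (e i) (e k) * (z i * z k) := by
      simp only [Finset.mul_sum, ← Finset.sum_add_distrib, ← Finset.sum_sub_distrib]
      exact Finset.sum_congr rfl fun i _ => Finset.sum_congr rfl fun k _ => by ring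
    rw [hnn, e2, e4, ← e3, Finset.sum_congr rfl fun i _ => e1 i]
    ring
  have hterm : ∀ z : σ → ℝ, ∀ i k, 0 ≤ s i * s k * Q (e i) (e k) * (z i - z k) ^ 2 := by
    intro z i k
    by_cases hik : i = k
    · simp [hik]
    · exact mul_nonneg (mul_nonneg (mul_nonneg (hs i).le (hs k).le) (hoff i k hik)) (sq_nonneg _)
  have hz : ∀ φ : EuclideanSpace ℝ σ, ∀ i, φ i = (φ i / (s i * p i)) * (s i * p i) := by
    intro φ i
    have := (hp0 i).ne'; have := (hs i).ne'
    field_simp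
  have hbψ : ∀ y, inner ℝ (b y) ψ = Q y v := by
    intro y
    rw [hinner, hv]
    refine Finset.sum_congr rfl fun i _ => ?_
    rw [hb, hψi]
    have := (hp0 i).ne'
    field_simp
  refine form_nonpos_of_le_norm_sq Q hQ b j ?_ ?_ ψ ?_ ?_ ?_ y (by rw [hbψ, hy])
  · intro y φ
    rw [hQj, hinner]
    refine Finset.sum_congr rfl fun i _ => ?_
    rw [hb]; ring
  · intro y
    refine (hle y).trans (le_of_eq ?_)
    rw [hnn]
    refine Finset.sum_congr rfl fun i _ => ?_
    rw [hb, div_pow, hqp]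
    have := (hp0 i).ne'; have := (hs i).ne'
    field_simp
  · ext i
    rw [hb, hQ, hQj, hψi]
    have : ∑ k, ψ k / p k * Q (e i) (e k) = s i * p i ^ 2 := by
      rw [← hqp, hv]
      refine Finset.sum_congr rfl fun k _ => ?_
      rw [hψi]
      have := (hp0 k).ne'
      field_simp
    rw [this]
    have := (hp0 i).ne'
    field_simp
  · intro φ
    have := hgap _ φ (hz φ)
    have h2 : 0 ≤ ∑ i, ∑ k, s i * s k * Q (e i) (e k) *
        (φ i / (s i * p i) - φ k / (s k * p k)) ^ 2 :=
      Finset.sum_nonneg fun i _ => Finset.sum_nonneg fun k _ =>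
        hterm (fun i => φ i / (s i * p i)) i k
    linarith
  · intro φ hφ hφψ
    have h1 := hgap _ φ (hz φ)
    rw [hφ, real_inner_self_eq_norm_sq, sub_self] at h1
    set z : σ → ℝ := fun i => φ i / (s i * p i) with hzdef
    have h2 : ∑ i, ∑ k, s i * s k * Q (e i) (e k) * (z i - z k) ^ 2 = 0 := by
      simp only [hzdef]; linarith
    rw [Finset.sum_eq_zero_iff_of_nonneg
      (fun i _ => Finset.sum_nonneg fun k _ => hterm z i k)] at h2
    have h3 : ∀ i k, s i * s k * Q (e i) (e k) * (z i - z k) ^ 2 = 0 := fun i k =>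
      (Finset.sum_eq_zero_iff_of_nonneg (fun k _ => hterm z i k)).mp (h2 i (Finset.mem_univ _)) k
        (Finset.mem_univ _)
    have h4 := hconn z (fun i k _ hpos => by
      have := h3 i k
      have hne : s i * s k * Q (e i) (e k) ≠ 0 :=
        (mul_pos (mul_pos (hs i) (hs k)) hpos).ne'
      have := (mul_eq_zero.mp this).resolve_left hne
      exact sub_eq_zero.mp (pow_eq_zero_iff (two_ne_zero) |>.mp this))
    ext i
    have h5 : inner ℝ φ ψ = z i * ∑ k, (s k * p k) ^ 2 := by
      rw [hinner, Finset.mul_sum]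
      refine Finset.sum_congr rfl fun k _ => ?_
      have hzk : φ k = z k * (s k * p k) := hz φ k
      rw [h4 i k, hψi, hzk]; ring
    have h6 : 0 < ∑ k, (s k * p k) ^ 2 :=
      Finset.sum_pos (fun k _ => pow_pos (mul_pos (hs k) (hp0 k)) 2) ⟨i, Finset.mem_univ _⟩
    rw [h5] at hφψ
    have h7 := (mul_eq_zero.mp hφψ).resolve_right h6.ne'
    rw [hz φ i]
    change z i * _ = _
    rw [h7]; simp

theorem const_of_form_nonpos {V σ : Type*} [AddCommGroup V] [Module ℝ V] [Fintype σ]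
    (Q : V →ₗ[ℝ] V →ₗ[ℝ] ℝ) (hQ : ∀ x y, Q x y = Q y x) (e : σ → V) (s : σ → ℝ)
    (hs : ∀ i, 0 < s i) (v : V) (hv : ∀ y, Q y v = ∑ i, s i * Q y (e i))
    (hq : ∀ i, 0 < Q (e i) v) (hneg : ∀ y, Q y v = 0 → Q y y ≤ 0)
    (z : σ → ℝ) (hz : ∀ i j, i ≠ j → Q (e i) (e j) ≠ 0 → z i = z j) (i j : σ) : z i = z j := by
  set W : ℝ := ∑ i, s i * Q (e i) v with hW
  have hW0 : 0 < W := Finset.sum_pos (fun i _ => mul_pos (hs i) (hq i)) ⟨i, Finset.mem_univ _⟩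
  set c : ℝ := (∑ i, z i * (s i * Q (e i) v)) / W with hc
  set y : V := ∑ i, ((z i - c) * s i) • e i with hy
  have hyl : ∀ x, Q y x = ∑ i, (z i - c) * s i * Q (e i) x := fun x => by
    rw [hy, map_sum, LinearMap.sum_apply]; simp
  have h0 : Q y v = 0 := by
    rw [hyl]
    have : ∑ i, (z i - c) * s i * Q (e i) v
        = ∑ i, z i * (s i * Q (e i) v) - c * W := by
      rw [hW, Finset.mul_sum, ← Finset.sum_sub_distrib]
      exact Finset.sum_congr rfl fun i _ => by ring
    rw [this, hc]; field_simp; ring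
  have h1 : Q y y = ∑ i, (z i - c) ^ 2 * (s i * Q (e i) v) := by
    rw [hyl]
    refine Finset.sum_congr rfl fun i _ => ?_
    rw [hQ, hyl, hv, Finset.mul_sum, Finset.mul_sum, Finset.mul_sum]
    refine Finset.sum_congr rfl fun k _ => ?_
    by_cases hik : i = k
    · subst hik; ring
    · by_cases h : Q (e i) (e k) = 0
      · rw [hQ (e k), h]; ring
      · rw [hz i k hik h, hQ (e k)]; ring
  have h2 := hneg y h0
  rw [h1] at h2
  have h3 : ∀ i ∈ Finset.univ, 0 ≤ (z i - c) ^ 2 * (s i * Q (e i) v) := fun i _ =>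
    mul_nonneg (sq_nonneg _) (mul_pos (hs i) (hq i)).le
  have h4 := (Finset.sum_eq_zero_iff_of_nonneg h3).mp (le_antisymm h2 (Finset.sum_nonneg h3))
  have h5 : ∀ i, z i = c := fun i => by
    have := (mul_eq_zero.mp (h4 i (Finset.mem_univ _))).resolve_right
      (mul_pos (hs i) (hq i)).ne'
    exact sub_eq_zero.mp (pow_eq_zero_iff two_ne_zero |>.mp this)
  rw [h5 i, h5 j]

/-- A symmetric form that is nonpositive on the complement of one vector satisfies the reversed
Cauchy–Schwarz inequality against every vector of positive length. -/
theorem reverse_cauchy_schwarz {V : Type*} [AddCommGroup V] [Module ℝ V]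
    (Q : V →ₗ[ℝ] V →ₗ[ℝ] ℝ) (hQ : ∀ x y, Q x y = Q y x) (v : V)
    (hneg : ∀ y, Q y v = 0 → Q y y ≤ 0) (w : V) (hw : 0 < Q w w) (y : V) :
    Q y y * Q w w ≤ Q y w ^ 2 := by
  have key : ∀ y, Q y w = 0 → Q y y ≤ 0 := by
    intro y hyw
    by_contra! hpos
    set z := Q w v • y - Q y v • w with hz
    have h0 : Q z v = 0 := by
      simp only [hz, map_sub, map_smul, LinearMap.sub_apply, LinearMap.smul_apply, smul_eq_mul]
      ring
    have h1 := hneg z h0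
    have h2 : Q z z = Q w v ^ 2 * Q y y + Q y v ^ 2 * Q w w := by
      simp only [hz, map_sub, map_smul, LinearMap.sub_apply, LinearMap.smul_apply, smul_eq_mul]
      rw [hQ w y, hyw]; ring
    rw [h2] at h1
    have h3 : Q w v = 0 := by
      by_contra h
      have : 0 < Q w v ^ 2 := by positivity
      nlinarith [mul_pos this hpos, mul_nonneg (sq_nonneg (Q y v)) hw.le]
    exact absurd (hneg w h3) (not_le.mpr hw)
  have h := key (y - (Q y w / Q w w) • w) (by
    simp only [map_sub, map_smul, LinearMap.sub_apply, LinearMap.smul_apply, smul_eq_mul]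
    field_simp; ring)
  simp only [map_sub, map_smul, LinearMap.sub_apply, LinearMap.smul_apply, smul_eq_mul] at h
  rw [hQ w y] at h
  have h2 : Q y y - Q y w / Q w w * Q y w -
      Q y w / Q w w * (Q y w - Q y w / Q w w * Q w w) = Q y y - Q y w ^ 2 / Q w w := by
    field_simp; ring
  have h3 : Q y y ≤ Q y w ^ 2 / Q w w := by linarith [h2 ▸ h]
  rwa [le_div_iff₀ hw] at h3

open MvPolynomial in
/-- The directional derivative of a polynomial. -/
noncomputable def dirD {ι : Type*} (y : ι → ℝ) :
    Derivation ℝ (MvPolynomial ι ℝ) (MvPolynomial ι ℝ) :=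
  mkDerivation ℝ fun i => C (y i)

section dirD
variable {ι : Type*}
open MvPolynomial

@[simp] theorem dirD_X (y : ι → ℝ) (i : ι) : dirD y (X i) = C (y i) := by
  simp [dirD]

theorem dirD_add (x y : ι → ℝ) (q : MvPolynomial ι ℝ) :
    dirD (x + y) q = dirD x q + dirD y q := by
  have : dirD (x + y) = dirD x + dirD y := by
    apply MvPolynomial.derivation_ext; intro i; simp
  rw [this]; rfl

theorem dirD_smul (a : ℝ) (y : ι → ℝ) (q : MvPolynomial ι ℝ) :
    dirD (a • y) q = a • dirD y q := by
  have : dirD (a • y) = a • dirD y := by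
    apply MvPolynomial.derivation_ext; intro i; simp [MvPolynomial.smul_eq_C_mul]
  rw [this]; rfl

theorem dirD_comm (x y : ι → ℝ) (q : MvPolynomial ι ℝ) :
    dirD x (dirD y q) = dirD y (dirD x q) := by
  have : ⁅dirD x, dirD y⁆ = 0 := by
    apply MvPolynomial.derivation_ext; intro i
    simp [Derivation.commutator_apply]
  have h := congrArg (fun D => D q) this
  simp only [Derivation.commutator_apply, Derivation.coe_zero, Pi.zero_apply] at h
  exact sub_eq_zero.mp h

/-- The directional derivative as a linear function of the direction. -/
noncomputable def dirDₗ (q : MvPolynomial ι ℝ) : (ι → ℝ) →ₗ[ℝ] MvPolynomial ι ℝ where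
  toFun y := dirD y q
  map_add' x y := dirD_add x y q
  map_smul' a y := dirD_smul a y q

theorem dirD_eq_sum [Fintype ι] [DecidableEq ι] (y : ι → ℝ) (q : MvPolynomial ι ℝ) :
    dirD y q = ∑ i, y i • dirD (Pi.single i 1) q := by
  change dirDₗ q y = ∑ i, y i • dirDₗ q (Pi.single i 1)
  conv_lhs => rw [pi_eq_sum_univ' y, map_sum]
  refine Finset.sum_congr rfl fun i _ => ?_
  rw [map_smul]

theorem dirD_single [DecidableEq ι] (i : ι) (q : MvPolynomial ι ℝ) :
    dirD (Pi.single i 1) q = pderiv i q := by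
  have : dirD (Pi.single i (1 : ℝ)) = pderiv i := by
    apply MvPolynomial.derivation_ext; intro j
    rw [dirD_X, pderiv_X]
    by_cases h : i = j
    · subst h; simp
    · simp [Ne.symm h]
  rw [this]

theorem IsHomogeneous.dirD [Fintype ι] {q : MvPolynomial ι ℝ} {n : ℕ}
    (hq : q.IsHomogeneous (n + 1)) (y : ι → ℝ) : (dirD y q).IsHomogeneous n := by
  classical
  rw [dirD_eq_sum]
  refine MvPolynomial.IsHomogeneous.sum _ _ _ fun i _ => ?_
  rw [dirD_single, MvPolynomial.smul_eq_C_mul]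
  have := (MvPolynomial.isHomogeneous_C ι (y i)).mul (hq.pderiv (i := i))
  simpa using this

theorem eval_dirD_self [Fintype ι] {q : MvPolynomial ι ℝ} {n : ℕ}
    (hq : q.IsHomogeneous n) (w : ι → ℝ) : eval w (dirD w q) = n * eval w q := by
  classical
  rw [dirD_eq_sum, map_sum]
  have h := congrArg (eval w) hq.sum_X_mul_pderiv
  simp only [map_sum, map_mul, eval_X, nsmul_eq_mul, map_natCast] at h
  rw [← h]
  refine Finset.sum_congr rfl fun i _ => ?_
  rw [dirD_single]; simp [MvPolynomial.smul_eval]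

/-- Iterated directional derivatives. -/
noncomputable def iterD (ys : List (ι → ℝ)) (q : MvPolynomial ι ℝ) : MvPolynomial ι ℝ :=
  ys.foldr (fun y r => dirD y r) q

@[simp] theorem iterD_nil (q : MvPolynomial ι ℝ) : iterD [] q = q := rfl

@[simp] theorem iterD_cons (y : ι → ℝ) (ys : List (ι → ℝ)) (q : MvPolynomial ι ℝ) :
    iterD (y :: ys) q = dirD y (iterD ys q) := rfl

theorem iterD_dirD (y : ι → ℝ) (ys : List (ι → ℝ)) (q : MvPolynomial ι ℝ) :
    iterD ys (dirD y q) = dirD y (iterD ys q) := by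
  induction ys with
  | nil => rfl
  | cons z ys ih => rw [iterD_cons, ih, iterD_cons, dirD_comm]

theorem iterD_add (ys : List (ι → ℝ)) (q r : MvPolynomial ι ℝ) :
    iterD ys (q + r) = iterD ys q + iterD ys r := by
  induction ys with
  | nil => rfl
  | cons z ys ih => simp [ih]

theorem iterD_smul (ys : List (ι → ℝ)) (a : ℝ) (q : MvPolynomial ι ℝ) :
    iterD ys (a • q) = a • iterD ys q := by
  induction ys with
  | nil => rfl
  | cons z ys ih => simp [ih]

theorem iterD_zero (ys : List (ι → ℝ)) : iterD ys (0 : MvPolynomial ι ℝ) = 0 := by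
  simpa using iterD_smul ys 0 0

theorem iterD_sum {κ : Type*} (ys : List (ι → ℝ)) (S : Finset κ) (q : κ → MvPolynomial ι ℝ) :
    iterD ys (∑ i ∈ S, q i) = ∑ i ∈ S, iterD ys (q i) := by
  classical
  induction S using Finset.induction_on with
  | empty => simp [iterD_zero]
  | insert a S ha ih => rw [Finset.sum_insert ha, Finset.sum_insert ha, iterD_add, ih]

theorem IsHomogeneous.iterD [Fintype ι] (ys : List (ι → ℝ)) {q : MvPolynomial ι ℝ} {n : ℕ}
    (hq : q.IsHomogeneous (ys.length + n)) : (iterD ys q).IsHomogeneous n := by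
  induction ys generalizing n with
  | nil => simpa using hq
  | cons y ys ih =>
    apply IsHomogeneous.dirD
    apply ih
    convert hq using 1
    simp; ring

theorem eval_zero_iterD_replicate [Fintype ι] (w : ι → ℝ) (k : ℕ) {q : MvPolynomial ι ℝ}
    (hq : q.IsHomogeneous k) :
    eval 0 (iterD (List.replicate k w) q) = k.factorial * eval w q := by
  induction k generalizing q with
  | zero =>
    have := MvPolynomial.totalDegree_eq_zero_iff_eq_C.mp (Nat.le_zero.mp hq.totalDegree_le)
    rw [this]; simp
  | succ k ih =>
    rw [List.replicate_succ, iterD_cons, ← iterD_dirD, ih (IsHomogeneous.dirD hq w),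
      eval_dirD_self hq, Nat.factorial_succ]
    push_cast; ring

/-- The symmetric bilinear form obtained by polarising an iterated derivative at the origin. -/
noncomputable def derivForm (q : MvPolynomial ι ℝ) :
    (ι → ℝ) →ₗ[ℝ] (ι → ℝ) →ₗ[ℝ] ℝ :=
  LinearMap.mk₂ ℝ (fun x y => eval 0 (dirD x (dirD y q)))
    (fun x x' y => by rw [dirD_add]; simp)
    (fun a x y => by rw [dirD_smul]; simp)
    (fun x y y' => by rw [dirD_add]; simp)
    (fun a x y => by rw [dirD_smul]; simp)

theorem derivForm_apply (q : MvPolynomial ι ℝ) (x y : ι → ℝ) :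
    derivForm q x y = eval 0 (dirD x (dirD y q)) := rfl

theorem derivForm_symm (q : MvPolynomial ι ℝ) (x y : ι → ℝ) :
    derivForm q x y = derivForm q y x := by
  rw [derivForm_apply, derivForm_apply, dirD_comm]

/-- The restriction of a polynomial to a line. -/
noncomputable def linePoly (w y : ι → ℝ) : MvPolynomial ι ℝ →ₐ[ℝ] Polynomial ℝ :=
  aeval fun i => Polynomial.C (w i) + Polynomial.C (y i) * Polynomial.X

theorem eval_linePoly (w y : ι → ℝ) (q : MvPolynomial ι ℝ) (t : ℝ) :
    (linePoly w y q).eval t = eval (w + t • y) q := by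
  induction q using MvPolynomial.induction_on with
  | C a => simp [linePoly]
  | add p q hp hq => simp [hp, hq]
  | mul_X p i hp =>
    rw [map_mul, Polynomial.eval_mul, hp]
    simp only [linePoly, aeval_X, map_mul, eval_X, Polynomial.eval_add, Polynomial.eval_C,
      Polynomial.eval_mul, Polynomial.eval_X, Pi.add_apply, Pi.smul_apply, smul_eq_mul]
    ring

theorem derivative_linePoly (w y : ι → ℝ) (q : MvPolynomial ι ℝ) :
    (linePoly w y q).derivative = linePoly w y (dirD y q) := by
  induction q using MvPolynomial.induction_on with
  | C a => simp [linePoly, ← MvPolynomial.algebraMap_eq]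
  | add p q hp hq => simp [hp, hq]
  | mul_X p i hp =>
    rw [map_mul, Polynomial.derivative_mul, hp, Derivation.leibniz, map_add]
    simp [linePoly]; ring

end dirD

section
set_option linter.unusedSectionVars false
variable {ι : Type*} [Fintype ι] [DecidableEq ι]
open MvPolynomial Filter Topology

/-- Coordinate directions. -/
def coordDirs (l : List ι) : List (ι → ℝ) := l.map fun i => Pi.single i 1

/-- The analytic properties of the volume polynomial of a family of simple polytopes that share
a normal fan. -/
structure IsVolumePolynomial (p : MvPolynomial ι ℝ) (d : ℕ) (C : Set (ι → ℝ)) : Prop where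
  homogeneous : p.IsHomogeneous d
  isOpen : IsOpen C
  nonneg : ∀ l : List ι, l.Nodup → ∀ w ∈ C, 0 ≤ eval w (iterD (coordDirs l) p)
  logConcave : ∀ l : List ι, l.Nodup → ∀ w ∈ C, ∀ w' ∈ C,
    eval w (iterD (coordDirs l) p) * eval w' (iterD (coordDirs l) p) ≤
      eval ((1 / 2 : ℝ) • (w + w')) (iterD (coordDirs l) p) ^ 2
  shift : ∀ l : List ι, l.Nodup → ∀ w ∈ C, eval w (iterD (coordDirs l) p) ≠ 0 →
    ∃ s : ι → ℝ, (∀ i, 0 ≤ s i) ∧ (∀ i ∈ l, s i = 0) ∧ dirD (w - s) p = 0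


theorem exists_segment_mem_of_isOpen {C : Set (ι → ℝ)} (hC : IsOpen C) {w : ι → ℝ} (hw : w ∈ C)
    (y : ι → ℝ) : ∀ᶠ t : ℝ in 𝓝 0, w + t • y ∈ C ∧ w + (-t) • y ∈ C := by
  have h1 : Tendsto (fun t : ℝ => w + t • y) (𝓝 0) (𝓝 w) := by
    have : Continuous fun t : ℝ => w + t • y := by fun_prop
    simpa using this.tendsto 0
  have h2 : Tendsto (fun t : ℝ => w + (-t) • y) (𝓝 0) (𝓝 w) := by
    have : Continuous fun t : ℝ => w + (-t) • y := by fun_prop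
    simpa using this.tendsto 0
  exact (h1.eventually (hC.mem_nhds hw)).and (h2.eventually (hC.mem_nhds hw))

/-- A polynomial that is nonnegative and midpoint log-concave on an open set is zero or positive
there. -/
theorem eval_pos_of_logConcave {C : Set (ι → ℝ)} (hC : IsOpen C) {g : MvPolynomial ι ℝ}
    (h0 : ∀ w ∈ C, 0 ≤ eval w g)
    (hlc : ∀ w ∈ C, ∀ w' ∈ C, eval w g * eval w' g ≤ eval ((1 / 2 : ℝ) • (w + w')) g ^ 2)
    (hg : g ≠ 0) {w : ι → ℝ} (hw : w ∈ C) : 0 < eval w g := by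
  refine lt_of_le_of_ne (h0 w hw) fun hzero => hg ?_
  apply MvPolynomial.funext
  intro x
  rw [map_zero]
  set φ := linePoly w (x - w) g with hφ
  have hφe : ∀ t, φ.eval t = eval (w + t • (x - w)) g := eval_linePoly w (x - w) g
  have hprod : φ * φ.comp (-Polynomial.X) = 0 := by
    have hev : ∀ᶠ t : ℝ in 𝓝 0, (φ * φ.comp (-Polynomial.X)).eval t = 0 := by
      filter_upwards [exists_segment_mem_of_isOpen hC hw (x - w)] with t ht
      have h1 := hlc _ ht.1 _ ht.2
      have h2 : (1 / 2 : ℝ) • (w + t • (x - w) + (w + -t • (x - w))) = w := by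
        rw [neg_smul]
        have : w + t • (x - w) + (w + -(t • (x - w))) = (2 : ℝ) • w := by
          rw [two_smul]; abel
        rw [this, smul_smul]; norm_num
      rw [h2, ← hzero] at h1
      have h3 := mul_nonneg (h0 _ ht.1) (h0 _ ht.2)
      simp only [Polynomial.eval_mul, Polynomial.eval_comp, Polynomial.eval_neg, Polynomial.eval_X,
        hφe]
      nlinarith
    by_contra hne
    have hfin := (φ * φ.comp (-Polynomial.X)).roots.toFinset.finite_toSet
    have hinf : (𝓝 (0 : ℝ)) ≤ 𝓟 ((φ * φ.comp (-Polynomial.X)).roots.toFinset : Set ℝ) := by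
      rw [le_principal_iff]
      filter_upwards [hev] with t ht
      simp only [Finset.mem_coe, Multiset.mem_toFinset]
      exact (Polynomial.mem_roots hne).mpr ht
    exact (infinite_of_mem_nhds (0 : ℝ) (le_principal_iff.mp hinf)) hfin
  have hφ0 : φ = 0 := by
    rcases mul_eq_zero.mp hprod with h | h
    · exact h
    · have := congrArg (fun r => Polynomial.comp r (-Polynomial.X)) h
      simpa [Polynomial.comp_assoc] using this
  have := hφe 1
  rw [hφ0] at this
  simpa using this.symm

theorem second_order_of_logConcave_polynomial (φ : Polynomial ℝ)
    (h : ∀ᶠ t : ℝ in 𝓝 0, φ.eval t * φ.eval (-t) ≤ φ.eval 0 ^ 2) :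
    φ.derivative.derivative.eval 0 * φ.eval 0 ≤ φ.derivative.eval 0 ^ 2 := by
  obtain ⟨ψ, hψ⟩ : ∃ ψ, φ = Polynomial.X * ψ + Polynomial.C (φ.eval 0) :=
    ⟨φ.divX, by rw [← Polynomial.coeff_zero_eq_eval_zero]; exact (Polynomial.X_mul_divX_add φ).symm⟩
  obtain ⟨χ, hχ⟩ : ∃ χ, ψ = Polynomial.X * χ + Polynomial.C (ψ.eval 0) :=
    ⟨ψ.divX, by rw [← Polynomial.coeff_zero_eq_eval_zero]; exact (Polynomial.X_mul_divX_add ψ).symm⟩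
  set a := φ.eval 0
  set b := ψ.eval 0
  have hd1 : φ.derivative.eval 0 = b := by rw [hψ, hχ]; simp
  have hd2 : φ.derivative.derivative.eval 0 = 2 * χ.eval 0 := by rw [hψ, hχ]; simp; ring
  have hev : ∀ t, φ.eval t = a + t * b + t ^ 2 * χ.eval t := fun t => by
    rw [hψ, hχ]; simp; ring
  set G : ℝ → ℝ := fun t => b ^ 2 - a * χ.eval t - a * χ.eval (-t) + t * b * (χ.eval t - χ.eval (-t))
    - t ^ 2 * (χ.eval t * χ.eval (-t)) with hG
  have hGc : Continuous G := by
    have h1 : Continuous fun t => χ.eval t := χ.continuous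
    have h2 : Continuous fun t : ℝ => χ.eval (-t) := χ.continuous.comp continuous_neg
    fun_prop
  have hpos : ∀ᶠ t in 𝓝[≠] (0 : ℝ), 0 ≤ G t := by
    filter_upwards [h.filter_mono nhdsWithin_le_nhds, self_mem_nhdsWithin] with t ht ht0
    have ht0 : t ≠ 0 := ht0
    have e : a ^ 2 - φ.eval t * φ.eval (-t) = t ^ 2 * G t := by
      rw [hev t, hev (-t)]; simp only [hG]; ring
    have : 0 < t ^ 2 := by positivity
    by_contra! hneg
    nlinarith
  have hlim : 0 ≤ G 0 := ge_of_tendsto (hGc.tendsto 0 |>.mono_left nhdsWithin_le_nhds) hpos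
  have : G 0 = b ^ 2 - 2 * χ.eval 0 * a := by simp [hG]; ring
  rw [hd1, hd2]; linarith

theorem hessian_of_logConcave {C : Set (ι → ℝ)} (hC : IsOpen C) {g : MvPolynomial ι ℝ}
    (hlc : ∀ w ∈ C, ∀ w' ∈ C, eval w g * eval w' g ≤ eval ((1 / 2 : ℝ) • (w + w')) g ^ 2)
    {w : ι → ℝ} (hw : w ∈ C) (y : ι → ℝ) :
    eval w (dirD y (dirD y g)) * eval w g ≤ eval w (dirD y g) ^ 2 := by
  have := second_order_of_logConcave_polynomial (linePoly w y g) (by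
    filter_upwards [exists_segment_mem_of_isOpen hC hw y] with t ht
    have h1 := hlc _ ht.1 _ ht.2
    have h2 : (1 / 2 : ℝ) • (w + t • y + (w + -t • y)) = w := by
      rw [neg_smul]
      have : w + t • y + (w + -(t • y)) = (2 : ℝ) • w := by
        rw [two_smul]; abel
      rw [this, smul_smul]; norm_num
    rw [h2] at h1
    simpa [eval_linePoly] using h1)
  simpa [derivative_linePoly, eval_linePoly] using this

namespace IsVolumePolynomial
variable {p : MvPolynomial ι ℝ} {d : ℕ} {C : Set (ι → ℝ)}

theorem eval_pos (H : IsVolumePolynomial p d C) {l : List ι} (hl : l.Nodup)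
    (hg : iterD (coordDirs l) p ≠ 0) {w : ι → ℝ} (hw : w ∈ C) :
    0 < eval w (iterD (coordDirs l) p) :=
  eval_pos_of_logConcave H.isOpen (H.nonneg l hl) (H.logConcave l hl) hg hw

theorem homogeneous_iterD (H : IsVolumePolynomial p d C) (l : List ι) {k : ℕ}
    (hk : k + l.length = d) : (iterD (coordDirs l) p).IsHomogeneous k := by
  apply IsHomogeneous.iterD
  convert H.homogeneous using 1
  simp [coordDirs, ← hk]; ring

/-- Along a direction of `C` the derivative is a nonnegative combination of coordinate
derivatives in new directions. -/
theorem exists_dirD_eq (H : IsVolumePolynomial p d C) {l : List ι} (hl : l.Nodup)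
    (hg : iterD (coordDirs l) p ≠ 0) {w : ι → ℝ} (hw : w ∈ C) :
    ∃ s : ι → ℝ, (∀ i, 0 ≤ s i) ∧ (∀ i ∈ l, s i = 0) ∧
      dirD w (iterD (coordDirs l) p) = ∑ i, s i • iterD (coordDirs (i :: l)) p := by
  obtain ⟨s, h0, hl0, hs⟩ := H.shift l hl w hw (H.eval_pos hl hg hw).ne'
  refine ⟨s, h0, hl0, ?_⟩
  have h1 : dirD w p = dirD s p := by
    have : dirD w p = dirD ((w - s) + s) p := by simp
    rw [this, dirD_add, hs, zero_add]
  rw [← iterD_dirD, h1, iterD_dirD, dirD_eq_sum]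
  rfl

theorem eval_zero_pos (H : IsVolumePolynomial p d C) (ws : List (ι → ℝ)) (hws : ∀ w ∈ ws, w ∈ C)
    {l : List ι} (hl : l.Nodup) (hlen : ws.length + l.length = d)
    (hg : iterD (coordDirs l) p ≠ 0) (hC : C.Nonempty) :
    0 < eval 0 (iterD ws (iterD (coordDirs l) p)) := by
  induction ws generalizing l with
  | nil =>
    obtain ⟨w, hw⟩ := hC
    have h1 := H.homogeneous_iterD l (k := 0) (by simpa using hlen)
    have h2 := MvPolynomial.totalDegree_eq_zero_iff_eq_C.mp (Nat.le_zero.mp h1.totalDegree_le)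
    have h3 := H.eval_pos hl hg hw
    rw [h2] at h3 ⊢
    simpa using h3
  | cons w ws ih =>
    have hw : w ∈ C := hws w (by simp)
    obtain ⟨s, h0, hl0, hs⟩ := H.exists_dirD_eq hl hg hw
    have hlen' : ws.length + 1 + l.length = d := by simpa using hlen
    have hterm : ∀ i, 0 < s i → iterD (coordDirs (i :: l)) p ≠ 0 →
        0 < eval 0 (iterD ws (iterD (coordDirs (i :: l)) p)) := by
      intro i hi hgi
      refine ih (fun w hw => hws w (by simp [hw])) ?_ ?_ hgi
      · refine List.nodup_cons.mpr ⟨fun hil => ?_, hl⟩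
        rw [hl0 i hil] at hi; exact lt_irrefl _ hi
      · simp; omega
    have hterm0 : ∀ i, 0 ≤ s i * eval 0 (iterD ws (iterD (coordDirs (i :: l)) p)) := by
      intro i
      rcases (h0 i).eq_or_lt with hi | hi
      · rw [← hi, zero_mul]
      · by_cases hgi : iterD (coordDirs (i :: l)) p = 0
        · rw [hgi, iterD_zero]; simp
        · exact (mul_pos hi (hterm i hi hgi)).le
    rw [iterD_cons, ← iterD_dirD, hs, iterD_sum, map_sum]
    simp only [iterD_smul, MvPolynomial.smul_eval]
    refine Finset.sum_pos' (fun i _ => hterm0 i) ?_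
    by_contra! hcon
    have hz : dirD w (iterD (coordDirs l) p) = 0 := by
      rw [hs]
      refine Finset.sum_eq_zero fun i _ => ?_
      rcases (h0 i).eq_or_lt with hi | hi
      · rw [← hi, zero_smul]
      · by_cases hgi : iterD (coordDirs (i :: l)) p = 0
        · rw [hgi, smul_zero]
        · exact absurd (mul_pos hi (hterm i hi hgi)) (not_lt.mpr (hcon i (Finset.mem_univ _)))
    have he := eval_dirD_self (H.homogeneous_iterD l (k := ws.length + 1) hlen') (w := w)
    rw [hz, map_zero] at he
    have := H.eval_pos hl hg hw
    have h5 : (0 : ℝ) < ((ws.length + 1 : ℕ) : ℝ) * eval w (iterD (coordDirs l) p) := by positivity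
    linarith

/-- The form obtained by differentiating repeatedly in a single direction. -/
theorem form_replicate_nonpos (H : IsVolumePolynomial p d C) {l : List ι} (hl : l.Nodup)
    (hg : iterD (coordDirs l) p ≠ 0) {k : ℕ} (hk : k + 2 + l.length = d) {w : ι → ℝ} (hw : w ∈ C)
    (y : ι → ℝ)
    (hy : derivForm (iterD (List.replicate k w) (iterD (coordDirs l) p)) y w = 0) :
    derivForm (iterD (List.replicate k w) (iterD (coordDirs l) p)) y y ≤ 0 := by
  set g := iterD (coordDirs l) p with hgdef
  have hh : g.IsHomogeneous (k + 1 + 1) := H.homogeneous_iterD l (by omega)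
  have h1 : ∀ x y, derivForm (iterD (List.replicate k w) g) x y
      = k.factorial * eval w (dirD x (dirD y g)) := by
    intro x y
    rw [derivForm_apply, ← iterD_dirD, ← iterD_dirD]
    exact eval_zero_iterD_replicate w k (IsHomogeneous.dirD (IsHomogeneous.dirD hh y) x)
  rw [h1, dirD_comm, eval_dirD_self (IsHomogeneous.dirD hh y)] at hy
  rw [h1]
  have hf : (0 : ℝ) < k.factorial := by positivity
  have hk1 : ((k + 1 : ℕ) : ℝ) ≠ 0 := by positivity
  have hy0 : eval w (dirD y g) = 0 := by
    rcases mul_eq_zero.mp hy with h | h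
    · exact absurd h hf.ne'
    · exact (mul_eq_zero.mp h).resolve_left hk1
  have h2 := hessian_of_logConcave H.isOpen (H.logConcave l hl) hw y
  rw [← hgdef, hy0] at h2
  have h3 := H.eval_pos hl hg hw
  rw [← hgdef] at h3
  have h4 : eval w (dirD y (dirD y g)) ≤ 0 := by
    by_contra! h
    nlinarith [mul_pos h h3]
  exact mul_nonpos_of_nonneg_of_nonpos hf.le h4

end IsVolumePolynomial
end

namespace IsVolumePolynomial
variable {ι : Type*} [Fintype ι] [DecidableEq ι]
open MvPolynomial
variable {p : MvPolynomial ι ℝ} {d : ℕ} {C : Set (ι → ℝ)}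

/-- Derivatives in the directions `e_i`, `e_j` of an iterated derivative. -/
theorem eval_zero_offdiag (H : IsVolumePolynomial p d C) {l : List ι} (hl : l.Nodup)
    {ws : List (ι → ℝ)} (hws : ∀ w ∈ ws, w ∈ C) (hC : C.Nonempty)
    (hlen : ws.length + 2 + l.length = d) {i j : ι} (hi : i ∉ l) (hj : j ∉ l) (hij : i ≠ j) :
    0 ≤ derivForm (iterD ws (iterD (coordDirs l) p)) (Pi.single i 1) (Pi.single j 1) ∧
    (derivForm (iterD ws (iterD (coordDirs l) p)) (Pi.single i 1) (Pi.single j 1) ≠ 0 ↔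
      iterD (coordDirs (i :: j :: l)) p ≠ 0) := by
  have e : derivForm (iterD ws (iterD (coordDirs l) p)) (Pi.single i 1) (Pi.single j 1)
      = eval 0 (iterD ws (iterD (coordDirs (i :: j :: l)) p)) := by
    rw [derivForm_apply, ← iterD_dirD, ← iterD_dirD]; rfl
  have hnd : (i :: j :: l).Nodup := by simp [hi, hj, hij, hl]
  rw [e]
  by_cases hg : iterD (coordDirs (i :: j :: l)) p = 0
  · rw [hg, iterD_zero]; simp
  · have := H.eval_zero_pos ws hws hnd (by simp; omega) hg hC
    exact ⟨this.le, iff_of_true this.ne' hg⟩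

/-- The Alexandrov–Fenchel inequality for volume polynomials. -/
theorem form_nonpos (H : IsVolumePolynomial p d C) (ws : List (ι → ℝ))
    (hws : ∀ w ∈ ws, w ∈ C) {l : List ι} (hl : l.Nodup) (hlen : ws.length + 2 + l.length = d)
    (hg : iterD (coordDirs l) p ≠ 0) {w : ι → ℝ} (hw : w ∈ C) (y : ι → ℝ)
    (hy : derivForm (iterD ws (iterD (coordDirs l) p)) y w = 0) :
    derivForm (iterD ws (iterD (coordDirs l) p)) y y ≤ 0 := by
  have hC : C.Nonempty := ⟨w, hw⟩
  have hself : ∀ (ws : List (ι → ℝ)), (∀ w ∈ ws, w ∈ C) → ∀ {l : List ι}, l.Nodup →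
      ws.length + 2 + l.length = d → iterD (coordDirs l) p ≠ 0 → ∀ {w}, w ∈ C →
      0 < derivForm (iterD ws (iterD (coordDirs l) p)) w w := by
    intro ws hws l hl hlen hg w hw
    exact H.eval_zero_pos (w :: w :: ws) (by simpa [hw] using hws) hl (by simp; omega) hg hC
  induction ws generalizing l w y with
  | nil =>
    exact H.form_replicate_nonpos hl hg (k := 0) (by simpa using hlen) hw y hy
  | cons v ws ih =>
    have hv : v ∈ C := hws v (by simp)
    have hws' : ∀ w ∈ ws, w ∈ C := fun w hw => hws w (by simp [hw])
    have hlen' : ws.length + 1 + 2 + l.length = d := by simpa using hlen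
    obtain ⟨s, h0, hl0, hs⟩ := H.exists_dirD_eq hl hg hv
    set g := iterD (coordDirs l) p with hgdef
    classical
    let σ := {i : ι // 0 < s i ∧ iterD (coordDirs (i :: l)) p ≠ 0}
    let e : σ → ι → ℝ := fun i => Pi.single i.1 1
    have hσl : ∀ i : σ, i.1 ∉ l := fun i hil => by
      have := i.2.1
      rw [hl0 _ hil] at this; exact lt_irrefl _ this
    have hnd : ∀ i : σ, (i.1 :: l).Nodup := fun i => List.nodup_cons.mpr ⟨hσl i, hl⟩
    have hs' : dirD v g = ∑ i : σ, s i.1 • dirD (e i) g := by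
      rw [hs, ← Finset.sum_filter_of_ne (p := fun i => 0 < s i ∧ iterD (coordDirs (i :: l)) p ≠ 0)]
      · exact Finset.sum_subtype _ (by simp) _
      · intro i _ hi
        exact ⟨lt_of_le_of_ne (h0 i) (fun h => hi (by rw [← h, zero_smul])),
          fun h => hi (by rw [h, smul_zero])⟩
    have hexp : ∀ vs : List (ι → ℝ), eval 0 (iterD vs (dirD v g))
        = ∑ i : σ, s i.1 * eval 0 (iterD vs (dirD (e i) g)) := fun vs => by
      rw [hs', iterD_sum, map_sum]
      simp only [iterD_smul, MvPolynomial.smul_eval]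
    have hQv : ∀ (vs : List (ι → ℝ)) (y : ι → ℝ), derivForm (iterD vs g) y v
        = ∑ i : σ, s i.1 * derivForm (iterD vs g) y (e i) := by
      intro vs y
      have := hexp (y :: vs)
      rw [iterD_dirD, iterD_cons] at this
      rw [derivForm_symm, derivForm_apply, this]
      refine Finset.sum_congr rfl fun i _ => ?_
      rw [iterD_dirD, iterD_cons, derivForm_symm, derivForm_apply]
    have hQe : ∀ (y : ι → ℝ) (i : σ), derivForm (iterD (v :: ws) g) y (e i)
        = derivForm (iterD ws (iterD (coordDirs (i.1 :: l)) p)) y v := by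
      intro y i
      rw [derivForm_apply, derivForm_apply]
      change _ = eval 0 (dirD y (dirD v (iterD ws (dirD (e i) g))))
      rw [iterD_cons, iterD_dirD, dirD_comm v (e i)]
    have hq : ∀ i : σ, 0 < derivForm (iterD ws (iterD (coordDirs (i.1 :: l)) p)) v v := fun i =>
      hself ws hws' (hnd i) (by simp; omega) i.2.2 hv
    have hqe : ∀ i : σ, derivForm (iterD (v :: ws) g) (e i) v
        = derivForm (iterD ws (iterD (coordDirs (i.1 :: l)) p)) v v := fun i => by
      rw [derivForm_symm, hQe]
    have hmain : ∀ y, derivForm (iterD (v :: ws) g) y v = 0 →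
        derivForm (iterD (v :: ws) g) y y ≤ 0 := by
      refine form_nonpos_of_local_inequality _ (derivForm_symm _) e (fun i => s i.1)
        (fun i => i.2.1) v (hQv _) (fun i => by rw [hqe]; exact hq i) ?_ ?_ ?_
      · intro y
        have h1 : derivForm (iterD (v :: ws) g) y y
            = ∑ i : σ, s i.1 * derivForm (iterD ws (iterD (coordDirs (i.1 :: l)) p)) y y := by
          have := hexp (y :: y :: ws)
          rw [iterD_dirD, iterD_cons, iterD_cons, dirD_comm v, dirD_comm v] at this
          rw [derivForm_apply, iterD_cons, this]
          rfl
        rw [h1]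
        refine Finset.sum_le_sum fun i _ => ?_
        rw [hqe, hQe, mul_div_assoc]
        refine mul_le_mul_of_nonneg_left ?_ i.2.1.le
        rw [le_div_iff₀ (hq i)]
        exact reverse_cauchy_schwarz _ (derivForm_symm _) v
          (fun z hz => ih hws' (hnd i) (by simp; omega) i.2.2 hv z hz) v (hq i) y
      · intro i j hij
        exact (H.eval_zero_offdiag hl hws hC (by simpa using hlen) (hσl i) (hσl j)
          (fun h => hij (Subtype.ext h))).1
      · intro z hz
        refine const_of_form_nonpos (derivForm (iterD (List.replicate (ws.length + 1) v) g))
          (derivForm_symm _) e (fun i => s i.1) (fun i => i.2.1) v (hQv _) ?_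
          (H.form_replicate_nonpos hl hg (by omega) hv) z ?_
        · intro i
          have h1 : derivForm (iterD (List.replicate (ws.length + 1) v) g) (e i) v
              = eval 0 (iterD (v :: List.replicate (ws.length + 1) v)
                  (iterD (coordDirs (i.1 :: l)) p)) := by
            change _ = eval 0 (iterD (v :: List.replicate (ws.length + 1) v) (dirD (e i) g))
            rw [iterD_dirD]; rfl
          rw [h1]
          refine H.eval_zero_pos _ (fun w hw => ?_) (hnd i) (by simp; omega) i.2.2 hC
          rw [← List.replicate_succ] at hw
          rw [List.eq_of_mem_replicate hw]; exact hv
        · intro i j hij hne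
          have hij' : i.1 ≠ j.1 := fun h => hij (Subtype.ext h)
          have h1 := H.eval_zero_offdiag hl (ws := List.replicate (ws.length + 1) v)
            (fun w hw => by rw [List.eq_of_mem_replicate hw]; exact hv) hC (by simp; omega)
            (hσl i) (hσl j) hij'
          have h2 := H.eval_zero_offdiag hl hws hC (by simpa using hlen) (hσl i) (hσl j) hij'
          exact hz i j hij (lt_of_le_of_ne h2.1 (h2.2.mpr (h1.2.mp hne)).symm)
    have hpos := hself (v :: ws) hws hl hlen hg hw
    have h5 := reverse_cauchy_schwarz _ (derivForm_symm _) v hmain w hpos y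
    rw [hy] at h5
    by_contra! hc
    nlinarith [mul_pos hc hpos]

end IsVolumePolynomial

section
open Set ENNReal

theorem volume_add_volume_le_of_isCompact {A B C : Set ℝ} (hA : IsCompact A) (hB : IsCompact B)
    (hAne : A.Nonempty) (hBne : B.Nonempty)
    (h : ∀ x ∈ A, ∀ y ∈ B, (x + y) / 2 ∈ C) :
    volume A + volume B ≤ 2 * volume C := by
  obtain ⟨a, haA, ha⟩ := hA.exists_isGreatest hAne
  obtain ⟨b, hbB, hb⟩ := hB.exists_isLeast hBne
  have hvol : ∀ (c : ℝ) (S : Set ℝ), volume ((fun x => c + x) ⁻¹' ((fun x => x * 2) ⁻¹' S))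
      = volume S / 2 := by
    intro c S
    rw [measure_preimage_add, Real.volume_preimage_mul_right (by norm_num)]
    rw [div_eq_mul_inv, mul_comm]
    congr 1
    rw [abs_of_pos (by norm_num), ENNReal.ofReal_inv_of_pos (by norm_num)]
    simp
  set A' := (fun x => (-b / 2) + x) ⁻¹' ((fun x => x * 2) ⁻¹' A) with hA'
  set B' := (fun x => (-a / 2) + x) ⁻¹' ((fun x => x * 2) ⁻¹' B) with hB'
  have hA'C : A' ⊆ C := fun x hx => by
    have := h _ hx b hbB
    convert this using 1; simp; ring
  have hB'C : B' ⊆ C := fun x hx => by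
    have := h a haA _ hx
    convert this using 1; simp; ring
  have hmA : MeasurableSet A' := by
    have := hA.measurableSet
    exact (measurable_const_add _) ((measurable_id.mul_const _) this)
  have hinter : volume (A' ∩ B') = 0 := by
    refine measure_mono_null (t := {(a + b) / 2}) ?_ Real.volume_singleton
    rintro x ⟨h1, h2⟩
    have h3 := ha h1
    have h4 := hb h2
    rw [mem_singleton_iff]
    simp only at h3 h4
    linarith
  have h1 : volume A' + volume B' = volume (A' ∪ B') := by
    rw [← measure_union_add_inter' hmA, hinter, add_zero]
  have h2 : volume A' + volume B' ≤ volume C := h1 ▸ measure_mono (union_subset hA'C hB'C)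
  rw [hvol, hvol, ← ENNReal.add_div] at h2
  rw [mul_comm]
  exact (ENNReal.div_le_iff (by norm_num) (by norm_num)).mp h2

theorem volume_le_of_forall_isCompact {A : Set ℝ} (hA : MeasurableSet A) {c : ℝ≥0∞}
    (h : ∀ K ⊆ A, IsCompact K → K.Nonempty → volume K ≤ c) : volume A ≤ c := by
  refine le_of_forall_lt fun r hr => ?_
  obtain ⟨K, hKA, hK, hrK⟩ := hA.exists_lt_isCompact hr
  refine hrK.trans_le (h K hKA hK ?_)
  by_contra hne
  rw [Set.not_nonempty_iff_eq_empty] at hne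
  simp [hne] at hrK

/-- The one-dimensional Brunn–Minkowski inequality. -/
theorem volume_add_volume_le {A B C : Set ℝ} (hA : MeasurableSet A) (hB : MeasurableSet B)
    (hAne : A.Nonempty) (hBne : B.Nonempty)
    (h : ∀ x ∈ A, ∀ y ∈ B, (x + y) / 2 ∈ C) :
    volume A + volume B ≤ 2 * volume C := by
  have h1 : ∀ L ⊆ B, IsCompact L → L.Nonempty → volume A + volume L ≤ 2 * volume C := by
    intro L hL hLc hLne
    have hfin : volume L ≠ ∞ := hLc.measure_lt_top.ne
    have hle : volume A ≤ 2 * volume C - volume L :=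
      volume_le_of_forall_isCompact hA fun K hK hKc hKne =>
        ENNReal.le_sub_of_add_le_right hfin
          (volume_add_volume_le_of_isCompact hKc hLc hKne hLne
            fun x hx y hy => h x (hK hx) y (hL hy))
    obtain ⟨x, hx⟩ := hAne
    have hL2 : volume L ≤ 2 * volume C := by
      have := volume_add_volume_le_of_isCompact (isCompact_singleton (x := x)) hLc
        (singleton_nonempty x) hLne fun z hz y hy => h z (by rw [hz]; exact hx) y (hL hy)
      exact le_add_self.trans this
    calc volume A + volume L ≤ (2 * volume C - volume L) + volume L := by gcongr
      _ = 2 * volume C := tsub_add_cancel_of_le hL2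
  by_cases hfin : volume A = ∞
  · obtain ⟨y, hy⟩ := hBne
    have := h1 {y} (singleton_subset_iff.mpr hy) isCompact_singleton (singleton_nonempty y)
    rw [hfin] at this ⊢
    simpa using this
  · have hA2 : volume A ≤ 2 * volume C := by
      obtain ⟨y, hy⟩ := hBne
      have := h1 {y} (singleton_subset_iff.mpr hy) isCompact_singleton (singleton_nonempty y)
      exact le_self_add.trans this
    have hle : volume B ≤ 2 * volume C - volume A :=
      volume_le_of_forall_isCompact hB fun L hL hLc hLne => by
        apply ENNReal.le_sub_of_add_le_right hfin
        rw [add_comm]; exact h1 L hL hLc hLne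
    calc volume A + volume B ≤ volume A + (2 * volume C - volume A) := by gcongr
      _ = 2 * volume C := add_tsub_cancel_of_le hA2

/-- The midpoint Prékopa–Leindler inequality for a measure. -/
def PrekopaLeindler {E : Type*} [AddCommGroup E] [Module ℝ E] [MeasurableSpace E]
    (μ : Measure E) : Prop :=
  ∀ f g h : E → ℝ≥0∞, Measurable f → Measurable g → Measurable h →
    (∀ x y, f x * g y ≤ h ((1 / 2 : ℝ) • (x + y)) ^ 2) →
    (∫⁻ x, f x ∂μ) * (∫⁻ x, g x ∂μ) ≤ (∫⁻ x, h x ∂μ) ^ 2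

theorem ENNReal.mul_le_sq_of_add_le {a b c : ℝ≥0∞} (h : a + b ≤ 2 * c) : a * b ≤ c ^ 2 := by
  by_cases hc : c = ∞
  · simp [hc]
  have hab : a + b ≠ ∞ := ne_top_of_le_ne_top (ENNReal.mul_ne_top (by norm_num) hc) h
  have ha : a ≠ ∞ := (ENNReal.add_ne_top.mp hab).1
  have hb : b ≠ ∞ := (ENNReal.add_ne_top.mp hab).2
  lift a to NNReal using ha
  lift b to NNReal using hb
  lift c to NNReal using hc
  norm_cast at h ⊢
  rw [← NNReal.coe_le_coe] at h ⊢
  push_cast at h ⊢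
  nlinarith [sq_nonneg ((a : ℝ) - b), a.2, b.2, c.2, show (0:ℝ) ≤ a from a.2, show (0:ℝ) ≤ b from b.2]

theorem lintegral_eq_lintegral_Ioo_of_le_one {f : ℝ → ℝ≥0∞} (hf : Measurable f)
    (h1 : ∀ x, f x ≤ 1) :
    ∫⁻ x, f x = ∫⁻ t in Ioo (0 : ℝ) 1, volume {x | ENNReal.ofReal t < f x} := by
  have hfin : ∀ x, f x ≠ ∞ := fun x => ne_top_of_le_ne_top one_ne_top (h1 x)
  have e1 : ∫⁻ x, f x = ∫⁻ x, ENNReal.ofReal (f x).toReal :=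
    lintegral_congr fun x => (ENNReal.ofReal_toReal (hfin x)).symm
  rw [e1, lintegral_eq_lintegral_meas_lt volume (Filter.Eventually.of_forall
    fun x => ENNReal.toReal_nonneg) hf.ennreal_toReal.aemeasurable]
  have e2 : ∀ t ∈ Ioi (0 : ℝ), volume {x | t < (f x).toReal}
      = (Ioo (0 : ℝ) 1).indicator (fun t => volume {x | ENNReal.ofReal t < f x}) t := by
    intro t ht
    by_cases ht1 : t < 1
    · rw [indicator_of_mem (show t ∈ Ioo (0 : ℝ) 1 from ⟨ht, ht1⟩)]
      congr 1; ext x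
      simp only [Set.mem_ofPred_eq]
      rw [ENNReal.ofReal_lt_iff_lt_toReal (le_of_lt ht) (hfin x)]
    · rw [indicator_of_notMem (fun h => ht1 h.2)]
      convert measure_empty (μ := (volume : Measure ℝ))
      ext x
      simp only [Set.mem_ofPred_eq, mem_empty_iff_false, iff_false, not_lt]
      refine le_trans ?_ (not_lt.mp ht1)
      exact ENNReal.toReal_le_of_le_ofReal zero_le_one (by simpa using h1 x)
  rw [setLIntegral_congr_fun measurableSet_Ioi e2, setLIntegral_indicator measurableSet_Ioo]
  congr 2
  ext t; simp +contextual

theorem lintegral_mul_lintegral_le_of_iSup_eq_one {f g h : ℝ → ℝ≥0∞} (hf : Measurable f)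
    (hg : Measurable g) (hh : Measurable h) (hf1 : ⨆ x, f x = 1) (hg1 : ⨆ x, g x = 1)
    (hfgh : ∀ x y, f x * g y ≤ h ((1 / 2 : ℝ) • (x + y)) ^ 2) :
    (∫⁻ x, f x) * (∫⁻ x, g x) ≤ (∫⁻ x, h x) ^ 2 := by
  have hfle : ∀ x, f x ≤ 1 := fun x => hf1 ▸ le_iSup f x
  have hgle : ∀ x, g x ≤ 1 := fun x => hg1 ▸ le_iSup g x
  have hmin : ∫⁻ x, min (h x) 1 ≤ ∫⁻ x, h x := lintegral_mono fun x => min_le_left _ _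
  refine le_trans ?_ (pow_le_pow_left' hmin 2)
  apply ENNReal.mul_le_sq_of_add_le
  rw [lintegral_eq_lintegral_Ioo_of_le_one hf hfle, lintegral_eq_lintegral_Ioo_of_le_one hg hgle,
    lintegral_eq_lintegral_Ioo_of_le_one (hh.min measurable_const) (fun x => min_le_right _ _),
    ← lintegral_const_mul' _ _ (by norm_num), ← lintegral_add_left']
  · refine setLIntegral_mono' measurableSet_Ioo fun t ht => ?_
    have ht1 : ENNReal.ofReal t < 1 := by
      rw [← ENNReal.ofReal_one]; exact (ENNReal.ofReal_lt_ofReal_iff one_pos).mpr ht.2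
    refine volume_add_volume_le (measurableSet_lt measurable_const hf)
      (measurableSet_lt measurable_const hg) ?_ ?_ ?_
    · exact lt_iSup_iff.mp (hf1 ▸ ht1)
    · exact lt_iSup_iff.mp (hg1 ▸ ht1)
    · intro x hx y hy
      refine lt_min ?_ ht1
      have h1 := hfgh x y
      have h2 : ENNReal.ofReal t ^ 2 < f x * g y := by
        rw [sq]; exact ENNReal.mul_lt_mul hx hy
      have h3 := h2.trans_le h1
      have h4 : (1 / 2 : ℝ) • (x + y) = (x + y) / 2 := by simp; ring
      rw [h4] at h3
      exact lt_of_pow_lt_pow_left' 2 h3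
  · apply Measurable.aemeasurable
    refine Antitone.measurable fun s t hst => measure_mono fun x hx => ?_
    exact (ENNReal.ofReal_le_ofReal hst).trans_lt hx

theorem prekopaLeindler_of_bounded {E : Type*} [AddCommGroup E] [Module ℝ E] [MeasurableSpace E]
    {μ : Measure E} (H : ∀ f g h : E → ℝ≥0∞, Measurable f → Measurable g → Measurable h →
      (∃ n : ℕ, ∀ x, f x ≤ n) → (∃ n : ℕ, ∀ x, g x ≤ n) →
      (∀ x y, f x * g y ≤ h ((1 / 2 : ℝ) • (x + y)) ^ 2) →
      (∫⁻ x, f x ∂μ) * (∫⁻ x, g x ∂μ) ≤ (∫⁻ x, h x ∂μ) ^ 2) : PrekopaLeindler μ := by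
  have hsup : ∀ f : E → ℝ≥0∞, Measurable f →
      ∫⁻ x, f x ∂μ = ⨆ n : ℕ, ∫⁻ x, min (f x) n ∂μ := by
    intro f hf
    rw [← lintegral_iSup (fun n => hf.min measurable_const)]
    · refine lintegral_congr fun x => ?_
      refine le_antisymm ?_ (iSup_le fun n => min_le_left _ _)
      by_cases hx : f x = ∞
      · simp only [hx, le_top, inf_of_le_right]
        rw [ENNReal.iSup_natCast]
      · obtain ⟨n, hn⟩ := ENNReal.exists_nat_gt hx
        exact le_iSup_of_le n (le_min le_rfl hn.le)
    · intro m n hmn x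
      exact min_le_min_left _ (by exact_mod_cast hmn)
  intro f g h hf hg hh hfgh
  rw [hsup f hf, hsup g hg, ENNReal.iSup_mul]
  refine iSup_le fun m => ?_
  rw [ENNReal.mul_iSup]
  refine iSup_le fun n => ?_
  refine H _ _ h (hf.min measurable_const) (hg.min measurable_const) hh
    ⟨m, fun x => min_le_right _ _⟩ ⟨n, fun x => min_le_right _ _⟩ fun x y => ?_
  exact (mul_le_mul' (min_le_left _ _) (min_le_left _ _)).trans (hfgh x y)

theorem prekopaLeindler_real : PrekopaLeindler (volume : Measure ℝ) := by
  refine prekopaLeindler_of_bounded fun f g h hf hg hh ⟨m, hm⟩ ⟨n, hn⟩ hfgh => ?_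
  set F := ⨆ x, f x with hF
  set G := ⨆ x, g x with hG
  have hFfin : F ≠ ∞ := ne_top_of_le_ne_top (ENNReal.natCast_ne_top m) (iSup_le hm)
  have hGfin : G ≠ ∞ := ne_top_of_le_ne_top (ENNReal.natCast_ne_top n) (iSup_le hn)
  by_cases hF0 : F = 0
  · have : ∀ x, f x = 0 := fun x => le_antisymm (hF0 ▸ le_iSup f x) bot_le
    simp [this]
  by_cases hG0 : G = 0
  · have : ∀ x, g x = 0 := fun x => le_antisymm (hG0 ▸ le_iSup g x) bot_le
    simp [this]
  set r : ℝ≥0∞ := (F * G) ^ (1 / 2 : ℝ) with hr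
  have hr2 : r ^ 2 = F * G := by
    rw [hr, ← ENNReal.rpow_natCast, ← ENNReal.rpow_mul]; norm_num
  have hFG0 : F * G ≠ 0 := mul_ne_zero hF0 hG0
  have hFGfin : F * G ≠ ∞ := ENNReal.mul_ne_top hFfin hGfin
  have key := lintegral_mul_lintegral_le_of_iSup_eq_one (f := fun x => F⁻¹ * f x)
    (g := fun x => G⁻¹ * g x) (h := fun x => r⁻¹ * h x) (hf.const_mul _) (hg.const_mul _)
    (hh.const_mul _) (by rw [← ENNReal.mul_iSup]; exact ENNReal.inv_mul_cancel hF0 hFfin)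
    (by rw [← ENNReal.mul_iSup]; exact ENNReal.inv_mul_cancel hG0 hGfin) (by
      intro x y
      rw [mul_pow, ← ENNReal.inv_pow, hr2, ENNReal.mul_inv (Or.inl hF0) (Or.inl hFfin)]
      calc F⁻¹ * f x * (G⁻¹ * g y) = F⁻¹ * G⁻¹ * (f x * g y) := by ring
        _ ≤ _ := by gcongr; exact hfgh x y)
  rw [lintegral_const_mul _ hf, lintegral_const_mul _ hg, lintegral_const_mul _ hh, mul_pow,
    ← ENNReal.inv_pow, hr2] at key
  have e1 : F⁻¹ * (∫⁻ x, f x) * (G⁻¹ * ∫⁻ x, g x)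
      = (F * G)⁻¹ * ((∫⁻ x, f x) * ∫⁻ x, g x) := by
    rw [ENNReal.mul_inv (Or.inl hF0) (Or.inl hFfin)]; ring
  rw [e1] at key
  exact (ENNReal.mul_le_mul_iff_right (ENNReal.inv_ne_zero.mpr hFGfin)
    (ENNReal.inv_ne_top.mpr hFG0)).mp key

theorem PrekopaLeindler.prod {E F : Type*} [AddCommGroup E] [Module ℝ E] [MeasurableSpace E]
    [AddCommGroup F] [Module ℝ F] [MeasurableSpace F] {μ : Measure E} {ν : Measure F}
    [SFinite μ] [SFinite ν] (hμ : PrekopaLeindler μ) (hν : PrekopaLeindler ν) :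
    PrekopaLeindler (μ.prod ν) := by
  intro f g h hf hg hh hfgh
  rw [lintegral_prod _ hf.aemeasurable, lintegral_prod _ hg.aemeasurable,
    lintegral_prod _ hh.aemeasurable]
  refine hμ _ _ _ hf.lintegral_prod_right' hg.lintegral_prod_right' hh.lintegral_prod_right' ?_
  intro x x'
  exact hν _ _ _ (hf.comp measurable_prodMk_left) (hg.comp measurable_prodMk_left)
    (hh.comp measurable_prodMk_left) fun y y' => hfgh (x, y) (x', y')

theorem PrekopaLeindler.of_measurePreserving {E F : Type*} [AddCommGroup E] [Module ℝ E]
    [MeasurableSpace E] [AddCommGroup F] [Module ℝ F] [MeasurableSpace F] {μ : Measure E}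
    {ν : Measure F} (hμ : PrekopaLeindler μ) (e : E →ₗ[ℝ] F) (he : MeasurePreserving e μ ν) :
    PrekopaLeindler ν := by
  intro f g h hf hg hh hfgh
  rw [← he.lintegral_comp hf, ← he.lintegral_comp hg, ← he.lintegral_comp hh]
  refine hμ _ _ _ (hf.comp he.measurable) (hg.comp he.measurable) (hh.comp he.measurable) ?_
  intro x y
  rw [map_smul, map_add]
  exact hfgh _ _

theorem PrekopaLeindler.smul {E : Type*} [AddCommGroup E] [Module ℝ E]
    [MeasurableSpace E] {μ : Measure E} (hμ : PrekopaLeindler μ) (c : ℝ≥0∞) :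
    PrekopaLeindler (c • μ) := by
  intro f g h hf hg hh hfgh
  simp only [lintegral_smul_measure, smul_eq_mul]
  calc _ = c ^ 2 * ((∫⁻ x, f x ∂μ) * ∫⁻ x, g x ∂μ) := by ring
    _ ≤ c ^ 2 * (∫⁻ x, h x ∂μ) ^ 2 := by gcongr; exact hμ f g h hf hg hh hfgh
    _ = _ := by ring

theorem prekopaLeindler_pi (n : ℕ) : PrekopaLeindler (volume : Measure (Fin n → ℝ)) := by
  induction n with
  | zero =>
    intro f g h hf hg hh hfgh
    rw [lintegral_unique, lintegral_unique, lintegral_unique]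
    simp only [volume_pi, Measure.pi_empty_univ, mul_one]
    convert hfgh default default
  | succ n ih =>
    have h1 := PrekopaLeindler.prod prekopaLeindler_real ih
    refine PrekopaLeindler.of_measurePreserving h1
      (Fin.consLinearEquiv ℝ (fun _ : Fin (n + 1) => ℝ)).toLinearMap ?_
    have := (volume_preserving_piFinSuccAbove (fun _ : Fin (n + 1) => ℝ) 0).symm
    have e : ⇑(Fin.consLinearEquiv ℝ (fun _ : Fin (n + 1) => ℝ)).toLinearMap
        = (MeasurableEquiv.piFinSuccAbove (fun _ : Fin (n + 1) => ℝ) 0).symm := by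
      funext x
      simp [MeasurableEquiv.piFinSuccAbove, Fin.consLinearEquiv, Fin.consEquiv]
    rw [e]
    exact this

theorem prekopaLeindler_of_isAddHaarMeasure {E : Type*} [NormedAddCommGroup E] [NormedSpace ℝ E]
    [FiniteDimensional ℝ E] [MeasurableSpace E] [BorelSpace E] (μ : Measure E)
    [μ.IsAddHaarMeasure] : PrekopaLeindler μ := by
  let e : (Fin (Module.finrank ℝ E) → ℝ) ≃L[ℝ] E :=
    ContinuousLinearEquiv.ofFinrankEq (by simp)
  have h1 : PrekopaLeindler (Measure.map e volume) :=
    (prekopaLeindler_pi _).of_measurePreserving e.toLinearMap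
      ⟨e.continuous.measurable, rfl⟩
  have h2 : (Measure.map e (volume : Measure (Fin (Module.finrank ℝ E) → ℝ))).IsAddHaarMeasure :=
    e.isAddHaarMeasure_map _
  rw [Measure.isAddLeftInvariant_eq_smul μ (Measure.map e volume)]
  exact h1.smul _

/-- The multiplicative midpoint Brunn–Minkowski inequality. -/
theorem measure_mul_measure_le_sq {E : Type*} [NormedAddCommGroup E] [NormedSpace ℝ E]
    [FiniteDimensional ℝ E] [MeasurableSpace E] [BorelSpace E] (μ : Measure E)
    [μ.IsAddHaarMeasure] {A B C : Set E} (hA : MeasurableSet A) (hB : MeasurableSet B)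
    (hC : MeasurableSet C) (h : ∀ x ∈ A, ∀ y ∈ B, (1 / 2 : ℝ) • (x + y) ∈ C) :
    μ A * μ B ≤ μ C ^ 2 := by
  have := prekopaLeindler_of_isAddHaarMeasure μ (A.indicator 1) (B.indicator 1) (C.indicator 1)
    (measurable_one.indicator hA) (measurable_one.indicator hB) (measurable_one.indicator hC) (by
      intro x y
      by_cases hx : x ∈ A
      · by_cases hy : y ∈ B
        · rw [indicator_of_mem hx, indicator_of_mem hy, indicator_of_mem (h x hx y hy)]; simp
        · simp [hy]
      · simp [hx])
  simpa [lintegral_indicator_one hA, lintegral_indicator_one hB, lintegral_indicator_one hC]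
    using this

end

section
set_option linter.unusedSectionVars false
open Set Filter Topology
variable {ι E : Type*} [Fintype ι] [NormedAddCommGroup E] [NormedSpace ℝ E]

/-- The polyhedron cut out by the linear inequalities `u i x ≤ h i`. -/
def polyh (u : ι → E →ₗ[ℝ] ℝ) (h : ι → ℝ) : Set E := {x | ∀ i, u i x ≤ h i}

/-- At every point of the polyhedron, the tight constraints have independent normals. -/
def IsSimpleAt (u : ι → E →ₗ[ℝ] ℝ) (h : ι → ℝ) : Prop :=
  ∀ x ∈ polyh u h, ∀ c : ι → ℝ, (∀ i, u i x ≠ h i → c i = 0) → ∑ i, c i • u i = 0 → c = 0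

theorem mem_polyh {u : ι → E →ₗ[ℝ] ℝ} {h : ι → ℝ} {x : E} : x ∈ polyh u h ↔ ∀ i, u i x ≤ h i :=
  Iff.rfl

theorem convex_polyh (u : ι → E →ₗ[ℝ] ℝ) (h : ι → ℝ) : Convex ℝ (polyh u h) := by
  intro x hx y hy a b ha hb hab i
  simp only [map_add, map_smul, smul_eq_mul]
  calc a * u i x + b * u i y ≤ a * h i + b * h i :=
        add_le_add (mul_le_mul_of_nonneg_left (hx i) ha) (mul_le_mul_of_nonneg_left (hy i) hb)
    _ = h i := by rw [← add_mul, hab, one_mul]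

variable [FiniteDimensional ℝ E]

theorem isClosed_polyh (u : ι → E →ₗ[ℝ] ℝ) (h : ι → ℝ) : IsClosed (polyh u h) := by
  have : polyh u h = ⋂ i, {x | u i x ≤ h i} := by ext x; simp [mem_polyh]
  rw [this]
  exact isClosed_iInter fun i =>
    isClosed_le (LinearMap.continuous_of_finiteDimensional (u i)) continuous_const

theorem exists_norm_le_of_mem_polyh {u : ι → E →ₗ[ℝ] ℝ} (hu : ∀ x, (∀ i, u i x ≤ 0) → x = 0) :
    ∃ K : ℝ, 0 ≤ K ∧ ∀ h x, x ∈ polyh u h → ‖x‖ ≤ K * ∑ i, |h i| := by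
  have hcont : Continuous fun x : E => ∑ i, max (u i x) 0 :=
    continuous_finsetSum _ fun i _ =>
      (LinearMap.continuous_of_finiteDimensional (u i)).max continuous_const
  have hnn : ∀ x : E, 0 ≤ ∑ i, max (u i x) 0 := fun x =>
    Finset.sum_nonneg fun i _ => le_max_right _ _
  obtain ⟨c, hc, hcx⟩ : ∃ c : ℝ, 0 < c ∧ ∀ x ∈ Metric.sphere (0 : E) 1, c ≤ ∑ i, max (u i x) 0 := by
    rcases (Metric.sphere (0 : E) 1).eq_empty_or_nonempty with he | hne
    · exact ⟨1, one_pos, by simp [he]⟩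
    · obtain ⟨x, hx, hmin⟩ := (isCompact_sphere (0 : E) 1).exists_isMinOn hne hcont.continuousOn
      refine ⟨_, lt_of_le_of_ne (hnn x) fun h0 => ?_, fun y hy => hmin hy⟩
      have h1 := (Finset.sum_eq_zero_iff_of_nonneg (fun i _ => le_max_right (u i x) 0)).mp h0.symm
      have h2 := hu x fun i => max_eq_right_iff.mp (h1 i (Finset.mem_univ i))
      rw [h2] at hx
      simp at hx
  refine ⟨c⁻¹, (inv_pos.mpr hc).le, fun h x hx => ?_⟩
  have hsum : ∑ i, max (u i x) 0 ≤ ∑ i, |h i| := Finset.sum_le_sum fun i _ =>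
    max_le ((hx i).trans (le_abs_self _)) (abs_nonneg _)
  have hle : c * ‖x‖ ≤ ∑ i, max (u i x) 0 := by
    by_cases h0 : x = 0
    · simp [h0]
    · have hn : 0 < ‖x‖ := norm_pos_iff.mpr h0
      have h1 := hcx (‖x‖⁻¹ • x) (by simp [norm_smul, hn.ne'])
      have h2 : ∑ i, max (u i (‖x‖⁻¹ • x)) 0 = ‖x‖⁻¹ * ∑ i, max (u i x) 0 := by
        rw [Finset.mul_sum]
        refine Finset.sum_congr rfl fun i _ => ?_
        rw [map_smul, smul_eq_mul, mul_max_of_nonneg _ _ (inv_pos.mpr hn).le, mul_zero]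
      rw [h2, inv_mul_eq_div, le_div_iff₀ hn] at h1
      exact h1
  rw [inv_mul_eq_div, le_div_iff₀ hc, mul_comm]
  exact hle.trans hsum

theorem isCompact_polyh {u : ι → E →ₗ[ℝ] ℝ} (hu : ∀ x, (∀ i, u i x ≤ 0) → x = 0) (h : ι → ℝ) :
    IsCompact (polyh u h) := by
  obtain ⟨K, -, hK⟩ := exists_norm_le_of_mem_polyh hu
  refine (isCompact_closedBall (0 : E) (K * ∑ i, |h i|)).of_isClosed_subset (isClosed_polyh u h) ?_
  intro x hx
  simpa using hK h x hx

/-- The set of right-hand sides for which a prescribed face is nonempty is closed. -/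
theorem isClosed_face_nonempty {u : ι → E →ₗ[ℝ] ℝ} (hu : ∀ x, (∀ i, u i x ≤ 0) → x = 0)
    (T : Set ι) : IsClosed {h : ι → ℝ | ∃ x ∈ polyh u h, ∀ i ∈ T, u i x = h i} := by
  obtain ⟨K, hK0, hK⟩ := exists_norm_le_of_mem_polyh hu
  apply IsSeqClosed.isClosed
  intro hs h hmem hlim
  choose x hx hxT using hmem
  have hi : ∀ i, Tendsto (fun n => hs n i) atTop (𝓝 (h i)) := fun i =>
    (continuous_apply i).tendsto h |>.comp hlim
  have hbdd : Bornology.IsBounded (range x) := by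
    have hc : Continuous fun h : ι → ℝ => K * ∑ i, |h i| := by fun_prop
    have h1 := (hc.tendsto h).comp hlim
    obtain ⟨M, hM⟩ := h1.bddAbove_range
    refine isBounded_iff_forall_norm_le.mpr ⟨M, ?_⟩
    rintro _ ⟨n, rfl⟩
    exact (hK _ _ (hx n)).trans (hM ⟨n, rfl⟩)
  obtain ⟨y, -, φ, hφ, hy⟩ := tendsto_subseq_of_bounded hbdd (fun n => mem_range_self n)
  have hui : ∀ i, Tendsto (fun n => u i (x (φ n))) atTop (𝓝 (u i y)) := fun i =>
    ((LinearMap.continuous_of_finiteDimensional (u i)).tendsto y).comp hy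
  refine ⟨y, fun i => ?_, fun i hiT => ?_⟩
  · exact le_of_tendsto_of_tendsto' (hui i) ((hi i).comp hφ.tendsto_atTop) fun n => hx _ i
  · refine tendsto_nhds_unique (hui i) ?_
    have := (hi i).comp hφ.tendsto_atTop
    refine this.congr fun n => ?_
    exact (hxT _ i hiT).symm

theorem eventually_polyh_eq_empty {u : ι → E →ₗ[ℝ] ℝ} (hu : ∀ x, (∀ i, u i x ≤ 0) → x = 0)
    {a : ι → ℝ} (ha : polyh u a = ∅) : ∀ᶠ h in 𝓝 a, polyh u h = ∅ := by
  have h1 := (isClosed_face_nonempty hu ∅).isOpen_compl.mem_nhds (x := a) (by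
    rintro ⟨x, hx, -⟩
    rw [ha] at hx; exact hx)
  filter_upwards [h1] with h hh
  by_contra hne
  obtain ⟨x, hx⟩ := Set.nonempty_iff_ne_empty.mpr hne
  exact hh ⟨x, hx, by simp⟩

theorem isOpen_isSimpleAt {u : ι → E →ₗ[ℝ] ℝ} (hu : ∀ x, (∀ i, u i x ≤ 0) → x = 0) :
    IsOpen {h : ι → ℝ | IsSimpleAt u h} := by
  have : {h : ι → ℝ | IsSimpleAt u h} = ⋂ T : {T : Set ι // ∃ c : ι → ℝ, c ≠ 0 ∧
      (∀ i ∉ T, c i = 0) ∧ ∑ i, c i • u i = 0},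
      {h : ι → ℝ | ∃ x ∈ polyh u h, ∀ i ∈ T.1, u i x = h i}ᶜ := by
    ext h
    simp only [Set.mem_iInter, mem_compl_iff, Set.mem_ofPred_eq]
    constructor
    · rintro hs ⟨T, c, hc0, hcT, hc⟩ ⟨x, hx, hxT⟩
      exact hc0 (hs x hx c (fun i hi => hcT i fun hiT => hi (hxT i hiT)) hc)
    · intro hT x hx c hct hc
      by_contra hc0
      exact hT ⟨{i | u i x = h i}, c, hc0, fun i hi => hct i hi, hc⟩ ⟨x, hx, fun i hi => hi⟩
  rw [this]
  exact isOpen_iInter_of_finite fun T => (isClosed_face_nonempty hu T.1).isOpen_compl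

end

section
set_option linter.unusedSectionVars false
open Set Filter Topology
variable {ι : Type*} [Fintype ι] [DecidableEq ι]

theorem exists_eval_eq_integral (q : MvPolynomial ι ℝ) (i : ι) (α : ι → ℝ) (b : ℝ) :
    ∃ r : MvPolynomial ι ℝ, ∀ h : ι → ℝ,
      ∫ s in b..h i, MvPolynomial.eval (fun j => if j = i then 1 else h j - s * α j) q
        = MvPolynomial.eval h r := by
  classical
  let W : Polynomial (MvPolynomial ι ℝ) := MvPolynomial.aeval (R := ℝ)
    (fun j => if j = i then 1 else
      Polynomial.C (MvPolynomial.X j) - Polynomial.X * Polynomial.C (MvPolynomial.C (α j))) q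
  have hW : ∀ (h : ι → ℝ) (s : ℝ),
      MvPolynomial.eval (fun j => if j = i then 1 else h j - s * α j) q
        = W.eval₂ (MvPolynomial.eval h) s := by
    intro h s
    change _ = Polynomial.eval₂RingHom (MvPolynomial.eval h) s W
    induction q using MvPolynomial.induction_on with
    | C a => simp [W, MvPolynomial.algebraMap_eq, Polynomial.algebraMap_apply]
    | add p q hp hq => simp only [map_add, W] at hp hq ⊢; rw [hp, hq]
    | mul_X p j hp =>
      simp only [map_mul, W, MvPolynomial.eval_X, MvPolynomial.aeval_X] at hp ⊢
      rw [hp]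
      congr 1
      by_cases hj : j = i
      · simp [hj]
      · simp only [hj, if_false, Polynomial.coe_eval₂RingHom, Polynomial.eval₂_sub,
          Polynomial.eval₂_mul, Polynomial.eval₂_C, Polynomial.eval₂_X, MvPolynomial.eval_X,
          MvPolynomial.eval_C]
  refine ⟨∑ k ∈ Finset.range (W.natDegree + 1), W.coeff k *
    (MvPolynomial.C (1 / (k + 1 : ℝ)) * (MvPolynomial.X i ^ (k + 1) - MvPolynomial.C (b ^ (k + 1)))),
    fun h => ?_⟩
  simp only [hW, Polynomial.eval₂_eq_sum_range, map_sum, map_mul, map_sub, map_pow,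
    MvPolynomial.eval_X, MvPolynomial.eval_C]
  rw [intervalIntegral.integral_finsetSum]
  · refine Finset.sum_congr rfl fun k _ => ?_
    rw [intervalIntegral.integral_const_mul, integral_pow]
    congr 1; field_simp
  · intro k _
    exact (Continuous.intervalIntegrable (by fun_prop) _ _)

theorem measure_toReal_sub_eq_integral {F : Type*} [MeasurableSpace F] (ν : Measure F)
    [SFinite ν] (B : ℝ → Set F) (hB : MeasurableSet {z : ℝ × F | z.2 ∈ B z.1})
    (hBfin : ∀ s, ν (B s) ≠ ⊤)
    (hfin : ∀ t, (volume.prod ν) {z : ℝ × F | z.1 ≤ t ∧ z.2 ∈ B z.1} ≠ ⊤) (t t' : ℝ) :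
    ((volume.prod ν) {z : ℝ × F | z.1 ≤ t ∧ z.2 ∈ B z.1}).toReal -
      ((volume.prod ν) {z : ℝ × F | z.1 ≤ t' ∧ z.2 ∈ B z.1}).toReal
      = ∫ s in t'..t, (ν (B s)).toReal := by
  have hmeas : Measurable fun s => ν (B s) := measurable_measure_prodMk_left hB
  have e1 : ∀ t, (volume.prod ν) {z : ℝ × F | z.1 ≤ t ∧ z.2 ∈ B z.1}
      = ∫⁻ s in Iic t, ν (B s) := by
    intro t
    have hm : MeasurableSet {z : ℝ × F | z.1 ≤ t ∧ z.2 ∈ B z.1} :=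
      (measurableSet_le measurable_fst measurable_const).inter hB
    rw [Measure.prod_apply hm, ← lintegral_indicator measurableSet_Iic]
    refine lintegral_congr fun s => ?_
    by_cases hs : s ≤ t
    · rw [indicator_of_mem (show s ∈ Iic t from hs)]
      congr 1; ext y; simp [hs]
    · rw [indicator_of_notMem (show s ∉ Iic t from hs)]
      convert measure_empty (μ := ν)
      ext y; simp [hs]
  have e2 : ∀ t, ((volume.prod ν) {z : ℝ × F | z.1 ≤ t ∧ z.2 ∈ B z.1}).toReal
      = ∫ s in Iic t, (ν (B s)).toReal := by
    intro t
    rw [e1, integral_toReal hmeas.aemeasurable]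
    exact Filter.Eventually.of_forall fun s => (hBfin s).lt_top
  have e3 : ∀ t, IntegrableOn (fun s => (ν (B s)).toReal) (Iic t) := fun t =>
    integrable_toReal_of_lintegral_ne_top hmeas.aemeasurable (e1 t ▸ hfin t)
  rw [e2, e2, intervalIntegral.integral_Iic_sub_Iic (e3 _) (e3 _)]

/-- Coordinates on `ℝ^{k+1}` in which a nonzero functional is the first coordinate. -/
theorem exists_linearEquiv_fst {k : ℕ} (f : (Fin (k + 1) → ℝ) →ₗ[ℝ] ℝ) (hf : f ≠ 0) :
    ∃ g : (ℝ × (Fin k → ℝ)) ≃ₗ[ℝ] (Fin (k + 1) → ℝ), ∀ z, f (g z) = z.1 := by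
  obtain ⟨v, hv⟩ : ∃ v, f v = 1 := by
    obtain ⟨w, hw⟩ : ∃ w, f w ≠ 0 := by
      by_contra! h; exact hf (LinearMap.ext h)
    exact ⟨(f w)⁻¹ • w, by simp [hw]⟩
  have hfin : Module.finrank ℝ (LinearMap.ker f) = k := by
    have h1 := LinearMap.finrank_range_add_finrank_ker f
    have h2 : LinearMap.range f = ⊤ := by
      rw [LinearMap.range_eq_top]
      intro c; exact ⟨c • v, by simp [hv]⟩
    rw [h2] at h1
    simp at h1
    omega
  let ψ : (Fin k → ℝ) ≃ₗ[ℝ] LinearMap.ker f := LinearEquiv.ofFinrankEq _ _ (by simp [hfin])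
  let g : (ℝ × (Fin k → ℝ)) →ₗ[ℝ] (Fin (k + 1) → ℝ) :=
    (LinearMap.toSpanSingleton ℝ _ v).coprod ((LinearMap.ker f).subtype ∘ₗ ψ.toLinearMap)
  have hg : ∀ z, f (g z) = z.1 := fun z => by
    simp [g, hv]
  have hinj : Function.Injective g := by
    rw [← LinearMap.ker_eq_bot, LinearMap.ker_eq_bot']
    rintro ⟨s, y⟩ hz
    have hs : s = 0 := by
      have := hg (s, y)
      rw [hz, map_zero] at this; exact this.symm
    subst hs
    have h1 : ((ψ y : LinearMap.ker f) : Fin (k + 1) → ℝ) = 0 := by simpa [g] using hz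
    have h2 : ψ y = 0 := Subtype.ext h1
    have h3 : y = 0 := by simpa using h2
    rw [h3]; rfl
  refine ⟨LinearEquiv.ofInjectiveOfFinrankEq g hinj (by simp; ring), fun z => ?_⟩
  exact hg z

end

section
set_option linter.unusedSectionVars false
open Set Filter Topology
variable {ι : Type*} [Fintype ι] [DecidableEq ι]

theorem tendsto_update_self (a : ι → ℝ) (i : ι) :
    Tendsto (fun h : ι → ℝ => Function.update h i (a i)) (𝓝 a) (𝓝 a) := by
  have h1 : Continuous fun h : ι → ℝ => Function.update h i (a i) :=
    continuous_id.update i continuous_const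
  have h2 := h1.tendsto a
  rwa [Function.update_eq_self] at h2

theorem exists_eval_eq_volume_sub_update {n : ℕ}
    (IH : ∀ k, n = k + 1 → ∀ u : ι → (Fin k → ℝ) →ₗ[ℝ] ℝ, (∀ x, (∀ i, u i x ≤ 0) → x = 0) →
      ∀ a, IsSimpleAt u a → ∃ q : MvPolynomial ι ℝ,
        ∀ᶠ h in 𝓝 a, (volume (polyh u h)).toReal = MvPolynomial.eval h q)
    (u : ι → (Fin n → ℝ) →ₗ[ℝ] ℝ) (hu : ∀ x, (∀ i, u i x ≤ 0) → x = 0) (a : ι → ℝ)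
    (ha : IsSimpleAt u a) (i : ι) :
    ∃ r : MvPolynomial ι ℝ, ∀ᶠ h in 𝓝 a, (volume (polyh u h)).toReal -
      (volume (polyh u (Function.update h i (a i)))).toReal = MvPolynomial.eval h r := by
  by_cases hui : u i = 0
  · refine ⟨0, ?_⟩
    by_cases hai : 0 < a i
    · have h1 : ∀ᶠ h : ι → ℝ in 𝓝 a, 0 < h i :=
        (continuous_apply i).continuousAt.eventually_const_lt hai
      filter_upwards [h1] with h hh
      have : polyh u h = polyh u (Function.update h i (a i)) := by
        ext x
        simp only [mem_polyh]
        refine forall_congr' fun j => ?_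
        by_cases hj : j = i
        · subst hj; simp [hui, hh.le, hai.le]
        · simp [hj]
      rw [← this]; simp
    · have hemp : polyh u a = ∅ := by
        rw [Set.eq_empty_iff_forall_notMem]
        intro x hx
        have h0 : a i = 0 := le_antisymm (not_lt.mp hai) (by simpa [hui] using hx i)
        have h1 := ha x hx (Pi.single i 1) (fun j hj => by
          by_cases hji : j = i
          · subst hji; simp [hui, h0] at hj
          · simp [hji]) (by
            rw [Finset.sum_eq_single i] <;> simp +contextual [hui])
        have h2 := congrFun h1 i
        simp at h2
      have h1 := eventually_polyh_eq_empty hu hemp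
      filter_upwards [h1, (tendsto_update_self a i).eventually h1] with h hh hh'
      rw [hh, hh']; simp
  · obtain _ | k := n
    · exact absurd (LinearMap.ext fun x => by rw [Subsingleton.elim x 0, map_zero, map_zero]) hui
    obtain ⟨g, hg⟩ := exists_linearEquiv_fst (u i) hui
    let G : (ℝ × (Fin k → ℝ)) ≃L[ℝ] (Fin (k + 1) → ℝ) := g.toContinuousLinearEquiv
    have hGg : ∀ z, G z = g z := fun z => rfl
    let α : ι → ℝ := fun j => u j (g (1, 0))
    let u' : ι → (Fin k → ℝ) →ₗ[ℝ] ℝ := fun j => u j ∘ₗ g.toLinearMap ∘ₗ LinearMap.inr ℝ ℝ _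
    have hu'i : u' i = 0 := LinearMap.ext fun y => by simp [u', hg]
    have hsplit : ∀ j s y, u j (g (s, y)) = s * α j + u' j y := by
      intro j s y
      have : ((s, y) : ℝ × (Fin k → ℝ)) = s • (1, 0) + (0, y) := by simp
      rw [this, map_add, map_add, map_smul, map_smul]
      simp [α, u']
    let H : (ι → ℝ) → ℝ → ι → ℝ := fun h s j => if j = i then 1 else h j - s * α j
    have hmemB : ∀ h s y, y ∈ polyh u' (H h s) ↔ ∀ j, j ≠ i → u j (g (s, y)) ≤ h j := by
      intro h s y
      simp only [mem_polyh, H, hsplit]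
      refine forall_congr' fun j => ?_
      by_cases hj : j = i
      · simp [hj, hu'i]
      · simp only [hj, if_false, ne_eq, not_false_eq_true, forall_true_left]
        constructor <;> intro h <;> linarith
    have hpre : ∀ h, G ⁻¹' polyh u h = {z | z.1 ≤ h i ∧ z.2 ∈ polyh u' (H h z.1)} := by
      intro h
      ext ⟨s, y⟩
      change g (s, y) ∈ polyh u h ↔ s ≤ h i ∧ y ∈ polyh u' (H h s)
      rw [hmemB]
      constructor
      · intro hx
        exact ⟨by simpa [hg] using hx i, fun j _ => hx j⟩
      · rintro ⟨h1, h2⟩ j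
        by_cases hj : j = i
        · subst hj; simpa [hg] using h1
        · exact h2 j hj
    have hu' : ∀ y, (∀ j, u' j y ≤ 0) → y = 0 := by
      intro y hy
      have h1 : g (0, y) = 0 := hu _ fun j => by
        rw [hsplit, zero_mul, zero_add]; exact hy j
      have h2 : ((0, y) : ℝ × (Fin k → ℝ)) = 0 := by simpa using h1
      exact congrArg Prod.snd h2
    have hHupd : ∀ h t s, H (Function.update h i t) s = H h s := by
      intro h t s
      funext j
      by_cases hj : j = i <;> simp [H, hj]
    have hsimple : IsSimpleAt u' (H a (a i)) := by
      intro y hy c hct hc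
      have hci : c i = 0 := hct i (by simp [hu'i, H])
      have hx : g (a i, y) ∈ polyh u a := by
        have : ((a i, y) : ℝ × (Fin k → ℝ)) ∈ G ⁻¹' polyh u a := by
          rw [hpre]; exact ⟨le_rfl, hy⟩
        exact this
      have h1 := ha _ hx (c - Pi.single i (∑ j, c j * α j)) (fun j hj => by
        by_cases hji : j = i
        · subst hji; simp [hg] at hj
        · simp only [Pi.sub_apply, Pi.single_apply, hji, if_false, sub_zero]
          refine hct j fun h2 => hj ?_
          rw [hsplit, h2]
          simp [H, hji]) (by
        refine LinearMap.ext fun x => ?_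
        obtain ⟨⟨s, z⟩, rfl⟩ := g.surjective x
        have h2 : ∑ j, c j * u' j z = 0 := by
          have := LinearMap.congr_fun hc z
          simpa using this
        have h3 : ∀ j, (c - Pi.single i (∑ j, c j * α j) : ι → ℝ) j * u j (g (s, z)) =
            s * (c j * α j) + c j * u' j z - (Pi.single i (s * ∑ j, c j * α j) : ι → ℝ) j := by
          intro j
          by_cases hji : j = i
          · subst hji
            simp [hg, hci]; ring
          · simp [hji, hsplit]; ring
        simp only [LinearMap.sum_apply, LinearMap.smul_apply, smul_eq_mul, h3,
          Finset.sum_sub_distrib, Finset.sum_add_distrib, h2, ← Finset.mul_sum]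
        simp)
      funext j
      by_cases hji : j = i
      · rw [hji, hci]; rfl
      · have := congrFun h1 j
        simpa [hji] using this
    obtain ⟨q, hq⟩ := IH k rfl u' hu' _ hsimple
    obtain ⟨r, hr⟩ := exists_eval_eq_integral q i α (a i)
    have hHcont : Continuous fun z : (ι → ℝ) × ℝ => H z.1 z.2 := by
      refine continuous_pi fun j => ?_
      by_cases hj : j = i
      · simp only [H, hj, if_true]; exact continuous_const
      · simp only [H, hj, if_false]; fun_prop
    have hq' : ∀ᶠ z : (ι → ℝ) × ℝ in 𝓝 (a, a i),
        (volume (polyh u' (H z.1 z.2))).toReal = MvPolynomial.eval (H z.1 z.2) q :=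
      (hHcont.tendsto (a, a i)).eventually hq
    obtain ⟨ε, hε, hball⟩ := Metric.eventually_nhds_iff.mp hq'
    have : (volume : Measure (ℝ × (Fin k → ℝ))).IsAddHaarMeasure :=
      Measure.prod.instIsAddHaarMeasure volume volume
    have : (Measure.map G (volume : Measure (ℝ × (Fin k → ℝ)))).IsAddHaarMeasure :=
      G.isAddHaarMeasure_map _
    obtain ⟨c, hc⟩ : ∃ c : NNReal, (volume : Measure (Fin (k + 1) → ℝ))
        = c • Measure.map G (volume : Measure (ℝ × (Fin k → ℝ))) :=
      ⟨_, Measure.isAddLeftInvariant_eq_smul volume (Measure.map G volume)⟩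
    have hvol : ∀ h, (volume (polyh u h)).toReal = c * ((volume.prod volume)
        {z : ℝ × (Fin k → ℝ) | z.1 ≤ h i ∧ z.2 ∈ polyh u' (H h z.1)}).toReal := by
      intro h
      rw [hc, Measure.smul_apply,
        Measure.map_apply G.continuous.measurable (isClosed_polyh u h).measurableSet]
      change (c • volume (G ⁻¹' polyh u h)).toReal = _
      rw [hpre]
      simp [ENNReal.smul_def, Measure.volume_eq_prod]
    refine ⟨MvPolynomial.C (c : ℝ) * r, ?_⟩
    filter_upwards [Metric.ball_mem_nhds a hε] with h hh
    rw [hvol, hvol, ← mul_sub]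
    simp only [hHupd, Function.update_self]
    rw [measure_toReal_sub_eq_integral volume (fun s => polyh u' (H h s))]
    · rw [map_mul, MvPolynomial.eval_C, ← hr]
      congr 1
      refine intervalIntegral.integral_congr fun s hs => ?_
      refine hball (y := (h, s)) ?_
      rw [Prod.dist_eq, max_lt_iff]
      refine ⟨hh, ?_⟩
      have h1 : |s - a i| ≤ |h i - a i| := abs_sub_left_of_mem_uIcc hs
      have h2 : dist (h i) (a i) ≤ dist h a := dist_le_pi_dist h a i
      rw [Real.dist_eq] at h2 ⊢
      exact (h1.trans h2).trans_lt hh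
    · refine IsClosed.measurableSet ?_
      have : {z : ℝ × (Fin k → ℝ) | z.2 ∈ polyh u' (H h z.1)} =
          G ⁻¹' ⋂ j, ⋂ (_ : j ≠ i), {x | u j x ≤ h j} := by
        ext ⟨s, y⟩
        simp only [Set.mem_ofPred_eq, hmemB, mem_preimage, mem_iInter]
        rfl
      rw [this]
      exact (isClosed_iInter fun j => isClosed_iInter fun _ => isClosed_le
        (LinearMap.continuous_of_finiteDimensional (u j)) continuous_const).preimage G.continuous
    · exact fun s => (isCompact_polyh hu' _).measure_ne_top
    · intro t
      have h1 := hpre (Function.update h i t)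
      simp only [hHupd, Function.update_self] at h1
      rw [← h1]
      exact (G.toHomeomorph.isCompact_preimage.mpr (isCompact_polyh hu _)).measure_ne_top

theorem eventually_volume_polyh_eq_eval (n : ℕ) :
    ∀ u : ι → (Fin n → ℝ) →ₗ[ℝ] ℝ, (∀ x, (∀ i, u i x ≤ 0) → x = 0) →
      ∀ a, IsSimpleAt u a → ∃ q : MvPolynomial ι ℝ,
        ∀ᶠ h in 𝓝 a, (volume (polyh u h)).toReal = MvPolynomial.eval h q := by
  induction n using Nat.strong_induction_on with
  | _ n IH =>
  intro u hu a ha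
  have key := exists_eval_eq_volume_sub_update
    (fun k hk => IH k (by omega)) u hu a ha
  choose r hr using key
  have main : ∀ S : Finset ι, ∃ q : MvPolynomial ι ℝ, ∀ᶠ h in 𝓝 a,
      (volume (polyh u h)).toReal =
        (volume (polyh u (S.piecewise a h))).toReal + MvPolynomial.eval h q := by
    intro S
    induction S using Finset.induction_on with
    | empty => exact ⟨0, by simp⟩
    | insert i S hi ih =>
      obtain ⟨q, hq⟩ := ih
      let σ : ι → MvPolynomial ι ℝ := fun j =>
        if j ∈ S then MvPolynomial.C (a j) else MvPolynomial.X j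
      have hσ : ∀ h p, MvPolynomial.eval h (MvPolynomial.bind₁ σ p) =
          MvPolynomial.eval (S.piecewise a h) p := by
        intro h p
        rw [← MvPolynomial.coe_aeval_eq_eval, RingHom.coe_coe, MvPolynomial.aeval_bind₁,
          ← MvPolynomial.coe_aeval_eq_eval, RingHom.coe_coe]
        congr 2
        funext j
        by_cases hj : j ∈ S <;> simp [σ, hj]
      refine ⟨MvPolynomial.bind₁ σ (r i) + q, ?_⟩
      have ht : Tendsto (fun h : ι → ℝ => S.piecewise a h) (𝓝 a) (𝓝 a) := by
        have h1 : Continuous fun h : ι → ℝ => S.piecewise a h :=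
          continuous_pi fun j => by
            by_cases hj : j ∈ S
            · simp only [Finset.piecewise, hj, if_true]; exact continuous_const
            · simp only [Finset.piecewise, hj, if_false]; exact continuous_apply j
        have h2 := h1.tendsto a
        rwa [Finset.piecewise_same] at h2
      filter_upwards [hq, ht.eventually (hr i)] with h h1 h2
      rw [Finset.piecewise_insert, h1, map_add, hσ, ← h2]
      ring
  obtain ⟨q, hq⟩ := main Finset.univ
  refine ⟨MvPolynomial.C (volume (polyh u a)).toReal + q, ?_⟩
  filter_upwards [hq] with h hh
  rw [hh, Finset.piecewise_univ]
  simp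

theorem eventually_measure_polyh_eq_eval {E : Type*} [NormedAddCommGroup E] [NormedSpace ℝ E]
    [FiniteDimensional ℝ E] [MeasurableSpace E] [BorelSpace E] (μ : Measure E)
    [μ.IsAddHaarMeasure] (u : ι → E →ₗ[ℝ] ℝ) (hu : ∀ x, (∀ i, u i x ≤ 0) → x = 0)
    (a : ι → ℝ) (ha : IsSimpleAt u a) : ∃ q : MvPolynomial ι ℝ,
      ∀ᶠ h in 𝓝 a, (μ (polyh u h)).toReal = MvPolynomial.eval h q := by
  let e : (Fin (Module.finrank ℝ E) → ℝ) ≃L[ℝ] E :=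
    (LinearEquiv.ofFinrankEq _ _ (by simp)).toContinuousLinearEquiv
  have : (Measure.map e (volume : Measure (Fin (Module.finrank ℝ E) → ℝ))).IsAddHaarMeasure :=
    e.isAddHaarMeasure_map _
  obtain ⟨c, hc⟩ : ∃ c : NNReal, μ = c • Measure.map e volume :=
    ⟨_, Measure.isAddLeftInvariant_eq_smul μ (Measure.map e volume)⟩
  let u' : ι → (Fin (Module.finrank ℝ E) → ℝ) →ₗ[ℝ] ℝ :=
    fun i => u i ∘ₗ e.toLinearEquiv.toLinearMap
  have hpre : ∀ h, e ⁻¹' polyh u h = polyh u' h := fun h => rfl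
  obtain ⟨q, hq⟩ := eventually_volume_polyh_eq_eval _ u'
    (fun x hx => by simpa using hu (e x) hx) a (by
      intro x hx b hb hb0
      refine ha (e x) hx b hb (LinearMap.ext fun y => ?_)
      have := LinearMap.congr_fun hb0 (e.symm y)
      simpa [u'] using this)
  refine ⟨MvPolynomial.C (c : ℝ) * q, ?_⟩
  filter_upwards [hq] with h hh
  rw [hc, Measure.smul_apply, 
    Measure.map_apply e.continuous.measurable (isClosed_polyh u h).measurableSet]
  change (c • volume (e ⁻¹' polyh u h)).toReal = _
  rw [hpre, map_mul, MvPolynomial.eval_C, ← hh]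
  simp [ENNReal.smul_def]

end

section
set_option linter.unusedSectionVars false
open Set Filter Topology
variable {ι : Type*} [Fintype ι] [DecidableEq ι]

/-- Iterated forward differences. -/
def diffD : List (ι → ℝ) → ((ι → ℝ) → ℝ) → (ι → ℝ) → ℝ
  | [], F, x => F x
  | y :: ys, F, x => diffD ys F (x + y) - diffD ys F x

theorem hasDerivAt_diffD_eval (ys : List (ι → ℝ)) (y : ι → ℝ) (q : MvPolynomial ι ℝ)
    (x : ι → ℝ) (t : ℝ) :
    HasDerivAt (fun t : ℝ => diffD ys (fun z => MvPolynomial.eval z q) (x + t • y))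
      (diffD ys (fun z => MvPolynomial.eval z (dirD y q)) (x + t • y)) t := by
  induction ys generalizing x with
  | nil =>
    simp only [diffD, ← eval_linePoly, ← derivative_linePoly]
    exact Polynomial.hasDerivAt _ _
  | cons z ys ih =>
    simp only [diffD, add_right_comm _ _ z]
    exact (ih _).sub (ih _)

theorem exists_diffD_eval_eq (ys : List (ι → ℝ)) (q : MvPolynomial ι ℝ) (x : ι → ℝ) :
    ∃ ξ : ι → ℝ, ‖ξ - x‖ ≤ (ys.map norm).sum ∧
      diffD ys (fun z => MvPolynomial.eval z q) x = MvPolynomial.eval ξ (iterD ys q) := by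
  induction ys generalizing q x with
  | nil => exact ⟨x, by simp, rfl⟩
  | cons y ys ih =>
    obtain ⟨t, ht, hts⟩ := exists_hasDerivAt_eq_slope
      (fun t : ℝ => diffD ys (fun z => MvPolynomial.eval z q) (x + t • y)) _ one_pos
      (fun t _ => (hasDerivAt_diffD_eval ys y q x t).continuousAt.continuousWithinAt)
      (fun t _ => hasDerivAt_diffD_eval ys y q x t)
    obtain ⟨ξ, hξ, he⟩ := ih (dirD y q) (x + t • y)
    refine ⟨ξ, ?_, ?_⟩
    · calc ‖ξ - x‖ = ‖(ξ - (x + t • y)) + t • y‖ := by congr 1; abel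
        _ ≤ ‖ξ - (x + t • y)‖ + ‖t • y‖ := norm_add_le _ _
        _ ≤ (ys.map norm).sum + ‖y‖ := by
          refine add_le_add hξ ?_
          rw [norm_smul, Real.norm_eq_abs, abs_of_pos ht.1]
          exact mul_le_of_le_one_left (norm_nonneg _) ht.2.le
        _ = _ := by rw [List.map_cons, List.sum_cons, add_comm]
    · rw [iterD_cons, ← iterD_dirD, ← he, hts]
      simp [diffD]

theorem diffD_congr {F G : (ι → ℝ) → ℝ} (ys : List (ι → ℝ)) (x : ι → ℝ)
    (h : ∀ z, ‖z - x‖ ≤ (ys.map norm).sum → F z = G z) : diffD ys F x = diffD ys G x := by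
  induction ys generalizing x with
  | nil => exact h x (by simp)
  | cons y ys ih =>
    simp only [diffD]
    rw [ih, ih]
    · intro z hz
      apply h
      rw [List.map_cons, List.sum_cons]
      exact hz.trans (le_add_of_nonneg_left (norm_nonneg _))
    · intro z hz
      apply h
      rw [List.map_cons, List.sum_cons]
      calc ‖z - x‖ = ‖(z - (x + y)) + y‖ := by congr 1; abel
        _ ≤ ‖z - (x + y)‖ + ‖y‖ := norm_add_le _ _
        _ ≤ _ := by linarith

theorem iterD_map_smul_single (l : List ι) (a : ℝ) (q : MvPolynomial ι ℝ) :
    iterD (l.map fun i => a • (Pi.single i 1 : ι → ℝ)) q = a ^ l.length • iterD (coordDirs l) q := by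
  induction l with
  | nil => simp [coordDirs]
  | cons i l ih =>
    simp only [List.map_cons, iterD_cons, ih, coordDirs, List.length_cons, dirD_smul,
      Derivation.map_smul]
    rw [smul_smul, pow_succ]

variable {E : Type*} [NormedAddCommGroup E] [NormedSpace ℝ E]

/-- The points of a polyhedron close to the facets in a given list. -/
def nearFaces (u : ι → E →ₗ[ℝ] ℝ) (l : List ι) (ε : ℝ) (h : ι → ℝ) : Set E :=
  {x | x ∈ polyh u h ∧ ∀ i ∈ l, h i - ε < u i x}

theorem nearFaces_cons (u : ι → E →ₗ[ℝ] ℝ) {i : ι} {l : List ι} (hi : i ∉ l) (ε : ℝ)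
    (h : ι → ℝ) : nearFaces u (l := i :: l) ε h =
      nearFaces u l ε h \ nearFaces u l ε (h + (-ε) • (Pi.single i 1 : ι → ℝ)) := by
  have h1 : ∀ j, j ≠ i → (h + (-ε) • (Pi.single i 1 : ι → ℝ)) j = h j := by
    intro j hj; simp [hj]
  have h2 : (h + (-ε) • (Pi.single i 1 : ι → ℝ)) i = h i - ε := by simp; ring
  ext x
  simp only [nearFaces, Set.mem_sdiff, Set.mem_ofPred_eq, List.mem_cons, forall_eq_or_imp]
  constructor
  · rintro ⟨hx, hxi, hxl⟩
    refine ⟨⟨hx, hxl⟩, fun hx' => ?_⟩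
    have := hx'.1 i
    rw [h2] at this
    linarith
  · rintro ⟨⟨hx, hxl⟩, hn⟩
    refine ⟨hx, ?_, hxl⟩
    by_contra hle
    refine hn ⟨fun j => ?_, fun j hj => ?_⟩
    · by_cases hji : j = i
      · subst hji; rw [h2]; linarith
      · rw [h1 j hji]; exact hx j
    · rw [h1 j (fun hji => hi (hji ▸ hj))]
      exact hxl j hj

theorem nearFaces_shift_subset (u : ι → E →ₗ[ℝ] ℝ) {i : ι} {l : List ι} (hi : i ∉ l) {ε : ℝ}
    (hε : 0 < ε) (h : ι → ℝ) :
    nearFaces u l ε (h + (-ε) • (Pi.single i 1 : ι → ℝ)) ⊆ nearFaces u l ε h := by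
  have h1 : ∀ j, j ≠ i → (h + (-ε) • (Pi.single i 1 : ι → ℝ)) j = h j := by
    intro j hj; simp [hj]
  have h2 : (h + (-ε) • (Pi.single i 1 : ι → ℝ)) i = h i - ε := by simp; ring
  rintro x ⟨hx, hxl⟩
  refine ⟨fun j => ?_, fun j hj => ?_⟩
  · by_cases hji : j = i
    · subst hji; have := hx j; rw [h2] at this; linarith
    · have := hx j; rwa [h1 j hji] at this
  · have := hxl j hj
    rwa [h1 j (fun hji => hi (hji ▸ hj))] at this

variable [FiniteDimensional ℝ E] [MeasurableSpace E] [BorelSpace E]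

theorem measurableSet_nearFaces (u : ι → E →ₗ[ℝ] ℝ) (l : List ι) (ε : ℝ) (h : ι → ℝ) :
    MeasurableSet (nearFaces u l ε h) := by
  have : nearFaces u l ε h = polyh u h ∩ ⋂ i, ⋂ (_ : i ∈ l), {x | h i - ε < u i x} := by
    ext x; simp [nearFaces]
  rw [this]
  exact (isClosed_polyh u h).measurableSet.inter (MeasurableSet.iInter fun i =>
    MeasurableSet.iInter fun _ => measurableSet_lt measurable_const
      (LinearMap.continuous_of_finiteDimensional (u i)).measurable)

variable (μ : Measure E) [μ.IsAddHaarMeasure] {u : ι → E →ₗ[ℝ] ℝ}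

theorem measure_nearFaces_ne_top (hu : ∀ x, (∀ i, u i x ≤ 0) → x = 0) (l : List ι) (ε : ℝ)
    (h : ι → ℝ) : μ (nearFaces u l ε h) ≠ ⊤ :=
  ((measure_mono fun _ hx => hx.1).trans_lt (isCompact_polyh hu h).measure_lt_top).ne

theorem measure_nearFaces (hu : ∀ x, (∀ i, u i x ≤ 0) → x = 0) {l : List ι} (hl : l.Nodup)
    {ε : ℝ} (hε : 0 < ε) (h : ι → ℝ) :
    (μ (nearFaces u l ε h)).toReal = (-1) ^ l.length *
      diffD (l.map fun i => (-ε) • (Pi.single i 1 : ι → ℝ)) (fun h => (μ (polyh u h)).toReal) h := by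
  induction l generalizing h with
  | nil => simp [nearFaces, diffD]
  | cons i l ih =>
    rw [List.nodup_cons] at hl
    rw [nearFaces_cons u hl.1 ε, measure_sdiff (nearFaces_shift_subset u hl.1 hε h)
      (measurableSet_nearFaces u l ε _).nullMeasurableSet (measure_nearFaces_ne_top μ hu l ε _),
      ENNReal.toReal_sub_of_le (measure_mono (nearFaces_shift_subset u hl.1 hε h))
      (measure_nearFaces_ne_top μ hu l ε _), ih hl.2, ih hl.2]
    simp only [List.map_cons, diffD, List.length_cons]
    ring

theorem tendsto_measure_nearFaces (hu : ∀ x, (∀ i, u i x ≤ 0) → x = 0) {C : Set (ι → ℝ)}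
    (hC : IsOpen C) {p : MvPolynomial ι ℝ}
    (hp : ∀ h ∈ C, (μ (polyh u h)).toReal = MvPolynomial.eval h p) {l : List ι} (hl : l.Nodup)
    {h : ι → ℝ} (hh : h ∈ C) :
    Tendsto (fun ε => (μ (nearFaces u l ε h)).toReal / ε ^ l.length) (𝓝[>] 0)
      (𝓝 (MvPolynomial.eval h (iterD (coordDirs l) p))) := by
  obtain ⟨δ, hδ, hball⟩ := Metric.isOpen_iff.mp hC h hh
  have hsum : ∀ ε : ℝ, 0 < ε →
      ((l.map fun i => (-ε) • (Pi.single i 1 : ι → ℝ)).map norm).sum ≤ l.length * ε := by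
    intro ε hε
    clear hl
    induction l with
    | nil => simp
    | cons i l ih =>
      simp only [List.map_cons, List.sum_cons, List.length_cons, Nat.cast_succ]
      have : ‖(-ε) • (Pi.single i 1 : ι → ℝ)‖ = ε := by
        rw [norm_smul, Pi.norm_single]; simp [abs_of_pos hε]
      rw [this]; linarith
  have hsmall : ∀ᶠ ε : ℝ in 𝓝[>] 0, l.length * ε < δ := by
    have h1 : Tendsto (fun ε : ℝ => l.length * ε) (𝓝[>] 0) (𝓝 0) := by
      have : Continuous fun ε : ℝ => l.length * ε := by fun_prop
      simpa using (this.tendsto 0).mono_left nhdsWithin_le_nhds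
    exact h1.eventually_lt_const hδ
  have hex : ∀ ε : ℝ, ∃ ξ : ι → ℝ, 0 < ε → l.length * ε < δ → ‖ξ - h‖ ≤ l.length * ε ∧
      (μ (nearFaces u l ε h)).toReal / ε ^ l.length =
        MvPolynomial.eval ξ (iterD (coordDirs l) p) := by
    intro ε
    by_cases hε : 0 < ε ∧ l.length * ε < δ
    · obtain ⟨ξ, hξ, he⟩ := exists_diffD_eval_eq
        (l.map fun i => (-ε) • (Pi.single i 1 : ι → ℝ)) p h
      refine ⟨ξ, fun _ _ => ⟨hξ.trans (hsum ε hε.1), ?_⟩⟩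
      rw [measure_nearFaces μ hu hl hε.1, diffD_congr (G := fun z => MvPolynomial.eval z p), he,
        iterD_map_smul_single, MvPolynomial.smul_eval]
      · rw [← mul_assoc, ← mul_pow, neg_one_mul, neg_neg, mul_div_cancel_left₀]
        exact (pow_pos hε.1 _).ne'
      · intro z hz
        refine hp z (hball ?_)
        rw [Metric.mem_ball, dist_eq_norm]
        exact (hz.trans (hsum ε hε.1)).trans_lt hε.2
    · exact ⟨h, fun h1 h2 => absurd ⟨h1, h2⟩ hε⟩
  choose ξ hξ using hex
  have hξlim : Tendsto ξ (𝓝[>] 0) (𝓝 h) := by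
    rw [tendsto_iff_norm_sub_tendsto_zero]
    have h1 : Tendsto (fun ε : ℝ => l.length * ε) (𝓝[>] 0) (𝓝 0) := by
      have : Continuous fun ε : ℝ => l.length * ε := by fun_prop
      simpa using (this.tendsto 0).mono_left nhdsWithin_le_nhds
    refine squeeze_zero' (Eventually.of_forall fun _ => norm_nonneg _) ?_ h1
    filter_upwards [hsmall, self_mem_nhdsWithin] with ε h2 h3
    exact (hξ ε h3 h2).1
  have h4 := ((MvPolynomial.continuous_eval (iterD (coordDirs l) p)).tendsto h).comp hξlim
  refine h4.congr' ?_
  filter_upwards [hsmall, self_mem_nhdsWithin] with ε h2 h3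
  exact (hξ ε h3 h2).2.symm

theorem eq_zero_of_eval_eq_zero_of_isOpen {C : Set (ι → ℝ)} (hC : IsOpen C) (hne : C.Nonempty)
    {q : MvPolynomial ι ℝ} (hq : ∀ h ∈ C, MvPolynomial.eval h q = 0) : q = 0 := by
  obtain ⟨a, ha⟩ := hne
  obtain ⟨δ, hδ, hball⟩ := Metric.isOpen_iff.mp hC a ha
  refine MvPolynomial.funext_set (fun i => Metric.ball (a i) δ) (fun i => ?_) fun x hx => ?_
  · rw [Real.ball_eq_Ioo]; exact Ioo_infinite (by linarith)
  · rw [map_zero]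
    refine hq x (hball ?_)
    rw [← ball_pi _ hδ] at hx
    exact hx

theorem dirD_eq_zero_of_translation {C : Set (ι → ℝ)}
    (hC : IsOpen C) (hne : C.Nonempty) {p : MvPolynomial ι ℝ}
    (hp : ∀ h ∈ C, (μ (polyh u h)).toReal = MvPolynomial.eval h p) (x : E) :
    dirD (fun i => u i x) p = 0 := by
  refine eq_zero_of_eval_eq_zero_of_isOpen hC hne fun h hh => ?_
  have h1 : ∀ t : ℝ, μ (polyh u (h + t • fun i => u i x)) = μ (polyh u h) := by
    intro t
    have : polyh u (h + t • fun i => u i x) = (t • x) +ᵥ polyh u h := by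
      ext y
      rw [mem_vadd_set_iff_neg_vadd_mem, mem_polyh, mem_polyh]
      refine forall_congr' fun i => ?_
      simp only [Pi.add_apply, Pi.smul_apply, smul_eq_mul, vadd_eq_add, map_add, map_neg, map_smul]
      constructor <;> intro h <;> linarith
    rw [this, measure_vadd]
  have h2 : HasDerivAt (fun t : ℝ => MvPolynomial.eval (h + t • fun i => u i x) p)
      (MvPolynomial.eval (h + (0 : ℝ) • fun i => u i x) (dirD (fun i => u i x) p)) 0 :=
    hasDerivAt_diffD_eval [] _ p h 0
  have h3 : (fun t : ℝ => MvPolynomial.eval (h + t • fun i => u i x) p) =ᶠ[𝓝 0]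
      fun _ => MvPolynomial.eval h p := by
    filter_upwards [exists_segment_mem_of_isOpen hC hh fun i => u i x] with t ht
    rw [← hp _ ht.1, ← hp h hh, h1]
  have h4 := h2.congr_of_eventuallyEq h3.symm
  have h5 := h4.unique (hasDerivAt_const _ _)
  simpa using h5

theorem isVolumePolynomial_of_measure_polyh (hu : ∀ x, (∀ i, u i x ≤ 0) → x = 0)
    {C : Set (ι → ℝ)} (hC : IsOpen C) (hconv : Convex ℝ C) {p : MvPolynomial ι ℝ} {d : ℕ}
    (hd : p.IsHomogeneous d)
    (hp : ∀ h ∈ C, (μ (polyh u h)).toReal = MvPolynomial.eval h p) :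
    IsVolumePolynomial p d C where
  homogeneous := hd
  isOpen := hC
  nonneg l hl w hw := by
    refine ge_of_tendsto (tendsto_measure_nearFaces μ hu hC hp hl hw) ?_
    filter_upwards [self_mem_nhdsWithin] with ε hε
    exact div_nonneg ENNReal.toReal_nonneg (pow_nonneg (le_of_lt hε) _)
  logConcave l hl w hw w' hw' := by
    have hm : (1 / 2 : ℝ) • (w + w') ∈ C := by
      rw [smul_add]
      exact hconv hw hw' (by norm_num) (by norm_num) (by norm_num)
    have t1 := (tendsto_measure_nearFaces μ hu hC hp hl hw).mul
      (tendsto_measure_nearFaces μ hu hC hp hl hw')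
    have t2 := (tendsto_measure_nearFaces μ hu hC hp hl hm).pow 2
    refine le_of_tendsto_of_tendsto t1 t2 ?_
    filter_upwards [self_mem_nhdsWithin] with ε hε
    have hε' : 0 < ε ^ l.length := pow_pos hε _
    rw [div_mul_div_comm, div_pow, ← sq]
    refine div_le_div_of_nonneg_right ?_ (sq_nonneg _)
    have h1 := measure_mul_measure_le_sq μ (measurableSet_nearFaces u l ε w)
      (measurableSet_nearFaces u l ε w')
      (measurableSet_nearFaces u l ε ((1 / 2 : ℝ) • (w + w'))) (by
        rintro x ⟨hx, hxl⟩ y ⟨hy, hyl⟩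
        refine ⟨fun i => ?_, fun i hi => ?_⟩
        · have h1 := hx i
          have h2 := hy i
          simp only [map_smul, map_add, smul_eq_mul, Pi.smul_apply, Pi.add_apply]
          linarith
        · have h1 := hxl i hi
          have h2 := hyl i hi
          simp only [map_smul, map_add, smul_eq_mul, Pi.smul_apply, Pi.add_apply]
          linarith)
    have h2 := ENNReal.toReal_mono
      (ENNReal.pow_ne_top (measure_nearFaces_ne_top μ hu l ε _)) h1
    rwa [ENNReal.toReal_mul, ENNReal.toReal_pow] at h2
  shift l hl w hw hne := by
    have hlim := (tendsto_measure_nearFaces μ hu hC hp hl hw).eventually_ne hne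
    have hx : ∃ x ∈ polyh u w, ∀ i ∈ {i | i ∈ l}, u i x = w i := by
      have hcl := isClosed_face_nonempty hu {i | i ∈ l}
      refine hcl.closure_subset_iff.mpr (subset_refl _) ?_
      rw [Metric.mem_closure_iff]
      intro ε hε
      have h1 : ∀ᶠ δ : ℝ in 𝓝[>] 0, δ < ε :=
        (tendsto_id.mono_left nhdsWithin_le_nhds).eventually_lt_const hε
      obtain ⟨δ, ⟨hδ1, hδ2⟩, hδ3⟩ := ((hlim.and h1).and self_mem_nhdsWithin).exists
      have h2 : (nearFaces u l δ w).Nonempty := by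
        rw [Set.nonempty_iff_ne_empty]
        intro he
        rw [he] at hδ1
        simp at hδ1
      obtain ⟨x, hx, hxl⟩ := h2
      refine ⟨fun i => if i ∈ l then u i x else w i, ⟨x, fun i => ?_, fun i hi => ?_⟩, ?_⟩
      · by_cases hi : i ∈ l
        · simp [hi]
        · simp only [hi, if_false]; exact hx i
      · have hi' : i ∈ l := hi
        simp [hi']
      · rw [dist_pi_lt_iff hε]
        intro i
        by_cases hi : i ∈ l
        · simp only [hi, if_true]
          rw [Real.dist_eq, abs_of_nonneg (sub_nonneg.mpr (hx i))]
          have := hxl i hi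
          linarith
        · simp [hi, hε]
    obtain ⟨x, hx, hxl⟩ := hx
    refine ⟨fun i => w i - u i x, fun i => sub_nonneg.mpr (hx i), fun i hi => ?_, ?_⟩
    · have := hxl i hi
      simp [this]
    · have h1 : (w - fun i => w i - u i x) = fun i => u i x := by
        funext i; simp
      rw [h1]
      exact dirD_eq_zero_of_translation μ hC ⟨w, hw⟩ hp x

end

section
set_option linter.unusedSectionVars false
open Set Filter Topology
variable {ι : Type*} [Fintype ι] [DecidableEq ι]
variable {E : Type*} [NormedAddCommGroup E] [NormedSpace ℝ E]
variable [FiniteDimensional ℝ E] [MeasurableSpace E] [BorelSpace E]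
variable (μ : Measure E) [μ.IsAddHaarMeasure] {u : ι → E →ₗ[ℝ] ℝ}

theorem measure_polyh_smul (h : ι → ℝ) {t : ℝ} (ht : 0 < t) :
    (μ (polyh u (t • h))).toReal = t ^ Module.finrank ℝ E * (μ (polyh u h)).toReal := by
  have : polyh u (t • h) = t • polyh u h := by
    ext x
    rw [mem_smul_set_iff_inv_smul_mem₀ ht.ne', mem_polyh, mem_polyh]
    refine forall_congr' fun i => ?_
    rw [map_smul, Pi.smul_apply, smul_eq_mul, smul_eq_mul, inv_mul_le_iff₀ ht]
  rw [this, Measure.addHaar_smul, ENNReal.toReal_mul, abs_of_pos (pow_pos ht _),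
    ENNReal.toReal_ofReal (pow_pos ht _).le]

theorem eval_homogeneousComponent_of_smul {p : MvPolynomial ι ℝ} {d : ℕ} {h : ι → ℝ}
    (hp : ∀ t : ℝ, 0 < t → MvPolynomial.eval (t • h) p = t ^ d * MvPolynomial.eval h p) :
    MvPolynomial.eval h (MvPolynomial.homogeneousComponent d p) = MvPolynomial.eval h p := by
  let Q : Polynomial ℝ := ∑ k ∈ Finset.range (p.totalDegree + 1),
    Polynomial.C (MvPolynomial.eval h (MvPolynomial.homogeneousComponent k p)) * Polynomial.X ^ k
  have hhom : ∀ (k : ℕ) (t : ℝ), MvPolynomial.eval (t • h) (MvPolynomial.homogeneousComponent k p)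
      = MvPolynomial.eval h (MvPolynomial.homogeneousComponent k p) * t ^ k := by
    intro k t
    have hk := MvPolynomial.homogeneousComponent_isHomogeneous k p
    rw [MvPolynomial.eval_eq, MvPolynomial.eval_eq, Finset.sum_mul]
    refine Finset.sum_congr rfl fun m hm => ?_
    have h1 : ∑ i ∈ m.support, m i = k := by
      have := hk (MvPolynomial.mem_support_iff.mp hm)
      rw [← this, Finsupp.weight_apply, Finsupp.sum]
      simp
    simp only [Pi.smul_apply, smul_eq_mul, mul_pow, Finset.prod_mul_distrib, Finset.prod_pow_eq_pow_sum,
      h1]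
    ring
  have hQ : ∀ t, Q.eval t = MvPolynomial.eval (t • h) p := by
    intro t
    conv_rhs => rw [← MvPolynomial.sum_homogeneousComponent p]
    simp [Q, Polynomial.eval_finsetSum, hhom]
  have hQ' : Q = Polynomial.C (MvPolynomial.eval h p) * Polynomial.X ^ d := by
    refine Polynomial.eq_of_infinite_eval_eq _ _ ((Ioi_infinite (0 : ℝ)).mono fun t ht => ?_)
    have ht' : 0 < t := ht
    change Q.eval t = Polynomial.eval t _
    rw [hQ, hp t ht', Polynomial.eval_mul, Polynomial.eval_C, Polynomial.eval_pow,
      Polynomial.eval_X, mul_comm]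
  have h1 := congrArg (fun P => Polynomial.coeff P d) hQ'
  simp only [Q, Polynomial.finsetSum_coeff, Polynomial.coeff_C_mul, Polynomial.coeff_X_pow,
    if_true, mul_one, mul_ite, mul_zero, Finset.sum_ite_eq, Finset.mem_range] at h1
  rw [← h1]
  split_ifs with h2
  · rfl
  · rw [MvPolynomial.homogeneousComponent_eq_zero _ _ (by omega), map_zero]

theorem exists_isVolumePolynomial (hu : ∀ x, (∀ i, u i x ≤ 0) → x = 0)
    {C : Set (ι → ℝ)} (hC : IsOpen C) (hconv : Convex ℝ C) (hne : C.Nonempty)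
    (hcone : ∀ h ∈ C, ∀ t : ℝ, 0 < t → t • h ∈ C) (hs : ∀ h ∈ C, IsSimpleAt u h) :
    ∃ p : MvPolynomial ι ℝ, IsVolumePolynomial p (Module.finrank ℝ E) C ∧
      ∀ h ∈ C, (μ (polyh u h)).toReal = MvPolynomial.eval h p := by
  obtain ⟨a, ha⟩ := hne
  obtain ⟨q, hq⟩ := eventually_measure_polyh_eq_eval μ u hu a (hs a ha)
  have hpoly : ∀ p : MvPolynomial ι ℝ,
      AnalyticOnNhd ℝ (fun h : ι → ℝ => MvPolynomial.eval h p) univ :=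
    fun p => AnalyticOnNhd.eval_mvPolynomial p
  have han : AnalyticOnNhd ℝ (fun h => (μ (polyh u h)).toReal) C := by
    intro h hh
    obtain ⟨r, hr⟩ := eventually_measure_polyh_eq_eval μ u hu h (hs h hh)
    exact ((hpoly r) h (mem_univ _)).congr (hr.mono fun _ h => h.symm)
  have heq := han.eqOn_of_preconnected_of_eventuallyEq ((hpoly q).mono (subset_univ C))
    hconv.isPreconnected ha hq
  have hp : ∀ h ∈ C, (μ (polyh u h)).toReal =
      MvPolynomial.eval h (MvPolynomial.homogeneousComponent (Module.finrank ℝ E) q) := by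
    intro h hh
    rw [eval_homogeneousComponent_of_smul]
    · exact heq hh
    · intro t ht
      have h1 := heq hh
      have h2 := heq (hcone h hh t ht)
      simp only at h1 h2
      rw [← h1, ← h2, measure_polyh_smul μ h ht]
  exact ⟨_, isVolumePolynomial_of_measure_polyh μ hu hC hconv
    (MvPolynomial.homogeneousComponent_isHomogeneous _ _) hp, hp⟩

end

section
set_option linter.unusedSectionVars false
open Set Filter Topology
variable {ι : Type*} [Fintype ι] [DecidableEq ι]
variable {E : Type*} [NormedAddCommGroup E] [NormedSpace ℝ E]

theorem exists_smul_add_mem_polyh {u : ι → E →ₗ[ℝ] ℝ} {h : ι → ℝ} {x v : E} (hx : x ∈ polyh u h)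
    (hv : ∀ i, u i x = h i → u i v ≤ 0) : ∃ ε : ℝ, 0 < ε ∧ x + ε • v ∈ polyh u h := by
  have h1 : ∀ᶠ ε : ℝ in 𝓝[>] 0, ∀ i, u i (x + ε • v) ≤ h i := by
    rw [Filter.eventually_all]
    intro i
    by_cases hi : u i x = h i
    · filter_upwards [self_mem_nhdsWithin] with ε hε
      have hε' : 0 < ε := hε
      rw [map_add, map_smul, hi, smul_eq_mul]
      have := mul_nonpos_of_nonneg_of_nonpos hε'.le (hv i hi)
      linarith
    · have hlt : u i x < h i := lt_of_le_of_ne (hx i) hi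
      have h2 : Tendsto (fun ε : ℝ => u i (x + ε • v)) (𝓝[>] 0) (𝓝 (u i x)) := by
        have h3 : Continuous fun ε : ℝ => u i x + ε * u i v := by fun_prop
        have h4 := (h3.tendsto 0).mono_left (nhdsWithin_le_nhds (s := Ioi 0))
        simpa using h4
      exact (h2.eventually_lt_const hlt).mono fun _ h => h.le
  obtain ⟨ε, hε, h0⟩ := (h1.and self_mem_nhdsWithin).exists
  exact ⟨ε, h0, hε⟩

theorem exists_sum_smul_of_ker_le (u : ι → E →ₗ[ℝ] ℝ) (T : Set ι) (f : E →ₗ[ℝ] ℝ)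
    (hf : ∀ v, (∀ i ∈ T, u i v = 0) → f v = 0) :
    ∃ c : ι → ℝ, (∀ i ∉ T, c i = 0) ∧ f = ∑ i, c i • u i := by
  classical
  have h1 : f ∈ Submodule.span ℝ (range fun i : T => u i) := by
    apply mem_span_of_iInf_ker_le_ker
    intro v hv
    rw [Submodule.mem_iInf] at hv
    exact hf v fun i hi => hv ⟨i, hi⟩
  obtain ⟨c, hc⟩ := (Submodule.mem_span_range_iff_exists_fun ℝ).mp h1
  refine ⟨fun i => if hi : i ∈ T then c ⟨i, hi⟩ else 0, fun i hi => by simp [hi], ?_⟩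
  rw [← hc]
  symm
  have h2 : ∀ i, (if hi : i ∈ T then c ⟨i, hi⟩ else 0) • u i =
      if hi : i ∈ T then c ⟨i, hi⟩ • u i else 0 := by
    intro i; split_ifs <;> simp
  simp only [h2]
  rw [Finset.sum_dite]
  simp only [Finset.sum_const_zero, add_zero]
  refine Finset.sum_bij (fun i _ => ⟨i.1, (Finset.mem_filter.mp i.2).2⟩) ?_ ?_ ?_ ?_
  · intros; simp
  · intro a _ b _ hab
    exact Subtype.ext (by simpa using hab)
  · intro b _
    exact ⟨⟨b.1, by simp⟩, by simp, rfl⟩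
  · intros; rfl

/-- Linear programming duality at a simple vertex. -/
theorem exists_nonneg_sum_smul_of_isMax {u : ι → E →ₗ[ℝ] ℝ} {h : ι → ℝ} (hs : IsSimpleAt u h)
    {x : E} (hx : x ∈ polyh u h) {f : E →ₗ[ℝ] ℝ} (hf : ∀ y ∈ polyh u h, f y ≤ f x) :
    ∃ a : ι → ℝ, (∀ i, 0 ≤ a i) ∧ (∀ i, u i x ≠ h i → a i = 0) ∧ f = ∑ i, a i • u i := by
  have hdir : ∀ v, (∀ i, u i x = h i → u i v ≤ 0) → f v ≤ 0 := by
    intro v hv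
    obtain ⟨ε, hε, hmem⟩ := exists_smul_add_mem_polyh hx hv
    have := hf _ hmem
    rw [map_add, map_smul, smul_eq_mul] at this
    by_contra hlt
    have := mul_pos hε (not_le.mp hlt)
    linarith
  obtain ⟨a, ha, hfa⟩ := exists_sum_smul_of_ker_le u {i | u i x = h i} f (by
    intro v hv
    refine le_antisymm (hdir v fun i hi => (hv i hi).le) ?_
    have := hdir (-v) fun i hi => by rw [map_neg, hv i hi, neg_zero]
    rw [map_neg] at this
    linarith)
  refine ⟨a, fun i => ?_, ha, hfa⟩
  by_cases hi : u i x = h i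
  swap
  · exact (ha i hi).ge
  obtain ⟨v, hv, hvi⟩ : ∃ v, (∀ k ∈ {k | u k x = h k ∧ k ≠ i}, u k v = 0) ∧ u i v ≠ 0 := by
    by_contra! hcon
    obtain ⟨c, hc, hci⟩ := exists_sum_smul_of_ker_le u {k | u k x = h k ∧ k ≠ i} (u i) hcon
    have h1 := hs x hx (Pi.single i 1 - c : ι → ℝ) (fun k hk => by
      have hki : k ≠ i := fun h => hk (h ▸ hi)
      simp [hki, hc k fun h => hk h.1]) (by
      have h3 : ∀ k, (Pi.single i 1 - c : ι → ℝ) k • u k =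
          (Pi.single i 1 : ι → ℝ) k • u k - c k • u k := 
        fun k => LinearMap.ext fun v => by
          simp only [Pi.sub_apply, LinearMap.smul_apply, LinearMap.sub_apply, smul_eq_mul]; ring
      rw [Finset.sum_congr rfl fun k _ => h3 k, Finset.sum_sub_distrib, ← hci,
        Finset.sum_eq_single i] <;> simp +contextual)
    have h2 := congrFun h1 i
    simp [hc i fun h => h.2 rfl] at h2
  have h1 := hdir (-(u i v)⁻¹ • v) (fun k hk => by
    rw [map_smul]
    by_cases hki : k = i
    · subst hki; simp [hvi]
    · simp [hv k ⟨hk, hki⟩])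
  rw [hfa] at h1
  simp only [LinearMap.sum_apply, LinearMap.smul_apply, map_smul, smul_eq_mul] at h1
  rw [Finset.sum_eq_single i] at h1
  · have h2 : -(u i v)⁻¹ * (a i * u i v) = -a i := by field_simp
    rw [h2] at h1
    linarith
  · intro k _ hki
    by_cases hk : u k x = h k
    · simp [hv k ⟨hk, hki⟩]
    · simp [ha k hk]
  · simp

variable [FiniteDimensional ℝ E]

/-- A nonempty open set of right-hand sides contains a simple one. -/
theorem exists_isSimpleAt_mem (u : ι → E →ₗ[ℝ] ℝ) {U : Set (ι → ℝ)} (hU : IsOpen U)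
    (hne : U.Nonempty) : ∃ h ∈ U, IsSimpleAt u h := by
  by_contra! hcon
  let D := {T : Set ι // ∃ c : ι → ℝ, c ≠ 0 ∧ (∀ i ∉ T, c i = 0) ∧ ∑ i, c i • u i = 0}
  choose c hc0 hcT hcu using fun T : D => T.2
  let ψ : D → (ι → ℝ) →ₗ[ℝ] ℝ := fun T => ∑ i, c T i • LinearMap.proj i
  have hψ : ∀ T h, ψ T h = ∑ i, c T i * h i := by
    intro T h; simp [ψ]
  have hsub : U ⊆ ⋃ T : D, (LinearMap.ker (ψ T) : Set (ι → ℝ)) := by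
    intro h hh
    have h1 := hcon h hh
    simp only [IsSimpleAt] at h1
    push Not at h1
    obtain ⟨x, hx, b, hb, hbu, hb0⟩ := h1
    rw [mem_iUnion]
    let T : D := ⟨{i | u i x = h i}, b, hb0, hb, hbu⟩
    refine ⟨T, ?_⟩
    rw [SetLike.mem_coe, LinearMap.mem_ker, hψ]
    have h2 : ∑ i, c T i * h i = ∑ i, c T i * u i x := by
      refine Finset.sum_congr rfl fun i _ => ?_
      by_cases hi : u i x = h i
      · rw [hi]
      · rw [hcT T i hi]; simp
    rw [h2]
    have := LinearMap.congr_fun (hcu T) x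
    simpa using this
  have hnull : volume (⋃ T : D, (LinearMap.ker (ψ T) : Set (ι → ℝ))) = 0 := by
    rw [measure_iUnion_null_iff]
    intro T
    apply Measure.addHaar_submodule
    intro htop
    apply hc0 T
    funext i
    have : (Pi.single i 1 : ι → ℝ) ∈ LinearMap.ker (ψ T) := htop ▸ Submodule.mem_top
    rw [LinearMap.mem_ker, hψ] at this
    simpa [Pi.single_apply] using this
  exact (hU.measure_pos volume hne).ne' (measure_mono_null hsub hnull)

end

section
set_option linter.unusedSectionVars false
open Set Filter Topology
variable {ι : Type*} [Fintype ι] [DecidableEq ι]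
variable {E : Type*} [NormedAddCommGroup E] [NormedSpace ℝ E]

/-- `k` gives the support numbers of the convex body `K`, and the normal fan of `K` is coarser than
those of the polyhedra with right-hand sides in `B`. -/
structure IsCompatible (u : ι → E →ₗ[ℝ] ℝ) (B : Set (ι → ℝ)) (K : Set E) (k : ι → ℝ) : Prop where
  isCompact : IsCompact K
  convex : Convex ℝ K
  nonempty : K.Nonempty
  subset : K ⊆ polyh u k
  face : ∀ h ∈ B, ∀ x ∈ polyh u h, ∃ y ∈ K, ∀ i, u i x = h i → u i y = k i

namespace IsCompatible
variable {u : ι → E →ₗ[ℝ] ℝ} {B : Set (ι → ℝ)} {K K' : Set E} {k k' : ι → ℝ}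

theorem zero : IsCompatible u B {0} 0 where
  isCompact := isCompact_singleton
  convex := convex_singleton 0
  nonempty := singleton_nonempty 0
  subset := by rintro _ rfl i; simp
  face _ _ _ _ := ⟨0, rfl, by simp⟩

theorem add (H : IsCompatible u B K k) (H' : IsCompatible u B K' k') :
    IsCompatible u B (K + K') (k + k') where
  isCompact := H.isCompact.add H'.isCompact
  convex := H.convex.add H'.convex
  nonempty := H.nonempty.add H'.nonempty
  subset := by
    rintro _ ⟨x, hx, y, hy, rfl⟩ i
    simp only [map_add, Pi.add_apply]
    exact add_le_add (H.subset hx i) (H'.subset hy i)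
  face h hh x hx := by
    obtain ⟨y, hy, hyi⟩ := H.face h hh x hx
    obtain ⟨y', hy', hyi'⟩ := H'.face h hh x hx
    refine ⟨y + y', Set.add_mem_add hy hy', fun i hi => ?_⟩
    rw [map_add, hyi i hi, hyi' i hi, Pi.add_apply]

theorem smul (H : IsCompatible u B K k) {t : ℝ} (ht : 0 ≤ t) :
    IsCompatible u B (t • K) (t • k) where
  isCompact := H.isCompact.smul t
  convex := H.convex.smul t
  nonempty := H.nonempty.smul_set
  subset := by
    rintro _ ⟨x, hx, rfl⟩ i
    simp only [map_smul, Pi.smul_apply, smul_eq_mul]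
    exact mul_le_mul_of_nonneg_left (H.subset hx i) ht
  face h hh x hx := by
    obtain ⟨y, hy, hyi⟩ := H.face h hh x hx
    refine ⟨t • y, smul_mem_smul_set hy, fun i hi => ?_⟩
    rw [map_smul, hyi i hi, Pi.smul_apply]

theorem sum {κ : Type*} (S : Finset κ) {Ks : κ → Set E} {ks : κ → ι → ℝ}
    (H : ∀ j, IsCompatible u B (Ks j) (ks j)) :
    IsCompatible u B (∑ j ∈ S, Ks j) (∑ j ∈ S, ks j) := by
  classical
  induction S using Finset.induction_on with
  | empty =>
    rw [Finset.sum_empty, Finset.sum_empty]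
    exact zero
  | insert j S hj ih =>
    rw [Finset.sum_insert hj, Finset.sum_insert hj]
    exact (H j).add ih

end IsCompatible

theorem add_smul_polyh_subset {u : ι → E →ₗ[ℝ] ℝ} {K : Set E} {k h : ι → ℝ} (hK : K ⊆ polyh u k)
    {s : ℝ} (hs : 0 ≤ s) : K + s • polyh u h ⊆ polyh u (k + s • h) := by
  rintro _ ⟨x, hx, _, ⟨y, hy, rfl⟩, rfl⟩ i
  simp only [map_add, map_smul, Pi.add_apply, Pi.smul_apply, smul_eq_mul]
  exact add_le_add (hK hx i) (mul_le_mul_of_nonneg_left (hy i) hs)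

variable [FiniteDimensional ℝ E]

theorem IsCompatible.polyh_add_smul {u : ι → E →ₗ[ℝ] ℝ} (hu : ∀ x, (∀ i, u i x ≤ 0) → x = 0)
    {B : Set (ι → ℝ)} {K : Set E} {k h : ι → ℝ} (H : IsCompatible u B K k) (hh : h ∈ B)
    (hsimple : IsSimpleAt u h) (hne : (polyh u h).Nonempty) {s : ℝ} (hs : 0 ≤ s) :
    polyh u (k + s • h) = K + s • polyh u h := by
  refine Subset.antisymm (fun x hx => ?_) (add_smul_polyh_subset H.subset hs)
  by_contra hx'
  have hcpt : IsCompact (K + s • polyh u h) := H.isCompact.add ((isCompact_polyh hu h).smul s)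
  obtain ⟨f, a, hfa, hfx⟩ := geometric_hahn_banach_closed_point
    (H.convex.add ((convex_polyh u h).smul s)) hcpt.isClosed hx'
  obtain ⟨y, hy, hmax⟩ := (isCompact_polyh hu h).exists_isMaxOn hne f.continuous.continuousOn
  obtain ⟨c, hc0, hct, hfc⟩ := exists_nonneg_sum_smul_of_isMax hsimple hy (f := f.toLinearMap)
    fun z hz => hmax hz
  obtain ⟨z, hz, hzi⟩ := H.face h hh y hy
  have h1 : ∀ v, f v = ∑ i, c i * u i v := by
    intro v
    have := LinearMap.congr_fun hfc v
    simpa using this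
  have h2 : f x ≤ f (z + s • y) := by
    rw [h1, h1]
    refine Finset.sum_le_sum fun i _ => ?_
    by_cases hi : u i y = h i
    · refine mul_le_mul_of_nonneg_left ?_ (hc0 i)
      have := hx i
      rw [map_add, map_smul, hzi i hi, hi]
      exact this
    · rw [hct i hi]; simp
  have h3 := hfa _ (add_mem_add hz (smul_mem_smul_set (a := s) hy))
  linarith

theorem IsCompatible.isSimpleAt_add_smul {u : ι → E →ₗ[ℝ] ℝ}
    (hu : ∀ x, (∀ i, u i x ≤ 0) → x = 0)
    {B : Set (ι → ℝ)} {K : Set E} {k h : ι → ℝ} (H : IsCompatible u B K k) (hh : h ∈ B)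
    (hsimple : IsSimpleAt u h) (hne : (polyh u h).Nonempty) {s : ℝ} (hs : 0 < s) :
    IsSimpleAt u (k + s • h) := by
  intro x hx c hc hcu
  rw [H.polyh_add_smul hu hh hsimple hne hs.le] at hx
  obtain ⟨y, hy, _, ⟨z, hz, rfl⟩, rfl⟩ := hx
  refine hsimple z hz c (fun i hi => hc i fun heq => hi ?_) hcu
  simp only [map_add, map_smul, Pi.add_apply, Pi.smul_apply, smul_eq_mul] at heq
  have h1 := H.subset hy i
  have h2 := hz i
  by_contra
  have h3 : u i z < h i := lt_of_le_of_ne h2 hi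
  have := mul_lt_mul_of_pos_left h3 hs
  linarith

variable [MeasurableSpace E] [BorelSpace E] (μ : Measure E) [μ.IsAddHaarMeasure]

theorem tendsto_measure_of_subset_cthickening {α : Type*} {l : Filter α} {K : Set E}
    (hK : IsCompact K) {A : α → Set E} {r : α → ℝ} (hr : Tendsto r l (𝓝 0))
    (hlow : ∀ᶠ a in l, μ K ≤ μ (A a)) (hup : ∀ᶠ a in l, A a ⊆ Metric.cthickening (r a) K) :
    Tendsto (fun a => (μ (A a)).toReal) l (𝓝 (μ K).toReal) := by
  refine (ENNReal.tendsto_toReal hK.measure_ne_top).comp ?_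
  refine tendsto_of_tendsto_of_tendsto_of_le_of_le' tendsto_const_nhds
    ((tendsto_measure_cthickening_of_isCompact hK).comp hr) hlow ?_
  filter_upwards [hup] with a ha
  exact measure_mono ha

theorem tendsto_measure_add_smul {K M : Set E} (hK : IsCompact K) (hM : IsCompact M)
    (hMne : M.Nonempty) :
    Tendsto (fun ε : ℝ => (μ (K + ε • M)).toReal) (𝓝[>] 0) (𝓝 (μ K).toReal) := by
  obtain ⟨R, hR⟩ := hM.isBounded.exists_norm_le
  have hR0 : 0 ≤ R := by
    obtain ⟨x, hx⟩ := hMne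
    exact (norm_nonneg x).trans (hR x hx)
  have ht : Tendsto (fun ε : ℝ => ε * R) (𝓝[>] 0) (𝓝 0) := by
    have : Continuous fun ε : ℝ => ε * R := by fun_prop
    simpa using (this.tendsto 0).mono_left (nhdsWithin_le_nhds (s := Ioi 0))
  refine tendsto_measure_of_subset_cthickening μ hK ht ?_ ?_
  · refine Eventually.of_forall fun ε => ?_
    obtain ⟨x, hx⟩ := hMne
    rw [← measure_vadd μ (ε • x) K]
    refine measure_mono ?_
    rintro _ ⟨y, hy, rfl⟩
    change ε • x + y ∈ _
    rw [add_comm (ε • x) y]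
    exact Set.add_mem_add hy (smul_mem_smul_set hx)
  · filter_upwards [self_mem_nhdsWithin] with ε hε
    have hε' : 0 < ε := hε
    rw [← hK.add_closedBall_zero (mul_nonneg hε'.le hR0)]
    refine add_subset_add_left ?_
    rintro _ ⟨x, hx, rfl⟩
    rw [mem_closedBall_zero_iff, norm_smul, Real.norm_eq_abs, abs_of_pos hε']
    exact mul_le_mul_of_nonneg_left (hR x hx) hε'.le

theorem exists_volumePolynomial_of_isCompatible {u : ι → E →ₗ[ℝ] ℝ}
    (hu : ∀ x, (∀ i, u i x ≤ 0) → x = 0) {B : Set (ι → ℝ)} (hB : IsOpen B) (hBc : Convex ℝ B)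
    (hBne : B.Nonempty) (hBs : ∀ h ∈ B, IsSimpleAt u h) (hBp : ∀ h ∈ B, (polyh u h).Nonempty) :
    ∃ (C : Set (ι → ℝ)) (p : MvPolynomial ι ℝ), IsVolumePolynomial p (Module.finrank ℝ E) C ∧
      (∀ K k, IsCompatible u B K k → (μ K).toReal = MvPolynomial.eval k p) ∧
      ∀ K k, IsCompatible u B K k → ∀ s : ℝ, 0 < s → ∀ h ∈ B, k + s • h ∈ C := by
  let C : Set (ι → ℝ) := {g | ∃ (K : Set E) (k : ι → ℝ) (s : ℝ) (h : ι → ℝ),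
    IsCompatible u B K k ∧ 0 < s ∧ h ∈ B ∧ g = k + s • h}
  have hmem : ∀ K k, IsCompatible u B K k → ∀ s : ℝ, 0 < s → ∀ h ∈ B, k + s • h ∈ C :=
    fun K k H s hs h hh => ⟨K, k, s, h, H, hs, hh, rfl⟩
  have hopen : IsOpen C := by
    rw [isOpen_iff_mem_nhds]
    rintro _ ⟨K, k, s, h, H, hs, hh, rfl⟩
    have h1 : IsOpen (k +ᵥ s • B) := (hB.smul₀ hs.ne').vadd k
    refine Filter.mem_of_superset (h1.mem_nhds ⟨s • h, smul_mem_smul_set hh, rfl⟩) ?_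
    rintro _ ⟨_, ⟨h', hh', rfl⟩, rfl⟩
    exact hmem K k H s hs h' hh'
  have hcone : ∀ g ∈ C, ∀ t : ℝ, 0 < t → t • g ∈ C := by
    rintro _ ⟨K, k, s, h, H, hs, hh, rfl⟩ t ht
    rw [smul_add, smul_smul]
    exact hmem _ _ (H.smul ht.le) _ (mul_pos ht hs) h hh
  have hadd : ∀ g ∈ C, ∀ g' ∈ C, g + g' ∈ C := by
    rintro _ ⟨K, k, s, h, H, hs, hh, rfl⟩ _ ⟨K', k', s', h', H', hs', hh', rfl⟩
    have h1 : k + s • h + (k' + s' • h') =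
        (k + k') + (s + s') • ((s / (s + s')) • h + (s' / (s + s')) • h') := by
      have : s + s' ≠ 0 := (add_pos hs hs').ne'
      rw [smul_add, smul_smul, smul_smul, mul_div_cancel₀ _ this, mul_div_cancel₀ _ this]
      abel
    rw [h1]
    refine hmem _ _ (H.add H') _ (add_pos hs hs') _ (hBc hh hh' (by positivity) (by positivity) ?_)
    field_simp
  have hconv : Convex ℝ C := by
    intro g hg g' hg' a b ha hb hab
    rcases ha.eq_or_lt with rfl | ha
    · have : b = 1 := by linarith
      subst this; simpa using hg'
    rcases hb.eq_or_lt with rfl | hb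
    · have : a = 1 := by linarith
      subst this; simpa using hg
    exact hadd _ (hcone g hg a ha) _ (hcone g' hg' b hb)
  obtain ⟨h₀, hh₀⟩ := hBne
  obtain ⟨p, hp, hpe⟩ := exists_isVolumePolynomial μ hu hopen hconv
    ⟨_, hmem _ _ IsCompatible.zero 1 one_pos h₀ hh₀⟩ hcone (by
      rintro _ ⟨K, k, s, h, H, hs, hh, rfl⟩
      exact H.isSimpleAt_add_smul hu hh (hBs h hh) (hBp h hh) hs)
  refine ⟨C, p, hp, fun K k H => ?_, hmem⟩
  have t1 := tendsto_measure_add_smul μ H.isCompact (isCompact_polyh hu h₀) (hBp h₀ hh₀)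
  have t2 : Tendsto (fun ε : ℝ => MvPolynomial.eval (k + ε • h₀) p) (𝓝[>] 0)
      (𝓝 (MvPolynomial.eval k p)) := by
    have h1 : Continuous fun ε : ℝ => MvPolynomial.eval (k + ε • h₀) p :=
      (MvPolynomial.continuous_eval p).comp (by fun_prop)
    simpa using (h1.tendsto 0).mono_left (nhdsWithin_le_nhds (s := Ioi 0))
  refine tendsto_nhds_unique t1 (t2.congr' ?_)
  filter_upwards [self_mem_nhdsWithin] with ε hε
  have hε' : 0 < ε := hε
  rw [← hpe _ (hmem K k H ε hε' h₀ hh₀),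
    H.polyh_add_smul hu hh₀ (hBs h₀ hh₀) (hBp h₀ hh₀) hε'.le]

end

section
set_option linter.unusedSectionVars false
open Set Filter Topology
variable {ι : Type*} [Fintype ι] [DecidableEq ι]

theorem sum_powerset_eq_diffD {κ : Type*} [DecidableEq κ] {l : List κ} (hl : l.Nodup)
    (r : κ → ι → ℝ) (F : (ι → ℝ) → ℝ) (x : ι → ℝ) :
    ∑ S ∈ l.toFinset.powerset, (-1 : ℝ) ^ (l.length - S.card) * F (x + ∑ j ∈ S, r j) =
      diffD (l.map r) F x := by
  induction l generalizing x with
  | nil => simp [diffD]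
  | cons a l ih =>
    have ha : a ∉ l.toFinset := by simpa using (List.nodup_cons.mp hl).1
    have hl' := (List.nodup_cons.mp hl).2
    rw [List.toFinset_cons, Finset.sum_powerset_insert ha, List.map_cons, diffD, ← ih hl',
      ← ih hl', sub_eq_add_neg, add_comm, ← Finset.sum_neg_distrib]
    have hle : ∀ S ∈ l.toFinset.powerset, S.card ≤ l.length := fun S hS =>
      (Finset.card_le_card (Finset.mem_powerset.mp hS)).trans (List.toFinset_card_le l)
    congr 1
    · refine Finset.sum_congr rfl fun S hS => ?_
      have haS : a ∉ S := fun h => ha (Finset.mem_powerset.mp hS h)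
      rw [Finset.card_insert_of_notMem haS, Finset.sum_insert haS, List.length_cons,
        Nat.add_sub_add_right, add_assoc]
    · refine Finset.sum_congr rfl fun S hS => ?_
      rw [List.length_cons, Nat.sub_add_comm (hle S hS), pow_succ]
      ring

theorem diffD_eval_eq_of_isHomogeneous {p : MvPolynomial ι ℝ} (ys : List (ι → ℝ))
    (hp : p.IsHomogeneous ys.length) (x : ι → ℝ) :
    diffD ys (fun z => MvPolynomial.eval z p) x = MvPolynomial.eval 0 (iterD ys p) := by
  obtain ⟨ξ, -, hξ⟩ := exists_diffD_eval_eq ys p x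
  have h1 : (iterD ys p).IsHomogeneous 0 := IsHomogeneous.iterD ys (by simpa using hp)
  have h2 := MvPolynomial.totalDegree_eq_zero_iff_eq_C.mp (Nat.le_zero.mp h1.totalDegree_le)
  rw [hξ, h2]
  simp

theorem continuous_eval_iterD_add_smul (l : List ((ι → ℝ) × (ι → ℝ))) (q : MvPolynomial ι ℝ)
    (x : ι → ℝ) :
    Continuous fun ε : ℝ => MvPolynomial.eval x (iterD (l.map fun y => y.1 + ε • y.2) q) := by
  induction l generalizing q with
  | nil =>
    change Continuous fun _ : ℝ => MvPolynomial.eval x q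
    exact continuous_const
  | cons y l ih =>
    have h : (fun ε : ℝ => MvPolynomial.eval x
        (iterD ((y :: l).map fun y => y.1 + ε • y.2) q)) =
        fun ε : ℝ => MvPolynomial.eval x (iterD (l.map fun y => y.1 + ε • y.2) (dirD y.1 q)) +
          ε * MvPolynomial.eval x (iterD (l.map fun y => y.1 + ε • y.2) (dirD y.2 q)) := by
      funext ε
      rw [List.map_cons, iterD_cons, ← iterD_dirD, dirD_add, dirD_smul, iterD_add, iterD_smul,
        map_add, MvPolynomial.smul_eval]
    rw [h]
    exact (ih _).add (continuous_id.mul (ih _))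

theorem mixedVolume_eq_eval_iterD {d : ℕ} {u : ι → EuclideanSpace ℝ (Fin d) →ₗ[ℝ] ℝ}
    {B : Set (ι → ℝ)} {p : MvPolynomial ι ℝ} (hp : p.IsHomogeneous d)
    (hvol : ∀ K k, IsCompatible u B K k → (volume K).toReal = MvPolynomial.eval k p)
    {R : Fin d → Set (EuclideanSpace ℝ (Fin d))} {r : Fin d → ι → ℝ}
    (H : ∀ i, IsCompatible u B (R i) (r i)) :
    mixedVolume R = MvPolynomial.eval 0 (iterD (List.ofFn r) p) := by
  rw [← diffD_eval_eq_of_isHomogeneous _ (by simpa using hp) 0, List.ofFn_eq_map,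
    ← sum_powerset_eq_diffD (List.nodup_finRange d), mixedVolume, List.toFinset_finRange,
    Finset.powerset_univ]
  refine Finset.sum_congr rfl fun S _ => ?_
  rw [hvol _ _ (IsCompatible.sum S H), List.length_finRange, zero_add]

theorem IsVolumePolynomial.mul_le_sq {p : MvPolynomial ι ℝ} {d : ℕ} {C : Set (ι → ℝ)}
    (H : IsVolumePolynomial p d C) (ws : List (ι → ℝ)) (hws : ∀ w ∈ ws, w ∈ C)
    (hlen : ws.length + 2 = d) {w : ι → ℝ} (hw : w ∈ C) (y : ι → ℝ) :
    derivForm (iterD ws p) y y * derivForm (iterD ws p) w w ≤ derivForm (iterD ws p) y w ^ 2 := by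
  by_cases hp : p = 0
  · simp [hp, iterD_zero, derivForm_apply]
  refine reverse_cauchy_schwarz _ (derivForm_symm _) w (fun y hy => ?_) w ?_ y
  · exact H.form_nonpos (l := []) ws hws List.nodup_nil (by simpa using hlen) hp hw y hy
  · exact H.eval_zero_pos (l := []) (w :: w :: ws) (by simpa [hw] using hws) List.nodup_nil
      (by simp; omega) hp ⟨w, hw⟩

theorem IsVolumePolynomial.eval_zero_nonneg {p : MvPolynomial ι ℝ} {d : ℕ} {C : Set (ι → ℝ)}
    (H : IsVolumePolynomial p d C) (ws : List (ι → ℝ)) (hws : ∀ w ∈ ws, w ∈ C)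
    (hlen : ws.length = d) (hC : C.Nonempty) :
    0 ≤ MvPolynomial.eval 0 (iterD ws p) := by
  by_cases hp : p = 0
  · simp [hp, iterD_zero]
  exact (H.eval_zero_pos (l := []) ws hws List.nodup_nil (by simpa using hlen) hp hC).le

theorem alexandrovFenchel_of_isCompatible {m n : ℕ}
    {u : ι → EuclideanSpace ℝ (Fin (m + 2)) →ₗ[ℝ] ℝ}
    (hu : ∀ x, (∀ i, u i x ≤ 0) → x = 0) {B : Set (ι → ℝ)} (hB : IsOpen B) (hBc : Convex ℝ B)
    (hBne : B.Nonempty) (hBs : ∀ h ∈ B, IsSimpleAt u h) (hBp : ∀ h ∈ B, (polyh u h).Nonempty)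
    {P : Fin m → Set (EuclideanSpace ℝ (Fin (m + 2)))} {q : Fin m → ι → ℝ}
    (hP : ∀ i, IsCompatible u B (P i) (q i))
    {K : Fin n → Set (EuclideanSpace ℝ (Fin (m + 2)))} {k : Fin n → ι → ℝ}
    (hK : ∀ i, IsCompatible u B (K i) (k i)) :
    (∀ a b, 0 ≤ mixedVolume (Fin.cons (K a) (Fin.cons (K b) P))) ∧
    ∀ x : Fin n → ℝ,
      (∑ a, ∑ b, x a * x b * mixedVolume (Fin.cons (K a) (Fin.cons (K b) P))) *
        (∑ a, ∑ b, mixedVolume (Fin.cons (K a) (Fin.cons (K b) P))) ≤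
      (∑ a, ∑ b, x a * mixedVolume (Fin.cons (K a) (Fin.cons (K b) P))) ^ 2 := by
  obtain ⟨C, p, hp, hvol, hC⟩ := exists_volumePolynomial_of_isCompatible volume hu hB hBc hBne hBs hBp
  rw [finrank_euclideanSpace_fin] at hp
  obtain ⟨h₀, hh₀⟩ := hBne
  have hCne : C.Nonempty := ⟨_, hC _ _ IsCompatible.zero 1 one_pos h₀ hh₀⟩
  have hA : ∀ a b, mixedVolume (Fin.cons (K a) (Fin.cons (K b) P)) =
      MvPolynomial.eval 0 (iterD (k a :: k b :: List.ofFn q) p) := by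
    intro a b
    rw [mixedVolume_eq_eval_iterD hp.homogeneous hvol
      (r := Fin.cons (k a) (Fin.cons (k b) q))]
    · simp [List.ofFn_succ]
    · intro i
      refine Fin.cases (hK a) (fun i => ?_) i
      exact Fin.cases (hK b) hP i
  have hcont : ∀ y z y' z' : ι → ℝ, Tendsto (fun ε : ℝ => MvPolynomial.eval 0 (iterD
      ((y + ε • z) :: (y' + ε • z') :: List.ofFn fun i => q i + ε • h₀) p)) (𝓝[>] 0)
      (𝓝 (MvPolynomial.eval 0 (iterD (y :: y' :: List.ofFn q) p))) := by
    intro y z y' z'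
    have h := continuous_eval_iterD_add_smul
      ((y, z) :: (y', z') :: List.ofFn fun i => (q i, h₀)) p 0
    have h2 := (h.tendsto 0).mono_left (nhdsWithin_le_nhds (s := Ioi 0))
    simpa [Function.comp_def] using h2
  have hws : ∀ ε : ℝ, 0 < ε → ∀ w ∈ List.ofFn fun i => q i + ε • h₀, w ∈ C := by
    intro ε hε w hw
    obtain ⟨i, rfl⟩ := (List.mem_ofFn' _ _).mp hw
    exact hC _ _ (hP i) ε hε h₀ hh₀
  refine ⟨fun a b => ?_, fun x => ?_⟩
  · rw [hA]
    refine ge_of_tendsto (hcont (k a) h₀ (k b) h₀) ?_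
    filter_upwards [self_mem_nhdsWithin] with ε hε
    refine hp.eval_zero_nonneg _ (fun w hw => ?_) (by simp) hCne
    rcases List.mem_cons.mp hw with rfl | hw
    · exact hC _ _ (hK a) ε hε h₀ hh₀
    rcases List.mem_cons.mp hw with rfl | hw
    · exact hC _ _ (hK b) ε hε h₀ hh₀
    exact hws ε hε w hw
  · have hsum : ∀ x y : Fin n → ℝ,
        ∑ a, ∑ b, x a * y b * mixedVolume (Fin.cons (K a) (Fin.cons (K b) P)) =
        MvPolynomial.eval 0 (iterD ((∑ a, x a • k a) :: (∑ b, y b • k b) :: List.ofFn q) p) := by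
      intro x y
      change _ = derivForm (iterD (List.ofFn q) p) _ _
      simp only [map_sum, map_smul, LinearMap.sum_apply, LinearMap.smul_apply, smul_eq_mul,
        Finset.mul_sum]
      rw [Finset.sum_comm]
      refine Finset.sum_congr rfl fun b _ => Finset.sum_congr rfl fun a _ => ?_
      rw [hA, derivForm_apply, iterD_cons, iterD_cons]
      ring
    have h1 := hsum x x
    have h2 := hsum (fun _ => 1) (fun _ => 1)
    have h3 := hsum x (fun _ => 1)
    simp only [one_mul, mul_one, one_smul] at h1 h2 h3
    rw [h1, h2, h3]
    refine le_of_tendsto_of_tendsto ((hcont _ 0 _ 0).mul (hcont _ h₀ _ h₀))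
      ((hcont _ 0 _ h₀).pow 2) ?_
    filter_upwards [self_mem_nhdsWithin] with ε hε
    have hw : ∑ a, k a + ε • h₀ ∈ C := hC _ _ (IsCompatible.sum Finset.univ hK) ε hε h₀ hh₀
    simp only [smul_zero, add_zero]
    exact hp.mul_le_sq _ (hws ε hε) (by simp) hw _

end

section
set_option linter.unusedSectionVars false
open Set Filter Topology

theorem exists_forall_le_forall_ge (A B : Finset ℝ) (h : ∀ x ∈ A, ∀ y ∈ B, x ≤ y) :
    ∃ t, (∀ x ∈ A, x ≤ t) ∧ ∀ y ∈ B, t ≤ y := by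
  rcases A.eq_empty_or_nonempty with rfl | hA
  · rcases B.eq_empty_or_nonempty with rfl | hB
    · exact ⟨0, by simp, by simp⟩
    · exact ⟨B.min' hB, by simp, fun y hy => B.min'_le y hy⟩
  · exact ⟨A.max' hA, fun x hx => A.le_max' x hx, fun y hy => A.max'_le hA y fun x hx => h x hx y hy⟩

/-- Fourier–Motzkin elimination of one real variable. -/
theorem exists_forall_mul_le_iff {I : Type*} (T : Finset I) (a c : I → ℝ) :
    (∃ t, ∀ i ∈ T, t * a i ≤ c i) ↔ (∀ i ∈ T, a i = 0 → 0 ≤ c i) ∧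
      ∀ i ∈ T, ∀ j ∈ T, 0 < a i → a j < 0 → a j * c i ≤ a i * c j := by
  classical
  constructor
  · rintro ⟨t, ht⟩
    refine ⟨fun i hi hai => by simpa [hai] using ht i hi, fun i hi j hj hai haj => ?_⟩
    nlinarith [mul_le_mul_of_nonneg_left (ht j hj) hai.le,
      mul_le_mul_of_nonneg_left (ht i hi) (neg_nonneg.mpr haj.le)]
  · rintro ⟨h0, h1⟩
    obtain ⟨t, hlow, hup⟩ := exists_forall_le_forall_ge
      ((T.filter fun i => a i < 0).image fun i => c i / a i)
      ((T.filter fun i => 0 < a i).image fun i => c i / a i) (by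
        simp only [Finset.mem_image, Finset.mem_filter]
        rintro _ ⟨j, ⟨hj, haj⟩, rfl⟩ _ ⟨i, ⟨hi, hai⟩, rfl⟩
        rw [le_div_iff₀ hai, div_mul_eq_mul_div, div_le_iff_of_neg haj]
        linarith [h1 i hi j hj hai haj])
    refine ⟨t, fun i hi => ?_⟩
    rcases lt_trichotomy (a i) 0 with h | h | h
    · exact (div_le_iff_of_neg h).mp
        (hlow _ (Finset.mem_image_of_mem _ (Finset.mem_filter.mpr ⟨hi, h⟩)))
    · simpa [h] using h0 i hi h
    · exact (le_div_iff₀ h).mp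
        (hup _ (Finset.mem_image_of_mem _ (Finset.mem_filter.mpr ⟨hi, h⟩)))

theorem exists_finset_projection {E : Type*} [AddCommGroup E] [Module ℝ E]
    (T : Finset ((E →ₗ[ℝ] ℝ) × ℝ × ℝ)) :
    ∃ s : Finset ((E →ₗ[ℝ] ℝ) × ℝ), ∀ x,
      (∃ t : ℝ, ∀ q ∈ T, q.1 x + t * q.2.1 ≤ q.2.2) ↔ ∀ p ∈ s, p.1 x ≤ p.2 := by
  classical
  refine ⟨(T.filter fun q => q.2.1 = 0).image (fun q => (q.1, q.2.2)) ∪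
    ((T ×ˢ T).filter fun q => 0 < q.1.2.1 ∧ q.2.2.1 < 0).image (fun q =>
      (q.1.2.1 • q.2.1 - q.2.2.1 • q.1.1, q.1.2.1 * q.2.2.2 - q.2.2.1 * q.1.2.2)), fun x => ?_⟩
  have h := exists_forall_mul_le_iff T (fun q => q.2.1) (fun q => q.2.2 - q.1 x)
  simp only [le_sub_iff_add_le, zero_add] at h
  simp only [add_comm (_ : ℝ) (_ * _), h, Finset.forall_mem_union, Finset.forall_mem_image,
    Finset.mem_filter, Finset.mem_product]
  refine and_congr ⟨fun h q hq => h q hq.1 hq.2, fun h q hq h0 => h ⟨hq, h0⟩⟩ ⟨?_, ?_⟩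
  · rintro h ⟨q, r⟩ ⟨⟨hq, hr⟩, h1, h2⟩
    have := h q hq r hr h1 h2
    simp only [LinearMap.sub_apply, LinearMap.smul_apply, smul_eq_mul]
    linarith
  · intro h q hq r hr h1 h2
    have := h (x := (q, r)) ⟨⟨hq, hr⟩, h1, h2⟩
    simp only [LinearMap.sub_apply, LinearMap.smul_apply, smul_eq_mul] at this
    linarith

variable {E : Type*} [NormedAddCommGroup E] [NormedSpace ℝ E]

theorem eq_zero_of_forall_nonpos_of_isBounded {s : Finset ((E →ₗ[ℝ] ℝ) × ℝ)} {L : Set E}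
    (hL : Bornology.IsBounded L) (hne : L.Nonempty)
    (hs : ∀ x, x ∈ L ↔ ∀ p ∈ s, p.1 x ≤ p.2) {y : E} (hy : ∀ p ∈ s, p.1 y ≤ 0) : y = 0 := by
  obtain ⟨R, hR⟩ := hL.exists_norm_le
  obtain ⟨x, hx⟩ := hne
  by_contra hy0
  have hpos : 0 < ‖y‖ := norm_pos_iff.mpr hy0
  have hRx := hR x hx
  have hR0 := (norm_nonneg x).trans hRx
  have hr0 : 0 ≤ (2 * R + 1) / ‖y‖ := by positivity
  have hmem : x + ((2 * R + 1) / ‖y‖) • y ∈ L := by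
    rw [hs]
    intro p hp
    rw [map_add, map_smul, smul_eq_mul]
    have := (hs x).mp hx p hp
    nlinarith [mul_nonneg hr0 (neg_nonneg.mpr (hy p hp))]
  have h1 := hR _ hmem
  have h2 : ‖((2 * R + 1) / ‖y‖) • y‖ = 2 * R + 1 := by
    rw [norm_smul, Real.norm_eq_abs, abs_of_nonneg hr0, div_mul_cancel₀ _ hpos.ne']
  have h3 := norm_sub_norm_le (((2 * R + 1) / ‖y‖) • y) (-x)
  rw [sub_neg_eq_add, add_comm _ x, norm_neg, h2] at h3
  linarith

variable [FiniteDimensional ℝ E]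

/-- The convex hull of a finite set is an intersection of finitely many half-spaces. -/
theorem exists_finset_mem_convexHull_iff (V : Finset E) (hV : V.Nonempty) :
    ∃ s : Finset ((E →ₗ[ℝ] ℝ) × ℝ), ∀ x,
      x ∈ convexHull ℝ (V : Set E) ↔ ∀ p ∈ s, p.1 x ≤ p.2 := by
  classical
  induction hV using Finset.Nonempty.cons_induction with
  | singleton v =>
    let b := Module.finBasis ℝ E
    refine ⟨(Finset.univ.image fun i => (b.coord i, b.coord i v)) ∪
      Finset.univ.image fun i => (-b.coord i, -b.coord i v), fun x => ?_⟩
    simp only [Finset.coe_singleton, convexHull_singleton, mem_singleton_iff,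
      Finset.forall_mem_union, Finset.forall_mem_image, Finset.mem_univ, true_imp_iff,
      LinearMap.neg_apply, neg_le_neg_iff]
    refine ⟨by rintro rfl; simp, fun ⟨h, h'⟩ => b.ext_elem fun i => le_antisymm (@h i) (@h' i)⟩
  | cons v V hv hV ih =>
    obtain ⟨s, hs⟩ := ih
    obtain ⟨s', hs'⟩ := exists_finset_projection
      (insert (0, -1, 0) (insert (0, 1, 1) (s.image fun p => (p.1, p.2 - p.1 v, p.2))))
    refine ⟨s', fun x => ?_⟩
    rw [← hs', Finset.coe_cons, convexHull_insert hV.to_set, mem_convexJoin]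
    simp only [Finset.forall_mem_insert, Finset.forall_mem_image, mem_singleton_iff,
      exists_eq_left, LinearMap.zero_apply, zero_add, mul_neg, mul_one, neg_nonpos]
    constructor
    · rintro ⟨y, hy, a, b, ha, hb, hab, rfl⟩
      refine ⟨a, ha, by linarith, fun p hp => ?_⟩
      have h1 := (hs y).mp hy p hp
      rw [map_add, map_smul, map_smul, smul_eq_mul, smul_eq_mul]
      obtain rfl : b = 1 - a := by linarith
      nlinarith [mul_le_mul_of_nonneg_left h1 hb]
    · rintro ⟨t, ht0, ht1, ht⟩
      rcases ht1.eq_or_lt with rfl | ht1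
      · have hxv : x - v = 0 := by
          refine eq_zero_of_forall_nonpos_of_isBounded
            (V.finite_toSet.isCompact_convexHull ℝ).isBounded
            (hV.to_set.convexHull) hs fun p hp => ?_
          have := ht hp
          rw [map_sub]
          linarith
        obtain rfl : x = v := sub_eq_zero.mp hxv
        obtain ⟨y, hy⟩ := hV
        exact ⟨y, subset_convexHull _ _ hy, left_mem_segment _ _ _⟩
      · have h1 : 0 < 1 - t := by linarith
        refine ⟨(1 - t)⁻¹ • (x - t • v), (hs _).mpr fun p hp => ?_, t, 1 - t, ht0, h1.le,
          by ring, ?_⟩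
        · have := ht hp
          rw [map_smul, map_sub, map_smul, smul_eq_mul, smul_eq_mul, inv_mul_le_iff₀ h1]
          linarith
        · rw [smul_inv_smul₀ h1.ne']; abel

/-- The convex hulls of finitely many finite sets are compatible with an open convex set of simple
polytopes. -/
theorem exists_isCompatible_convexHull {J : Type*} [Fintype J] (V : J → Finset E)
    (hV : ∀ j, (V j).Nonempty) :
    ∃ (s : Finset ((E →ₗ[ℝ] ℝ) × ℝ)) (u : s → E →ₗ[ℝ] ℝ) (B : Set (s → ℝ)) (k : J → s → ℝ),
      (∀ x, (∀ i, u i x ≤ 0) → x = 0) ∧ IsOpen B ∧ Convex ℝ B ∧ B.Nonempty ∧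
      (∀ h ∈ B, IsSimpleAt u h) ∧ (∀ h ∈ B, (polyh u h).Nonempty) ∧
      ∀ j, IsCompatible u B (convexHull ℝ (V j : Set E)) (k j) := by
  classical
  let L : J → Set E := fun j => convexHull ℝ (V j : Set E)
  have hLc : ∀ j, IsCompact (L j) := fun j => (V j).finite_toSet.isCompact_convexHull ℝ
  have hLne : ∀ j, (L j).Nonempty := fun j => (hV j).to_set.convexHull
  have hsum : ∑ j, L j = convexHull ℝ ((∑ j, V j : Finset E) : Set E) := by
    rw [Finset.coe_sum, convexHull_sum]
  have hWne : (∑ j, V j : Finset E).Nonempty := by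
    rw [← Finset.coe_nonempty, ← convexHull_nonempty_iff (𝕜 := ℝ), ← hsum]
    choose y hy using hLne
    exact ⟨∑ j, y j, (Set.mem_fintype_sum _ _).mpr ⟨y, hy, rfl⟩⟩
  obtain ⟨s, hs⟩ := exists_finset_mem_convexHull_iff _ hWne
  let u : s → E →ₗ[ℝ] ℝ := fun i => i.1.1
  have hu : ∀ x, (∀ i, u i x ≤ 0) → x = 0 := fun x hx =>
    eq_zero_of_forall_nonpos_of_isBounded
      ((Finset.finite_toSet _).isCompact_convexHull ℝ).isBounded hWne.to_set.convexHull hs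
      fun p hp => hx ⟨p, hp⟩
  have hmax : ∀ j i, ∃ y ∈ L j, ∀ z ∈ L j, u i z ≤ u i y := fun j i =>
    (hLc j).exists_isMaxOn (hLne j)
      (LinearMap.continuous_of_finiteDimensional (u i)).continuousOn
  choose y hyL hymax using hmax
  let k : J → s → ℝ := fun j i => u i (y j i)
  let g : s → ℝ := fun i => ∑ j, k j i
  have hg : ∀ x, x ∈ polyh u g ↔ x ∈ ∑ j, L j := by
    intro x
    constructor
    · intro hx
      rw [hsum, hs]
      intro p hp
      have h1 : ∑ j, y j ⟨p, hp⟩ ∈ ∑ j, L j :=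
        (Set.mem_fintype_sum _ _).mpr ⟨_, fun j => hyL j _, rfl⟩
      rw [hsum, hs] at h1
      refine (hx ⟨p, hp⟩).trans (le_trans (le_of_eq ?_) (h1 p hp))
      rw [map_sum]
    · intro hx i
      obtain ⟨z, hz, rfl⟩ := (Set.mem_fintype_sum _ _).mp hx
      rw [map_sum]
      exact Finset.sum_le_sum fun j _ => hymax j i _ (hz j)
  have hnhds : ∀ᶠ h in 𝓝 g, ∀ T : Set s, (∃ x ∈ polyh u h, ∀ i ∈ T, u i x = h i) →
      ∃ x ∈ polyh u g, ∀ i ∈ T, u i x = g i := by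
    rw [eventually_all]
    intro T
    by_cases hT : ∃ x ∈ polyh u g, ∀ i ∈ T, u i x = g i
    · exact Eventually.of_forall fun _ _ => hT
    · filter_upwards [(isClosed_face_nonempty hu T).isOpen_compl.mem_nhds hT] with h hh hh'
      exact absurd hh' hh
  obtain ⟨η, hη, hball⟩ := Metric.eventually_nhds_iff_ball.mp hnhds
  let U : Set (s → ℝ) := Metric.ball g η ∩ ⋂ i, {h | g i < h i}
  have hU : IsOpen U := Metric.isOpen_ball.inter
    (isOpen_iInter_of_finite fun i => isOpen_lt continuous_const (continuous_apply i))
  have hUne : U.Nonempty := by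
    refine ⟨g + fun _ => η / 2, ?_, mem_iInter.mpr fun i => ?_⟩
    · rw [Metric.mem_ball, dist_eq_norm, add_sub_cancel_left]
      refine ((pi_norm_const_le (η / 2)).trans_eq ?_).trans_lt (half_lt_self hη)
      rw [Real.norm_eq_abs, abs_of_pos (half_pos hη)]
    · change g i < g i + η / 2
      linarith
  obtain ⟨h₀, hh₀, hs₀⟩ := exists_isSimpleAt_mem u hU hUne
  obtain ⟨δ, hδ, hBU⟩ := Metric.isOpen_iff.mp (hU.inter (isOpen_isSimpleAt hu)) h₀ ⟨hh₀, hs₀⟩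
  refine ⟨s, u, Metric.ball h₀ δ, k, hu, Metric.isOpen_ball, convex_ball _ _,
    ⟨h₀, Metric.mem_ball_self hδ⟩, fun h hh => (hBU hh).2, fun h hh => ?_, fun j => ?_⟩
  · obtain ⟨x, hx⟩ := hWne.to_set.convexHull (𝕜 := ℝ)
    rw [← hsum, ← hg] at hx
    exact ⟨x, fun i => (hx i).trans (mem_iInter.mp (hBU hh).1.2 i).le⟩
  · refine ⟨hLc j, convex_convexHull _ _, hLne j, fun x hx i => hymax j i x hx,
      fun h hh x hx => ?_⟩
    obtain ⟨x', hx', hx't⟩ := hball h (hBU hh).1.1 {i | u i x = h i} ⟨x, hx, fun i hi => hi⟩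
    obtain ⟨z, hz, rfl⟩ := (Set.mem_fintype_sum _ _).mp ((hg x').mp hx')
    refine ⟨z j, hz j, fun i hi => ?_⟩
    have h1 := hx't i hi
    rw [map_sum] at h1
    exact (Finset.sum_eq_sum_iff_of_le fun j _ => hymax j i _ (hz j)).mp h1 j (Finset.mem_univ j)

end

section
set_option linter.unusedSectionVars false
open Set Filter Topology

variable {E : Type*} [NormedAddCommGroup E] [NormedSpace ℝ E]

theorem isCompact_sum_of_isCompact {κ : Type*} (S : Finset κ) {R : κ → Set E}
    (hR : ∀ i, IsCompact (R i)) : IsCompact (∑ i ∈ S, R i) := by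
  classical
  induction S using Finset.induction_on with
  | empty => rw [Finset.sum_empty]; exact isCompact_singleton
  | insert j S hj ih => rw [Finset.sum_insert hj]; exact (hR j).add ih

theorem sum_closedBall_zero_subset {κ : Type*} (S : Finset κ) (r : ℝ) :
    ∑ _i ∈ S, Metric.closedBall (0 : E) r ⊆ Metric.closedBall 0 (S.card * r) := by
  intro x hx
  obtain ⟨g, hg, rfl⟩ := (Set.mem_finsetSum _ _ _).mp hx
  rw [mem_closedBall_zero_iff, ← nsmul_eq_mul]
  exact norm_sum_le_of_le _ (fun i hi => by simpa using hg hi) |>.trans (by simp)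

theorem tendsto_mixedVolume {d : ℕ} {α : Type*} {l : Filter α}
    {R : Fin d → Set (EuclideanSpace ℝ (Fin d))} (hR : ∀ i, IsCompact (R i))
    {A : α → Fin d → Set (EuclideanSpace ℝ (Fin d))} {ε : α → ℝ} (hε : Tendsto ε l (𝓝 0))
    (hε0 : ∀ a, 0 ≤ ε a) (hlow : ∀ a i, R i ⊆ A a i)
    (hup : ∀ a i, A a i ⊆ Metric.cthickening (ε a) (R i)) :
    Tendsto (fun a => mixedVolume (A a)) l (𝓝 (mixedVolume R)) := by
  refine tendsto_finsetSum _ fun S _ => Tendsto.const_mul _ ?_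
  have hc := isCompact_sum_of_isCompact S hR
  refine tendsto_measure_of_subset_cthickening volume hc (r := fun a => S.card * ε a)
    (by simpa using hε.const_mul (S.card : ℝ)) ?_ ?_
  · exact Eventually.of_forall fun a =>
      measure_mono (Set.finsetSum_subset_finsetSum _ _ _ fun i _ => hlow a i)
  · refine Eventually.of_forall fun a => ?_
    rw [← hc.add_closedBall_zero (mul_nonneg (Nat.cast_nonneg _) (hε0 a))]
    refine Subset.trans ?_ (add_subset_add_left (sum_closedBall_zero_subset S (ε a)))
    rw [← Finset.sum_add_distrib]
    refine Set.finsetSum_subset_finsetSum _ _ _ fun i _ => ?_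
    rw [(hR i).add_closedBall_zero (hε0 a)]
    exact hup a i

theorem exists_finset_convexHull_subset_cthickening [FiniteDimensional ℝ E] {K : Set E}
    (hne : K.Nonempty) (hK : IsCompact K) (hconv : Convex ℝ K) {δ : ℝ} (hδ : 0 < δ) :
    ∃ V : Finset E, V.Nonempty ∧ K ⊆ convexHull ℝ (V : Set E) ∧
      convexHull ℝ (V : Set E) ⊆ Metric.cthickening δ K := by
  obtain ⟨V, h1, h2⟩ := hconv.exists_subset_interior_convexHull_finset_of_isCompact hK
    (Metric.cthickening_mem_nhdsSet K hδ)
  have h3 := h1.trans interior_subset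
  refine ⟨V, ?_, h3, h2⟩
  rw [← Finset.coe_nonempty, ← convexHull_nonempty_iff (𝕜 := ℝ)]
  exact hne.mono h3

theorem alexandrovFenchel {m n : ℕ}
    {P : Fin m → Set (EuclideanSpace ℝ (Fin (m + 2)))}
    (hPne : ∀ i, (P i).Nonempty) (hPcpt : ∀ i, IsCompact (P i)) (hPconv : ∀ i, Convex ℝ (P i))
    {K : Fin n → Set (EuclideanSpace ℝ (Fin (m + 2)))}
    (hKne : ∀ i, (K i).Nonempty) (hKcpt : ∀ i, IsCompact (K i)) (hKconv : ∀ i, Convex ℝ (K i)) :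
    (∀ a b, 0 ≤ mixedVolume (Fin.cons (K a) (Fin.cons (K b) P))) ∧
    ∀ x : Fin n → ℝ,
      (∑ a, ∑ b, x a * x b * mixedVolume (Fin.cons (K a) (Fin.cons (K b) P))) *
        (∑ a, ∑ b, mixedVolume (Fin.cons (K a) (Fin.cons (K b) P))) ≤
      (∑ a, ∑ b, x a * mixedVolume (Fin.cons (K a) (Fin.cons (K b) P))) ^ 2 := by
  have hδ : ∀ N : ℕ, 0 < 1 / ((N : ℝ) + 1) := fun N => Nat.one_div_pos_of_nat
  choose V hV hPV hVP using fun (N : ℕ) i =>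
    exists_finset_convexHull_subset_cthickening (hPne i) (hPcpt i) (hPconv i) (hδ N)
  choose W hW hKW hWK using fun (N : ℕ) i =>
    exists_finset_convexHull_subset_cthickening (hKne i) (hKcpt i) (hKconv i) (hδ N)
  let A : ℕ → Fin n → Fin n → ℝ := fun N a b => mixedVolume (Fin.cons (convexHull ℝ (W N a : Set _))
    (Fin.cons (convexHull ℝ (W N b : Set _)) fun i => convexHull ℝ (V N i : Set _)))
  have hA : ∀ N, (∀ a b, 0 ≤ A N a b) ∧ ∀ x : Fin n → ℝ,
      (∑ a, ∑ b, x a * x b * A N a b) * (∑ a, ∑ b, A N a b) ≤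
        (∑ a, ∑ b, x a * A N a b) ^ 2 := by
    intro N
    classical
    obtain ⟨s, u, B, k, hu, hB, hBc, hBne, hBs, hBp, H⟩ :=
      exists_isCompatible_convexHull (Sum.elim (V N) (W N)) (by
        rintro (i | i)
        · exact hV N i
        · exact hW N i)
    exact alexandrovFenchel_of_isCompatible hu hB hBc hBne hBs hBp
      (fun i => H (Sum.inl i)) (fun i => H (Sum.inr i))
  have hlim : ∀ a b, Tendsto (fun N => A N a b) atTop
      (𝓝 (mixedVolume (Fin.cons (K a) (Fin.cons (K b) P)))) := by
    intro a b
    refine tendsto_mixedVolume (fun i => ?_) tendsto_one_div_add_atTop_nhds_zero_nat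
      (fun N => (hδ N).le) (fun N i => ?_) fun N i => ?_
    · refine Fin.cases (hKcpt a) (fun i => ?_) i
      exact Fin.cases (hKcpt b) hPcpt i
    · refine Fin.cases (hKW N a) (fun i => ?_) i
      exact Fin.cases (hKW N b) (hPV N) i
    · refine Fin.cases (hWK N a) (fun i => ?_) i
      exact Fin.cases (hWK N b) (hVP N) i
  refine ⟨fun a b => ge_of_tendsto' (hlim a b) fun N => (hA N).1 a b, fun x => ?_⟩
  refine le_of_tendsto_of_tendsto' (b := atTop) (Tendsto.mul ?_ ?_) (Tendsto.pow ?_ 2) fun N => (hA N).2 x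
  · exact tendsto_finsetSum _ fun a _ => tendsto_finsetSum _ fun b _ => (hlim a b).const_mul _
  · exact tendsto_finsetSum _ fun a _ => tendsto_finsetSum _ fun b _ => hlim a b
  · exact tendsto_finsetSum _ fun a _ => tendsto_finsetSum _ fun b _ => (hlim a b).const_mul _

end

section
open Matrix

theorem card_pos_eigenvalues_eq_one {n : Type*} [Fintype n] [DecidableEq n] {A : Matrix n n ℝ}
    (hA : A.IsHermitian) (h0 : ∀ a b, 0 ≤ A a b) (hne : A ≠ 0)
    (hsq : ∀ x : n → ℝ, (∑ a, ∑ b, x a * x b * A a b) * (∑ a, ∑ b, A a b) ≤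
      (∑ a, ∑ b, x a * A a b) ^ 2) :
    Fintype.card {i : n // 0 < hA.eigenvalues i} = 1 := by
  have hS : 0 < ∑ a, ∑ b, A a b := by
    have hnn : ∀ a ∈ Finset.univ, 0 ≤ ∑ b, A a b := fun a _ => Finset.sum_nonneg fun b _ => h0 a b
    refine (Finset.sum_nonneg hnn).lt_of_ne fun h => hne ?_
    ext a b
    have h1 := (Finset.sum_eq_zero_iff_of_nonneg hnn).mp h.symm a (Finset.mem_univ a)
    exact (Finset.sum_eq_zero_iff_of_nonneg fun b _ => h0 a b).mp h1 b (Finset.mem_univ b)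
  let v : n → n → ℝ := fun i => (hA.eigenvectorBasis i).ofLp
  have hv : ∀ i, A *ᵥ v i = hA.eigenvalues i • v i := hA.mulVec_eigenvectorBasis
  have horth : ∀ i j, v i ⬝ᵥ v j = if i = j then 1 else 0 := by
    intro i j
    have h := orthonormal_iff_ite.mp hA.eigenvectorBasis.orthonormal j i
    rw [EuclideanSpace.inner_eq_star_dotProduct] at h
    simpa [eq_comm] using h
  have hform : ∀ x : n → ℝ, ∑ a, ∑ b, x a * x b * A a b = x ⬝ᵥ A *ᵥ x := by
    intro x
    simp only [dotProduct, mulVec, Finset.mul_sum]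
    exact Finset.sum_congr rfl fun a _ => Finset.sum_congr rfl fun b _ => by ring
  have hlin : ∀ x : n → ℝ, ∑ a, ∑ b, x a * A a b = x ⬝ᵥ A *ᵥ 1 := by
    intro x
    simp only [dotProduct, mulVec, Finset.mul_sum, Pi.one_apply, mul_one]
  simp only [hform, hlin] at hsq
  obtain ⟨i, hi⟩ : ∃ i, 0 < hA.eigenvalues i := by
    by_contra! hcon
    have htr : ∑ i, hA.eigenvalues i = A.trace := by
      rw [hA.trace_eq_sum_eigenvalues]; rfl
    have h1 : 0 ≤ A.trace := Finset.sum_nonneg fun i _ => h0 i i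
    have h2 := (Finset.sum_eq_zero_iff_of_nonpos fun i _ => hcon i).mp
      (le_antisymm (Finset.sum_nonpos fun i _ => hcon i) (htr ▸ h1))
    exact hne (hA.eigenvalues_eq_zero_iff.mp (funext fun i => h2 i (Finset.mem_univ i)))
  refine Fintype.card_eq_one_iff.mpr ⟨⟨i, hi⟩, fun ⟨j, hj⟩ => Subtype.ext ?_⟩
  by_contra hji
  change j ≠ i at hji
  have hα : v i ⬝ᵥ A *ᵥ 1 ≠ 0 := by
    intro h
    have h1 := hsq (v i)
    rw [h, hv, dotProduct_smul, horth, if_pos rfl, smul_eq_mul, mul_one] at h1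
    nlinarith [mul_pos hi hS]
  have h1 := hsq ((v j ⬝ᵥ A *ᵥ 1) • v i - (v i ⬝ᵥ A *ᵥ 1) • v j)
  have h2 : ((v j ⬝ᵥ A *ᵥ 1) • v i - (v i ⬝ᵥ A *ᵥ 1) • v j) ⬝ᵥ A *ᵥ 1 = 0 := by
    rw [sub_dotProduct, smul_dotProduct, smul_dotProduct, smul_eq_mul, smul_eq_mul]; ring
  rw [h2, mulVec_sub, mulVec_smul, mulVec_smul, hv, hv] at h1
  simp only [sub_dotProduct, dotProduct_sub, smul_dotProduct, dotProduct_smul, horth, smul_eq_mul,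
    if_neg hji, if_neg hji.symm, if_true, mul_zero, mul_one] at h1
  have h3 := mul_pos (mul_pos (mul_self_pos.mpr hα) hj) hS
  have h4 := mul_nonneg (mul_nonneg (mul_self_nonneg (v j ⬝ᵥ A *ᵥ 1)) hi.le) hS.le
  nlinarith

end

/-- let `d = m + 2 ≥ 2`, let `P_1, …, P_{d-2}` and `η_1, …, η_n` be convex bodies
in `ℝ^d`, and let `AF` be the symmetric `n × n` matrix with `AF i j = V(η_i, η_j, P_1, …, P_{d-2})`.
If `AF ≠ 0`, then `AF` has exactly one positive eigenvalue, counted with multiplicity. -/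
theorem mixedVolume_matrix_one_positive_eigenvalue (m n : ℕ)
    (P : Fin m → Set (EuclideanSpace ℝ (Fin (m + 2))))
    (hPne : ∀ i, (P i).Nonempty) (hPcpt : ∀ i, IsCompact (P i)) (hPconv : ∀ i, Convex ℝ (P i))
    (η : Fin n → Set (EuclideanSpace ℝ (Fin (m + 2))))
    (hηne : ∀ i, (η i).Nonempty) (hηcpt : ∀ i, IsCompact (η i)) (hηconv : ∀ i, Convex ℝ (η i))
    (AF : Matrix (Fin n) (Fin n) ℝ)
    (hAF : ∀ i j, AF i j = mixedVolume (Fin.cons (η i) (Fin.cons (η j) P)))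
    (hsymm : AF.IsHermitian) (hnz : AF ≠ 0) :
    Fintype.card {i : Fin n // 0 < hsymm.eigenvalues i} = 1 := by
  obtain ⟨h1, h2⟩ := alexandrovFenchel hPne hPcpt hPconv hηne hηcpt hηconv
  simp only [← hAF] at h1 h2
  exact card_pos_eigenvalues_eq_one hsymm h1 hnz h2
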